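/- Let k be a finite field of characteristic p ≠ 2 and R an algebraically closed field of characteristic different from p. If there exists a selfdual supercuspidal irreducible R-representation of GL_n(k), then either n = 1 or n is even. -/

import Mathlib

open Matrix

section InvariantForms

variable {R : Type} [CommRing R] {G : Type} [Monoid G] {V : Type} [AddCommGroup V] [Module R V]

/-- The space of `H`-invariant `R`-linear forms on a representation `ρ`. -/
def invariantForms (ρ : Representation R G V) (H : Set G) : Submodule R (V →ₗ[R] R) where
  carrier := {φ | ∀ g ∈ H, ∀ v : V, φ (ρ g v) = φ v}
  add_mem' := by
    intro φ ψ hφ hψ g hg v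
    simp only [LinearMap.add_apply, hφ g hg v, hψ g hg v]
  zero_mem' := by intro g hg v; simp
  smul_mem' := by
    intro c φ hφ g hg v
    simp only [LinearMap.smul_apply, hφ g hg v]

/-- A representation is irreducible if it is nonzero and its only invariant submodules
are `⊥` and `⊤`. -/
def IsIrreducibleRep (ρ : Representation R G V) : Prop :=
  (⊥ : Submodule R V) ≠ ⊤ ∧
    ∀ W : Submodule R V, (∀ g : G, ∀ v ∈ W, ρ g v ∈ W) → W = ⊥ ∨ W = ⊤

/-- Two representations are isomorphic if there is an equivariant linear equivalence. -/
def RepIso {W : Type} [AddCommGroup W] [Module R W]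
    (ρ : Representation R G V) (τ : Representation R G W) : Prop :=
  ∃ e : V ≃ₗ[R] W, ∀ (g : G) (v : V), e (ρ g v) = τ g (e v)

/-- `ρ` is (isomorphic to) a subquotient of `τ`:  there is a `τ`-invariant submodule `q`
together with an equivariant surjection from `q` onto the space of `ρ`. -/
def IsSubquotientOf {W : Type} [AddCommGroup W] [Module R W]
    (ρ : Representation R G V) (τ : Representation R G W) : Prop :=
  ∃ (q : Submodule R W) (hq : ∀ g : G, ∀ w ∈ q, τ g w ∈ q) (f : ↥q →ₗ[R] V),
    Function.Surjective f ∧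
      ∀ (g : G) (w : ↥q), f ⟨τ g w.1, hq g w.1 w.2⟩ = ρ g (f w)

end InvariantForms
section RightRegular

variable {R : Type} [CommRing R] {G : Type} [Group G] {V : Type} [AddCommGroup V] [Module R V]

/-- The right-translation representation of `G` on a translation-invariant submodule of
the space of `V`-valued functions on `G`. -/
def rightRegular (C : Submodule R (G → V))
    (hC : ∀ g : G, ∀ f ∈ C, (fun x => f (x * g)) ∈ C) :
    Representation R G ↥C where
  toFun g := LinearMap.restrict
    { toFun := fun (f : G → V) => (fun x => f (x * g))
      map_add' := fun _ _ => rfl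
      map_smul' := fun _ _ => by rfl } (fun f hf => hC g f hf)
  map_one' := by
    apply LinearMap.ext
    intro f
    apply Subtype.ext
    funext x
    simp [LinearMap.restrict_apply]
  map_mul' := by
    intro g g'
    apply LinearMap.ext
    intro f
    apply Subtype.ext
    funext x
    simp [LinearMap.restrict_apply, mul_assoc]

/-- The space of the representation of `G` induced from a representation `τ` of a
subgroup `P`. -/
def indCarrier {W : Type} [AddCommGroup W] [Module R W]
    (P : Subgroup G) (τ : Representation R ↥P W) : Submodule R (G → W) where
  carrier := {f | ∀ (p : ↥P) (g : G), f (↑p * g) = τ p (f g)}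
  add_mem' := by
    intro f₁ f₂ h₁ h₂ p g
    simp [h₁ p g, h₂ p g]
  zero_mem' := by intro p g; simp
  smul_mem' := by
    intro c f hf p g
    simp [hf p g]

/-- The representation of `G` induced from a representation `τ` of a subgroup `P`,
realized on functions `f : G → W` with `f (p * g) = τ p (f g)`, with `G` acting by right
translation. -/
def inducedRep {W : Type} [AddCommGroup W] [Module R W]
    (P : Subgroup G) (τ : Representation R ↥P W) :
    Representation R G ↥(indCarrier P τ) :=
  rightRegular (indCarrier P τ) (by
    intro g f hf p x
    simpa [mul_assoc] using hf p (x * g))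

end RightRegular
section Parabolic

variable (k : Type) [Field k]

/-- The block upper-triangular parabolic subgroup of `GL n k` attached to a
block function `B`. -/
def parabolic (n r : ℕ) (B : Fin n → Fin r) : Subgroup (GL (Fin n) k) where
  carrier := {g | Matrix.BlockTriangular (g : Matrix (Fin n) (Fin n) k) B}
  one_mem' := by
    simpa using Matrix.blockTriangular_one (b := B)
  mul_mem' := by
    intro a b ha hb
    have h : ((a * b : GL (Fin n) k) : Matrix (Fin n) (Fin n) k)
        = (a : Matrix (Fin n) (Fin n) k) * (b : Matrix (Fin n) (Fin n) k) := rfl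
    simpa [Set.mem_setOf_eq, h] using Matrix.BlockTriangular.mul ha hb
  inv_mem' := by
    intro a ha
    have h : ((a⁻¹ : GL (Fin n) k) : Matrix (Fin n) (Fin n) k)
        = (a : Matrix (Fin n) (Fin n) k)⁻¹ := by
      simp [Matrix.coe_units_inv]
    haveI : Invertible (a : Matrix (Fin n) (Fin n) k) := a.invertible
    simpa [Set.mem_setOf_eq, h] using Matrix.blockTriangular_inv_of_blockTriangular ha

/-- A representation of `GL n k` is supercuspidal if it does not occur as a subquotient of
any representation induced from a proper parabolic subgroup, from a representation inflated
from the corresponding block-diagonal Levi subgroup (i.e. trivial on the unipotent radical). -/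
def IsSupercuspidal {R : Type} [CommRing R] {n : ℕ} {V : Type} [AddCommGroup V] [Module R V]
    (ρ : Representation R (GL (Fin n) k) V) : Prop :=
  ∀ (r : ℕ), 2 ≤ r → ∀ B : Fin n → Fin r, Monotone B → Function.Surjective B →
    ∀ (W : Type) [AddCommGroup W] [Module R W],
      ∀ τ : Representation R ↥(parabolic k n r B) W,
        (∀ u : ↥(parabolic k n r B),
            (∀ i j : Fin n, B i = B j →
              ((u : GL (Fin n) k) : Matrix (Fin n) (Fin n) k) i j
                = (1 : Matrix (Fin n) (Fin n) k) i j) → τ u = 1) →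
        ¬ IsSubquotientOf ρ (inducedRep (parabolic k n r B) τ)

end Parabolic

namespace SupercuspidalGL

section Irreducible

variable {K G V : Type} [Field K] [Group G] [AddCommGroup V] [Module K V]
  {ρ : Representation K G V}

theorem nontrivial_of_irreducible (h : IsIrreducibleRep ρ) : Nontrivial V := by
  by_contra hV
  rw [not_nontrivial_iff_subsingleton] at hV
  exact h.1 (Subsingleton.elim _ _)

theorem finiteDimensional_of_irreducible [Finite G] (h : IsIrreducibleRep ρ) :
    FiniteDimensional K V := by
  have := nontrivial_of_irreducible h
  obtain ⟨v, hv⟩ := exists_ne (0 : V)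
  rcases h.2 (Submodule.span K (Set.range fun g => ρ g v)) (by
    intro g w hw
    induction hw using Submodule.span_induction with
    | mem x hx =>
      obtain ⟨g', rfl⟩ := hx
      exact Submodule.subset_span ⟨g * g', by simp⟩
    | zero => simp
    | add x y _ _ hx hy => rw [map_add]; exact add_mem hx hy
    | smul c x _ hx => rw [map_smul]; exact Submodule.smul_mem _ _ hx) with h0 | h1
  · exact absurd ((Submodule.mem_bot K).1 (h0 ▸ Submodule.subset_span ⟨1, by simp⟩)) hv
  · exact ⟨h1 ▸ Submodule.fg_span (Set.finite_range _)⟩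

theorem exists_smul_of_commute [IsAlgClosed K] [FiniteDimensional K V] (h : IsIrreducibleRep ρ)
    (T : V →ₗ[K] V) (hT : ∀ g v, T (ρ g v) = ρ g (T v)) : ∃ c : K, ∀ v, T v = c • v := by
  have := nontrivial_of_irreducible h
  obtain ⟨c, hc⟩ := Module.End.exists_eigenvalue T
  refine ⟨c, ?_⟩
  rcases h.2 (Module.End.eigenspace T c) (fun g v hv => by
    rw [Module.End.mem_eigenspace_iff] at hv ⊢
    rw [hT, hv, map_smul]) with h0 | h1
  · exact absurd h0 hc
  · intro v
    exact Module.End.mem_eigenspace_iff.1 (h1 ▸ Submodule.mem_top)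

variable [Fintype G]

/-- Averaging a rank one endomorphism over the group. -/
theorem finrank_mul_sum_rankOne [IsAlgClosed K] [FiniteDimensional K V] (h : IsIrreducibleRep ρ)
    (f : Module.Dual K V) (y w : V) :
    (Module.finrank K V : K) • ∑ g : G, f (ρ g⁻¹ w) • ρ g y
      = ((Fintype.card G : K) * f y) • w := by
  set T : V →ₗ[K] V := ∑ g : G, ρ g ∘ₗ (f.smulRight y) ∘ₗ ρ g⁻¹ with hTdef
  have hTv : ∀ v, T v = ∑ g : G, f (ρ g⁻¹ v) • ρ g y := by
    intro v; simp [hTdef]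
  obtain ⟨c, hc⟩ := exists_smul_of_commute h T (by
    intro g v
    rw [hTv, hTv, map_sum]
    rw [← Equiv.sum_comp (Equiv.mulLeft g)]
    refine Finset.sum_congr rfl fun a _ => ?_
    simp [← Module.End.mul_apply, ← map_mul])
  have htr : LinearMap.trace K V T = Fintype.card G * f y := by
    rw [hTdef, map_sum, Finset.sum_congr rfl (g := fun _ => f y)]
    · simp
    · intro g _
      rw [LinearMap.trace_comp_comm', LinearMap.comp_assoc, ← Module.End.mul_eq_comp (ρ g⁻¹),
        ← map_mul]
      simp [Module.End.one_eq_id, LinearMap.trace_smulRight]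
  have hT : T = c • LinearMap.id := by ext v; simp [hc]
  rw [hT, map_smul, LinearMap.trace_id, smul_eq_mul] at htr
  rw [← hTv, hc, smul_smul, mul_comm, htr]

/-- A vanishing Frobenius-Schur indicator excludes nonzero invariant bilinear forms. -/
theorem bilin_eq_zero_of_sum_char_sq [IsAlgClosed K] [CharZero K] [FiniteDimensional K V]
    (h : IsIrreducibleRep ρ) (B : V →ₗ[K] V →ₗ[K] K) (hB : ∀ g x y, B (ρ g x) (ρ g y) = B x y)
    (hχ : ∑ g : G, ρ.character (g ^ 2) = 0) : B = 0 := by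
  have hnt := nontrivial_of_irreducible h
  have hd : (Module.finrank K V : K) ≠ 0 := by
    exact_mod_cast (Module.finrank_pos (R := K) (M := V)).ne'
  set S : V →ₗ[K] V := ∑ g : G, ρ (g ^ 2) with hS
  have hS0 : S = 0 := by
    obtain ⟨c, hc⟩ := exists_smul_of_commute h S (by
      intro g v
      simp only [hS, LinearMap.sum_apply, map_sum]
      rw [← Equiv.sum_comp (MulAut.conj g).toEquiv]
      refine Finset.sum_congr rfl fun a _ => ?_
      simp only [← Module.End.mul_apply, ← map_mul]
      congr 2
      simp [pow_two, mul_assoc])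
    have hT : S = c • LinearMap.id := by ext v; simp [hc]
    have htr : LinearMap.trace K V S = 0 := by
      rw [hS, map_sum]; exact hχ
    rw [hT, map_smul, LinearMap.trace_id, smul_eq_mul] at htr
    rw [hT, (mul_eq_zero.1 htr).resolve_right hd, zero_smul]
  have key : ∀ x y, (Fintype.card G : K) * B y x = 0 := by
    intro x y
    let b := Module.finBasis K V
    have h1 : ∑ g : G, B (ρ g⁻¹ x) (ρ g y) = 0 := by
      have : ∑ g : G, B (ρ g⁻¹ x) (ρ g y) = B x (S y) := by
        simp only [hS, LinearMap.sum_apply, map_sum]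
        refine Finset.sum_congr rfl fun g _ => ?_
        rw [← hB g, ← Module.End.mul_apply, ← map_mul, ← Module.End.mul_apply, ← map_mul]
        simp [pow_two]
      rw [this, hS0]; simp
    have h2 : ∑ g : G, B (ρ g⁻¹ x) (ρ g y)
        = ∑ i, B (b i) (∑ g : G, b.coord i (ρ g⁻¹ x) • ρ g y) := by
      simp only [map_sum, map_smul]
      rw [Finset.sum_comm]
      refine Finset.sum_congr rfl fun g _ => ?_
      conv_lhs => rw [← b.sum_repr (ρ g⁻¹ x)]
      simp only [map_sum, map_smul, LinearMap.sum_apply, LinearMap.smul_apply, b.coord_apply]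
    have h3 : (Module.finrank K V : K) * ∑ g : G, B (ρ g⁻¹ x) (ρ g y)
        = Fintype.card G * B y x := by
      rw [h2, Finset.mul_sum]
      conv_rhs => rw [← b.sum_repr y]
      simp only [map_sum (B), map_smul B, LinearMap.sum_apply, LinearMap.smul_apply, Finset.mul_sum]
      refine Finset.sum_congr rfl fun i _ => ?_
      rw [← smul_eq_mul, ← map_smul, finrank_mul_sum_rankOne h]
      simp [mul_assoc]
    rw [← h3, h1, mul_zero]
  ext y x
  have := key x y
  rw [mul_eq_zero] at this
  exact this.resolve_left (by exact_mod_cast Fintype.card_ne_zero)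

end Irreducible

section Cuspidal

/-- `r` has no nonzero vector fixed by a member of the family `S` of subgroups. -/
def IsCuspidalFor {K Γ M : Type} [Field K] [Group Γ] [AddCommGroup M] [Module K M]
    (S : Set (Subgroup Γ)) (r : Representation K Γ M) : Prop :=
  ∀ N ∈ S, ∀ v : M, (∀ g ∈ N, r g v = v) → v = 0

/-- The two properties of cuspidal representations on which the parity argument rests. -/
structure CuspidalVanishing (K : Type) {Γ : Type} [Field K] [Group Γ]
    (S : Set (Subgroup Γ)) : Prop where
  trace_eq_zero : ∀ (M : Type) [AddCommGroup M] [Module K M] [FiniteDimensional K M]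
    (r : Representation K Γ M), IsCuspidalFor S r → ∀ x : Γ, Even (orderOf x) →
      LinearMap.trace K M (r x) = 0
  eq_zero_of_fixed : ∀ (M : Type) [AddCommGroup M] [Module K M] [FiniteDimensional K M]
    (r : Representation K Γ M), IsCuspidalFor S r → ∀ ε : Γ, ε ^ 2 = 1 → ∀ v : M,
      (∀ c, Commute c ε → r c v = v) → v = 0

variable {K Γ : Type} [Field K] [Group Γ] {S : Set (Subgroup Γ)}

open Classical in
theorem card_sqrt_eq_card_involutions [Fintype Γ] {x : Γ} (hx : Odd (orderOf x)) :
    (Finset.univ.filter fun y : Γ => y ^ 2 = x).card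
      = (Finset.univ.filter fun ε : Γ => ε ^ 2 = 1 ∧ Commute x ε).card := by
  obtain ⟨m, hm⟩ := hx
  set h := x ^ (m + 1) with hh
  have hh2 : h ^ 2 = x := by
    rw [hh, ← pow_mul, show (m + 1) * 2 = (2 * m + 1) + 1 by ring, ← hm, pow_succ,
      pow_orderOf_eq_one, one_mul]
  refine Finset.card_bij' (fun y _ => y * h⁻¹) (fun ε _ => ε * h) ?_ ?_ ?_ ?_
  · intro y hy
    simp only [Finset.mem_filter, Finset.mem_univ, true_and] at hy ⊢
    have hxy : Commute x y := by rw [← hy]; exact (Commute.refl y).pow_left 2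
    have hhy : Commute h y := hxy.pow_left _
    refine ⟨?_, ?_⟩
    · rw [(hhy.inv_left.symm).mul_pow, hy, inv_pow, hh2, mul_inv_cancel]
    · exact hxy.mul_right (((Commute.refl x).pow_right _).inv_right)
  · intro ε hε
    simp only [Finset.mem_filter, Finset.mem_univ, true_and] at hε ⊢
    have : Commute h ε := hε.2.pow_left _
    rw [this.symm.mul_pow, hε.1, hh2, one_mul]
  · intro y _; simp
  · intro y _; simp

open Classical in
theorem CuspidalVanishing.sum_char_sq [Fintype Γ] (hS : CuspidalVanishing K S)
    {M : Type} [AddCommGroup M] [Module K M] [FiniteDimensional K M]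
    {r : Representation K Γ M} (hr : IsCuspidalFor S r) :
    ∑ y : Γ, r.character (y ^ 2) = 0 := by
  have h1 : ∑ y : Γ, r.character (y ^ 2)
      = ∑ x : Γ, ∑ y : Γ, if y ^ 2 = x then r.character x else 0 := by
    rw [Finset.sum_comm]; simp
  have h2 : ∀ x : Γ, (∑ y : Γ, if y ^ 2 = x then r.character x else 0)
      = ∑ ε : Γ, if ε ^ 2 = 1 ∧ Commute x ε then r.character x else 0 := by
    intro x
    rcases Nat.even_or_odd (orderOf x) with hx | hx
    · have : r.character x = 0 := hS.trace_eq_zero M r hr x hx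
      simp [this]
    · rw [← Finset.sum_filter, ← Finset.sum_filter, Finset.sum_const, Finset.sum_const,
        card_sqrt_eq_card_involutions hx]
  rw [h1, Finset.sum_congr rfl fun x _ => h2 x, Finset.sum_comm]
  refine Finset.sum_eq_zero fun ε _ => ?_
  by_cases hε : ε ^ 2 = 1
  · have hz : ∑ x ∈ Finset.univ.filter (fun x : Γ => Commute x ε), r x = 0 := by
      ext v
      refine hS.eq_zero_of_fixed M r hr ε hε _ fun c hc => ?_
      simp only [LinearMap.sum_apply, map_sum]
      refine Finset.sum_bij' (fun x _ => c * x) (fun x _ => c⁻¹ * x) ?_ ?_ ?_ ?_ ?_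
      · intro x hx
        simp only [Finset.mem_filter, Finset.mem_univ, true_and] at hx ⊢
        exact hc.mul_left hx
      · intro x hx
        simp only [Finset.mem_filter, Finset.mem_univ, true_and] at hx ⊢
        exact hc.inv_left.mul_left hx
      · simp
      · simp
      · simp
    simp only [hε, true_and]
    rw [← Finset.sum_filter]
    simp only [Representation.character]
    rw [← map_sum, hz, map_zero]
  · simp [hε]

/-- In characteristic zero an irreducible cuspidal representation carries no nonzero invariant
bilinear form. -/
theorem CuspidalVanishing.bilin_eq_zero [Finite Γ] [IsAlgClosed K] [CharZero K]
    (hS : CuspidalVanishing K S)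
    {M : Type} [AddCommGroup M] [Module K M] {r : Representation K Γ M}
    (hirr : IsIrreducibleRep r) (hr : IsCuspidalFor S r)
    (B : M →ₗ[K] M →ₗ[K] K) (hB : ∀ g x y, B (r g x) (r g y) = B x y) : B = 0 := by
  have := Fintype.ofFinite Γ
  have := finiteDimensional_of_irreducible hirr
  exact bilin_eq_zero_of_sum_char_sq hirr B hB (hS.sum_char_sq hr)

end Cuspidal

section Decomposition

variable {K Γ M : Type} [Field K] [Group Γ] [AddCommGroup M] [Module K M]
  {r : Representation K Γ M}

theorem exists_invariant_isCompl [Finite Γ] [CharZero K] (W : Submodule K M)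
    (hW : ∀ g, W ≤ W.comap (r g)) :
    ∃ W' : Submodule K M, (∀ g, W' ≤ W'.comap (r g)) ∧ IsCompl W W' := by
  have : NeZero (Nat.card Γ : K) := ⟨by exact_mod_cast Nat.card_pos.ne'⟩
  have hss : IsSemisimpleModule (MonoidAlgebra K Γ) r.asModule := inferInstance
  have := (Representation.isSemisimpleRepresentation_iff_isSemisimpleModule_asModule r).2 hss
  obtain ⟨W', hc⟩ := exists_isCompl (⟨W, fun g v hv => hW g hv⟩ : Subrepresentation r)
  refine ⟨W'.toSubmodule, fun g v hv => W'.apply_mem_toSubmodule g hv, ?_⟩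
  rw [isCompl_iff, disjoint_iff, codisjoint_iff] at hc ⊢
  exact ⟨congrArg Subrepresentation.toSubmodule hc.1, congrArg Subrepresentation.toSubmodule hc.2⟩

theorem character_eq_add_of_isCompl [FiniteDimensional K M] {W W' : Submodule K M}
    (hW : ∀ g, W ≤ W.comap (r g)) (hW' : ∀ g, W' ≤ W'.comap (r g)) (hc : IsCompl W W') (g : Γ) :
    r.character g = (r.subrepresentation W hW).character g
      + (r.subrepresentation W' hW').character g := by
  simp only [Representation.character]
  rw [← LinearMap.trace_prodMap', ← LinearMap.trace_conj' _ (Submodule.prodEquivOfIsCompl W W' hc)]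
  congr 1
  ext v
  obtain ⟨v, rfl⟩ := (Submodule.prodEquivOfIsCompl W W' hc).surjective v
  simp [LinearEquiv.conj_apply]

theorem IsCuspidalFor.subrepresentation {S : Set (Subgroup Γ)} (hr : IsCuspidalFor S r)
    {W : Submodule K M} (hW : ∀ g, W ≤ W.comap (r g)) :
    IsCuspidalFor S (r.subrepresentation W hW) := by
  intro N hN v hv
  exact Subtype.ext (hr N hN v fun g hg => congrArg Subtype.val (hv g hg))

theorem exists_irreducible_subrepresentation [FiniteDimensional K M] [Nontrivial M] :
    ∃ (W : Submodule K M) (hW : ∀ g, W ≤ W.comap (r g)), W ≠ ⊥ ∧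
      IsIrreducibleRep (r.subrepresentation W hW) := by
  classical
  have hex : ∃ n, ∃ W : Submodule K M, (∀ g, W ≤ W.comap (r g)) ∧ W ≠ ⊥ ∧
      Module.finrank K W = n := ⟨_, ⊤, fun g => by simp, top_ne_bot, rfl⟩
  obtain ⟨W, hW, hW0, hWn⟩ := Nat.find_spec hex
  refine ⟨W, hW, hW0, ?_, ?_⟩
  · intro h
    have := (Submodule.subsingleton_iff K).1 (subsingleton_of_bot_eq_top h)
    exact hW0 (Submodule.eq_bot_of_subsingleton)
  · intro U hU
    by_cases hU0 : U = ⊥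
    · exact Or.inl hU0
    right
    have hmap : U.map W.subtype ≠ ⊥ := by
      intro h
      exact hU0 (Submodule.map_injective_of_injective W.subtype_injective (by simpa using h))
    have hle := Nat.find_min' hex ⟨U.map W.subtype, by
      rintro g _ ⟨u, hu, rfl⟩
      exact ⟨_, hU g u hu, rfl⟩, hmap, rfl⟩
    rw [LinearEquiv.finrank_eq (Submodule.equivMapOfInjective W.subtype W.subtype_injective U).symm,
      ← hWn] at hle
    exact Submodule.eq_top_of_finrank_eq (le_antisymm (Submodule.finrank_le U) hle)

theorem irreducible_dual [FiniteDimensional K M] (h : IsIrreducibleRep r) :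
    IsIrreducibleRep r.dual := by
  have := nontrivial_of_irreducible h
  refine ⟨bot_ne_top, fun W hW => ?_⟩
  rcases h.2 W.dualCoannihilator (fun g v hv => by
    rw [Submodule.mem_dualCoannihilator] at hv ⊢
    intro φ hφ
    have := hv _ (hW g⁻¹ φ hφ)
    simpa [Representation.dual_apply, Module.Dual.transpose_apply] using this) with h0 | h1
  · right
    rw [← Subspace.dualCoannihilator_dualAnnihilator_eq (W := W), h0,
      Submodule.dualAnnihilator_bot]
  · left
    rw [← Subspace.dualCoannihilator_dualAnnihilator_eq (W := W), h1,
      Submodule.dualAnnihilator_top]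

/-- A nonzero intertwining map exists as soon as the character pairing is nonzero. -/
theorem exists_intertwining_of_sum_ne_zero [Fintype Γ] [CharZero K] [FiniteDimensional K M]
    {N : Type} [AddCommGroup N] [Module K N] [FiniteDimensional K N] {s : Representation K Γ N}
    (h : ∑ g, s.character g * r.character g⁻¹ ≠ 0) :
    ∃ f : M →ₗ[K] N, f ≠ 0 ∧ ∀ g v, f (r g v) = s g (f v) := by
  have : Invertible (Nat.card Γ : K) :=
    invertibleOfNonzero (by exact_mod_cast Nat.card_pos.ne')
  by_contra! hcon
  have hsub : Subsingleton (Representation.IntertwiningMap r s) := by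
    refine subsingleton_of_forall_eq 0 fun f => ?_
    have h0 : f.toLinearMap = 0 := by
      by_contra hf
      obtain ⟨g, v, hgv⟩ := hcon f.toLinearMap hf
      exact hgv (LinearMap.congr_fun (f.isIntertwining' g) v)
    ext v
    exact LinearMap.congr_fun h0 v
  have := Representation.card_inv_mul_sum_char_mul_char_eq_finrank r s
  rw [Module.finrank_zero_of_subsingleton, Nat.cast_zero] at this
  rcases mul_eq_zero.1 this with h1 | h1
  · exact inv_ne_zero (by exact_mod_cast Nat.card_pos.ne') h1
  · exact h h1

theorem sum_character_mul_ne_zero_of_intertwining [Fintype Γ] [CharZero K] [FiniteDimensional K M]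
    {N : Type} [AddCommGroup N] [Module K N] [FiniteDimensional K N] {s : Representation K Γ N}
    (f : M →ₗ[K] N) (hf : f ≠ 0) (hfg : ∀ g v, f (r g v) = s g (f v)) :
    ∑ g, s.character g * r.character g⁻¹ ≠ 0 := by
  have : Invertible (Nat.card Γ : K) :=
    invertibleOfNonzero (by exact_mod_cast Nat.card_pos.ne')
  intro h0
  have := Representation.card_inv_mul_sum_char_mul_char_eq_finrank r s
  rw [h0, mul_zero, eq_comm, Nat.cast_eq_zero] at this
  have hfin : FiniteDimensional K (Representation.IntertwiningMap r s) :=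
    FiniteDimensional.of_injective
      ({ toFun := fun φ => φ.toLinearMap
         map_add' := fun _ _ => rfl
         map_smul' := fun _ _ => rfl } :
        Representation.IntertwiningMap r s →ₗ[K] M →ₗ[K] N) (fun φ ψ h => by
          ext v; exact LinearMap.congr_fun h v)
  rw [Module.finrank_zero_iff] at this
  have hz := Subsingleton.elim (f.intertwiningMap_of_isIntertwiningMap r s hfg) 0
  exact hf (congrArg Representation.IntertwiningMap.toLinearMap hz)

end Decomposition

section Integrality

variable {K Γ M : Type} [Field K] [Group Γ] [AddCommGroup M] [Module K M]
  {r : Representation K Γ M}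

/-- The scalar by which a class sum with integral coefficients acts is integral. -/
theorem isIntegral_of_sum_smul_eq [Fintype Γ] [Nontrivial M] (b : Γ → K)
    (hb : ∀ g, IsIntegral ℤ (b g)) (c : K) (hc : ∀ v, ∑ g, b g • r g v = c • v) :
    IsIntegral ℤ c := by
  let A := integralClosure ℤ K
  let φ : MonoidAlgebra A Γ →ₐ[A] Module.End K M :=
    MonoidAlgebra.lift A (Module.End K M) Γ r
  let β : MonoidAlgebra A Γ := ∑ g, MonoidAlgebra.single g (⟨b g, hb g⟩ : A)
  have hfin : Module.Finite A (MonoidAlgebra A Γ) :=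
    Module.Finite.of_basis (Module.Basis.ofRepr (MonoidAlgebra.coeffLinearEquiv A))
  have hβ : IsIntegral A β := IsIntegral.of_finite A β
  have h1 : φ β = algebraMap K (Module.End K M) c := by
    ext v
    simp only [φ, β, map_sum, MonoidAlgebra.lift_single, LinearMap.sum_apply,
      LinearMap.smul_apply, Module.algebraMap_end_apply]
    rw [← hc]
    rfl
  have h2 : IsIntegral A (algebraMap K (Module.End K M) c) := h1 ▸ hβ.map φ
  rw [isIntegral_algebraMap_iff (FaithfulSMul.algebraMap_injective K (Module.End K M))] at h2
  exact isIntegral_trans c h2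

variable [Fintype Γ] [CharZero K] {S : Set (Subgroup Γ)}

theorem CuspidalVanishing.card_dvd_finrank (hS : CuspidalVanishing K S) [FiniteDimensional K M]
    (hr : IsCuspidalFor S r) {Q : Subgroup Γ} (hQ : IsPGroup 2 Q) :
    Nat.card Q ∣ Module.finrank K M := by
  classical
  have : Invertible (Nat.card Q : K) :=
    invertibleOfNonzero (by exact_mod_cast Nat.card_pos.ne')
  have h := Representation.card_inv_mul_sum_char_eq_finrank (r.comp Q.subtype)
  have h1 : ∑ g : Q, Representation.character (r.comp Q.subtype) g = Module.finrank K M := by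
    rw [Finset.sum_eq_single 1]
    · simp
    · intro g _ hg
      refine hS.trace_eq_zero M r hr g ?_
      rw [Subgroup.orderOf_coe]
      obtain ⟨j, hj⟩ := (IsPGroup.iff_orderOf.1 hQ) g
      rw [hj]
      have : j ≠ 0 := by
        rintro rfl
        exact hg (orderOf_eq_one_iff.1 (by simpa using hj))
      exact (Nat.even_pow' this).2 even_two
    · simp
  rw [h1, inv_mul_eq_iff_eq_mul₀ (by exact_mod_cast Nat.card_pos.ne')] at h
  exact ⟨_, by exact_mod_cast h⟩

theorem CuspidalVanishing.sum_irreducible_character_mul [IsAlgClosed K]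
    (hS : CuspidalVanishing K S) (hirr : IsIrreducibleRep r) (hr : IsCuspidalFor S r)
    {Q : Subgroup Γ} (hQ : IsPGroup 2 Q)
    (b : Γ → K) (hb : ∀ g, IsIntegral ℤ (b g)) (hconj : ∀ x g, b (x * g * x⁻¹) = b g) :
    ∃ t, IsIntegral ℤ t ∧ ∑ g, r.character g * b g = Nat.card Q * t := by
  have := nontrivial_of_irreducible hirr
  have := finiteDimensional_of_irreducible hirr
  obtain ⟨c, hc⟩ := exists_smul_of_commute hirr (∑ g, b g • r g) (by
    intro x v
    simp only [LinearMap.sum_apply, LinearMap.smul_apply, map_sum, map_smul]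
    rw [← Equiv.sum_comp (MulAut.conj x).toEquiv]
    refine Finset.sum_congr rfl fun a _ => ?_
    simp [hconj, ← Module.End.mul_apply, ← map_mul])
  have hci : IsIntegral ℤ c := isIntegral_of_sum_smul_eq (r := r) b hb c (by simpa using hc)
  obtain ⟨m, hm⟩ := hS.card_dvd_finrank hr hQ
  refine ⟨m * c, (isIntegral_natCast m).mul hci, ?_⟩
  have hT : (∑ g, b g • r g) = c • LinearMap.id := by ext v; simp [← hc]
  have htr := congrArg (LinearMap.trace K M) hT
  rw [map_sum, map_smul, LinearMap.trace_id, hm] at htr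
  simp only [map_smul, smul_eq_mul] at htr
  simp only [Representation.character, mul_comm _ (b _), htr]
  push_cast; ring

/-- Two irreducible cuspidal constituents exchanged by duality contribute twice the same amount,
and none is selfdual. -/
theorem CuspidalVanishing.sum_real_character_mul [IsAlgClosed K]
    (hS : CuspidalVanishing K S) {Q : Subgroup Γ} (hQ : IsPGroup 2 Q)
    (b : Γ → K) (hb : ∀ g, IsIntegral ℤ (b g)) (hconj : ∀ x g, b (x * g * x⁻¹) = b g)
    (hinv : ∀ g, b g⁻¹ = b g) (d : ℕ) :
    ∀ (M : Type) [AddCommGroup M] [Module K M] [FiniteDimensional K M]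
      (r : Representation K Γ M), Module.finrank K M = d → IsCuspidalFor S r →
      (∀ g, r.character g⁻¹ = r.character g) →
      ∃ t, IsIntegral ℤ t ∧ ∑ g, r.character g * b g = 2 * Nat.card Q * t := by
  induction d using Nat.strong_induction_on with
  | _ d ih =>
  intro M _ _ _ r hd hr hreal
  rcases subsingleton_or_nontrivial M with hM | hM
  · refine ⟨0, isIntegral_zero, ?_⟩
    have : ∀ g, r.character g = 0 := fun g => by
      rw [Representation.character, Subsingleton.elim (r g) 0, map_zero]
    simp [this]
  obtain ⟨W, hW, hW0, hirr⟩ := exists_irreducible_subrepresentation (r := r)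
  set σ := r.subrepresentation W hW with hσ
  obtain ⟨W₁, hW₁, hc⟩ := exists_invariant_isCompl W hW
  set s := r.subrepresentation W₁ hW₁ with hs
  have hadd : ∀ g, r.character g = σ.character g + s.character g :=
    character_eq_add_of_isCompl hW hW₁ hc
  have hσc : IsCuspidalFor S σ := hr.subrepresentation hW
  have hsc : IsCuspidalFor S s := hr.subrepresentation hW₁
  have hpair : ∑ g, s.character g * σ.dual.character g⁻¹ ≠ 0 := by
    have h1 : ∑ g, r.character g * σ.character g⁻¹ ≠ 0 :=
      sum_character_mul_ne_zero_of_intertwining W.subtype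
        (fun h => hW0 (by rw [← W.range_subtype, h, LinearMap.range_zero])) (fun _ _ => rfl)
    have h2 : ∑ g, r.character g * σ.character g ≠ 0 := by
      rw [← Equiv.sum_comp (Equiv.inv Γ)]
      simpa [hreal] using h1
    have h3 : ∑ g, σ.character g * σ.character g = 0 := by
      by_contra hne
      obtain ⟨f, hf0, hf⟩ := exists_intertwining_of_sum_ne_zero (r := σ) (s := σ.dual) (by
        rw [← Equiv.sum_comp (Equiv.inv Γ)]
        simpa using hne)
      refine hf0 (hS.bilin_eq_zero hirr hσc f fun g x y => ?_)
      rw [hf]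
      simp [Representation.dual_apply, Module.Dual.transpose_apply]
    simp only [hadd, add_mul, Finset.sum_add_distrib, h3, zero_add] at h2
    simpa using h2
  obtain ⟨f, hf0, hf⟩ := exists_intertwining_of_sum_ne_zero hpair
  have hfinj : Function.Injective f := by
    rw [← LinearMap.ker_eq_bot]
    refine ((irreducible_dual hirr).2 f.ker fun g v hv => ?_).resolve_right fun h =>
      hf0 (LinearMap.ker_eq_top.1 h)
    rw [LinearMap.mem_ker] at hv ⊢
    rw [hf, hv, map_zero]
  have hU : ∀ g, f.range ≤ f.range.comap (s g) := by
    rintro g _ ⟨v, rfl⟩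
    exact ⟨σ.dual g v, hf g v⟩
  obtain ⟨W₂, hW₂, hc₂⟩ := exists_invariant_isCompl f.range hU
  have hadd₂ : ∀ g, s.character g
      = (s.subrepresentation _ hU).character g + (s.subrepresentation W₂ hW₂).character g :=
    character_eq_add_of_isCompl hU hW₂ hc₂
  have hchar : ∀ g, (s.subrepresentation _ hU).character g = σ.character g⁻¹ := by
    intro g
    rw [← Representation.char_dual]
    simp only [Representation.character]
    rw [← LinearMap.trace_conj' _ (LinearEquiv.ofInjective f hfinj)]
    congr 1
    ext v
    obtain ⟨v, rfl⟩ := (LinearEquiv.ofInjective f hfinj).surjective v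
    simp [LinearEquiv.conj_apply, ← hf, Representation.dual_apply]
  have hlt : Module.finrank K W₂ < d := by
    have h1 : Module.finrank K W + Module.finrank K W₁ = Module.finrank K M :=
      Submodule.finrank_add_eq_of_isCompl hc
    have h2 : Module.finrank K W₂ ≤ Module.finrank K W₁ := W₂.finrank_le
    have h3 : 0 < Module.finrank K W := by
      have := nontrivial_of_irreducible hirr
      exact Module.finrank_pos
    omega
  obtain ⟨t₂, ht₂, hsum₂⟩ := ih _ hlt W₂ (s.subrepresentation W₂ hW₂) rfl
    (hsc.subrepresentation hW₂) (fun g => by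
      have h1 := hadd g⁻¹
      have h2 := hadd g
      rw [hadd₂, hchar] at h1 h2
      rw [hreal, inv_inv, h2] at h1
      linear_combination -h1)
  obtain ⟨t₁, ht₁, hsum₁⟩ := hS.sum_irreducible_character_mul hirr hσc hQ b hb hconj
  refine ⟨t₁ + t₂, ht₁.add ht₂, ?_⟩
  have h' : ∑ g, σ.character g⁻¹ * b g = Nat.card Q * t₁ := by
    rw [← Equiv.sum_comp (Equiv.inv Γ)]
    simpa [hinv] using hsum₁
  simp only [hadd, hadd₂, hchar, add_mul, Finset.sum_add_distrib]
  rw [hsum₁, hsum₂, h']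
  ring

end Integrality

section Unipotent

variable {k : Type} [Field k] {n : ℕ}

/-- The subgroup of matrices acting trivially on `W` and on the quotient by `W`. -/
def unipotentRadical (W : Submodule k (Fin n → k)) : Subgroup (GL (Fin n) k) where
  carrier := {g | (∀ w ∈ W, g.1 *ᵥ w = w) ∧ ∀ v, g.1 *ᵥ v - v ∈ W}
  one_mem' := by simp
  mul_mem' := by
    rintro a b ⟨ha, ha'⟩ ⟨hb, hb'⟩
    refine ⟨fun w hw => ?_, fun v => ?_⟩
    · rw [Units.val_mul, ← Matrix.mulVec_mulVec, hb w hw, ha w hw]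
    · rw [Units.val_mul, ← Matrix.mulVec_mulVec]
      simpa using add_mem (ha' (b.1 *ᵥ v)) (hb' v)
  inv_mem' := by
    rintro a ⟨ha, ha'⟩
    have hinv : ∀ w ∈ W, (a⁻¹).1 *ᵥ w = w := fun w hw => by
      conv_lhs => rw [← ha w hw]
      rw [Matrix.mulVec_mulVec, ← Units.val_mul, inv_mul_cancel, Units.val_one, Matrix.one_mulVec]
    refine ⟨hinv, fun v => ?_⟩
    have h := ha' ((a⁻¹).1 *ᵥ v)
    rw [Matrix.mulVec_mulVec, ← Units.val_mul, mul_inv_cancel, Units.val_one,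
      Matrix.one_mulVec] at h
    simpa using neg_mem h

theorem mem_unipotentRadical {W : Submodule k (Fin n → k)} {g : GL (Fin n) k} :
    g ∈ unipotentRadical W ↔ (∀ w ∈ W, g.1 *ᵥ w = w) ∧ ∀ v, g.1 *ᵥ v - v ∈ W := Iff.rfl

theorem conj_mem_unipotentRadical {W : Submodule k (Fin n → k)} {g x : GL (Fin n) k}
    (hg : g ∈ unipotentRadical W) (hx : ∀ w ∈ W, x.1 *ᵥ w ∈ W)
    (hx' : ∀ w ∈ W, (x⁻¹).1 *ᵥ w ∈ W) : x⁻¹ * g * x ∈ unipotentRadical W := by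
  refine ⟨fun w hw => ?_, fun v => ?_⟩
  · rw [Units.val_mul, Units.val_mul, ← Matrix.mulVec_mulVec, ← Matrix.mulVec_mulVec,
      hg.1 _ (hx w hw), Matrix.mulVec_mulVec, ← Units.val_mul, inv_mul_cancel, Units.val_one,
      Matrix.one_mulVec]
  · have h := hx' _ (hg.2 (x.1 *ᵥ v))
    rwa [Matrix.mulVec_sub, Matrix.mulVec_mulVec, Matrix.mulVec_mulVec, Matrix.mulVec_mulVec,
      ← Units.val_mul x⁻¹ g, ← Units.val_mul, ← Units.val_mul x⁻¹ x, inv_mul_cancel, Units.val_one,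
      Matrix.one_mulVec] at h

/-- The unit `1 + X` for `X` of square zero. -/
def oneAddSqZero (X : Matrix (Fin n) (Fin n) k) (hX : X * X = 0) : GL (Fin n) k where
  val := 1 + X
  inv := 1 - X
  val_inv := by noncomm_ring; simp [hX]
  inv_val := by noncomm_ring; simp [hX]

theorem sq_sub_one_eq_zero {W : Submodule k (Fin n → k)} {g : GL (Fin n) k}
    (hg : g ∈ unipotentRadical W) : (g.1 - 1) * (g.1 - 1) = 0 := by
  refine Matrix.toLin'.injective (LinearMap.ext fun v => ?_)
  rw [Matrix.toLin'_apply, ← Matrix.mulVec_mulVec]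
  have h := hg.1 _ (hg.2 v)
  simp only [Matrix.sub_mulVec, Matrix.one_mulVec] at h ⊢
  rw [h]; simp

/-- A representation of `GL n k` without nonzero vectors fixed by unipotent radicals. -/
def IsCuspidalGL {K M : Type} [Field K] [AddCommGroup M] [Module K M]
    (s : Representation K (GL (Fin n) k) M) : Prop :=
  ∀ W : Submodule k (Fin n → k), W ≠ ⊥ → W ≠ ⊤ →
    ∀ v, (∀ g ∈ unipotentRadical W, s g v = v) → v = 0

/-- The `+1` eigenspace of a matrix. -/
def fixedSpace (ε : Matrix (Fin n) (Fin n) k) : Submodule k (Fin n → k) :=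
  LinearMap.ker (Matrix.mulVecLin (ε - 1))

theorem mem_fixedSpace {ε : Matrix (Fin n) (Fin n) k} {v : Fin n → k} :
    v ∈ fixedSpace ε ↔ ε *ᵥ v = v := by
  simp [fixedSpace, sub_eq_zero]

theorem matrix_eq_of_mulVec {A B : Matrix (Fin n) (Fin n) k} (h : ∀ v, A *ᵥ v = B *ᵥ v) :
    A = B :=
  Matrix.toLin'.injective (LinearMap.ext fun v => h v)

theorem fixedSpace_ne_top {ε : Matrix (Fin n) (Fin n) k} (h : ε ≠ 1) : fixedSpace ε ≠ ⊤ := by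
  intro ht
  refine h (matrix_eq_of_mulVec fun v => ?_)
  rw [Matrix.one_mulVec]
  exact mem_fixedSpace.1 (ht ▸ Submodule.mem_top)

theorem fixedSpace_ne_bot {ε : Matrix (Fin n) (Fin n) k} (hε : ε * ε = 1) (h : ε ≠ -1) :
    fixedSpace ε ≠ ⊥ := by
  intro hb
  refine h (matrix_eq_of_mulVec fun v => ?_)
  have hv : v + ε *ᵥ v ∈ fixedSpace ε := by
    rw [mem_fixedSpace, Matrix.mulVec_add, Matrix.mulVec_mulVec, hε, Matrix.one_mulVec, add_comm]
  rw [hb, Submodule.mem_bot] at hv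
  rw [Matrix.neg_mulVec, Matrix.one_mulVec, eq_neg_iff_add_eq_zero, add_comm, hv]

/-- For odd `n`, an element whose square is central is a scalar multiple of an involution. -/
theorem exists_involution_of_sq_mem_center (hn : Odd n) (u : GL (Fin n) k)
    (hu : u ^ 2 ∈ Subgroup.center (GL (Fin n) k)) :
    ∃ (η : kˣ) (ε : GL (Fin n) k), ε * ε = 1 ∧
      u = Matrix.GeneralLinearGroup.scalar (Fin n) η * ε := by
  obtain ⟨j, hj⟩ := hn
  rw [Matrix.GeneralLinearGroup.center_eq_range_scalar] at hu
  obtain ⟨ζ, hζ⟩ := hu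
  set δ := Matrix.GeneralLinearGroup.det u
  have hdet : δ ^ 2 = ζ ^ n := by
    rw [← map_pow, ← hζ]
    ext
    simp
  set η := δ * (ζ ^ j)⁻¹ with hη
  have hη2 : η ^ 2 = ζ := by
    rw [hη, mul_pow, hdet, hj, inv_pow, ← pow_mul, mul_comm j 2, pow_succ, mul_right_comm,
      mul_inv_cancel, one_mul]
  have hcomm : ∀ (a : kˣ) (g : GL (Fin n) k),
      Commute (Matrix.GeneralLinearGroup.scalar (Fin n) a) g :=
    Matrix.GeneralLinearGroup.scalar_commute
  refine ⟨η, Matrix.GeneralLinearGroup.scalar (Fin n) η⁻¹ * u, ?_, ?_⟩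
  · rw [← pow_two, (hcomm _ _).mul_pow, ← hζ, ← map_pow, ← map_mul, inv_pow, hη2, inv_mul_cancel,
      map_one]
  · rw [← mul_assoc, ← map_mul, mul_inv_cancel, map_one, one_mul]

end Unipotent

section TraceVanishing

variable {k : Type} [Field k] {n : ℕ}

theorem eq_one_of_mem_unipotentRadical_of_commute (h2 : (2 : k) ≠ 0) {ε c : GL (Fin n) k}
    (hε : ε * ε = 1) (hc : c ∈ unipotentRadical (fixedSpace ε.1)) (hcomm : Commute c ε) :
    c = 1 := by
  refine Units.ext (matrix_eq_of_mulVec fun v => ?_)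
  have hεε : ∀ w, ε.1 *ᵥ (ε.1 *ᵥ w) = w := fun w => by
    rw [Matrix.mulVec_mulVec, ← Units.val_mul, hε, Units.val_one, Matrix.one_mulVec]
  have h1 : c.1 *ᵥ (v + ε.1 *ᵥ v) = v + ε.1 *ᵥ v :=
    hc.1 _ (by rw [mem_fixedSpace, Matrix.mulVec_add, hεε, add_comm])
  have h3 : c.1 *ᵥ (ε.1 *ᵥ v) = ε.1 *ᵥ (c.1 *ᵥ v) := by
    rw [Matrix.mulVec_mulVec, Matrix.mulVec_mulVec, ← Units.val_mul, ← Units.val_mul, hcomm.eq]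
  have h4 := mem_fixedSpace.1 (hc.2 v)
  rw [Matrix.mulVec_sub] at h4
  rw [Matrix.mulVec_add, h3] at h1
  have h5 : (2 : k) • (c.1 *ᵥ v - v) = 0 := by
    rw [two_smul]
    linear_combination (exp := 1) h1 - h4
  rw [Units.val_one, Matrix.one_mulVec]
  exact sub_eq_zero.1 ((smul_eq_zero.1 h5).resolve_left h2)

/-- The character of a cuspidal representation vanishes at elements with a power equal to a
nontrivial involution up to a scalar. -/
theorem trace_eq_zero_of_involution [Finite k] (h2 : (2 : k) ≠ 0)
    {K M : Type} [Field K] [CharZero K] [AddCommGroup M] [Module K M] [FiniteDimensional K M]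
    {s : Representation K (GL (Fin n) k) M} (hs : IsCuspidalGL s)
    {x ε : GL (Fin n) k} (hε : ε * ε = 1) (hε1 : ε.1 ≠ 1) (hε2 : ε.1 ≠ -1) {m : ℕ} {η : kˣ}
    (hpow : x ^ m = Matrix.GeneralLinearGroup.scalar (Fin n) η * ε) :
    LinearMap.trace K M (s x) = 0 := by
  classical
  have hsc : ∀ g : GL (Fin n) k, Commute (Matrix.GeneralLinearGroup.scalar (Fin n) η) g :=
    Matrix.GeneralLinearGroup.scalar_commute η
  have hε' : ε = (Matrix.GeneralLinearGroup.scalar (Fin n) η)⁻¹ * x ^ m := by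
    rw [hpow, inv_mul_cancel_left]
  have hcomm : ∀ c, Commute c x → Commute c ε := fun c hc => by
    rw [hε']; exact ((hsc c).inv_left.symm).mul_right (hc.pow_right m)
  set N := unipotentRadical (fixedSpace ε.1) with hN
  have : Fintype N := Fintype.ofFinite _
  have hpres : ∀ g : GL (Fin n) k, Commute g ε →
      ∀ w ∈ fixedSpace ε.1, g.1 *ᵥ w ∈ fixedSpace ε.1 := by
    intro g hg w hw
    rw [mem_fixedSpace] at hw ⊢
    rw [Matrix.mulVec_mulVec, ← Units.val_mul, ← hg.eq, Units.val_mul, ← Matrix.mulVec_mulVec, hw]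
  have hx := hcomm x (Commute.refl x)
  let φ : N → N := fun c => ⟨x⁻¹ * c * x, conj_mem_unipotentRadical c.2 (hpres x hx)
    (hpres x⁻¹ hx.inv_left)⟩ * c⁻¹
  have hφ : Function.Injective φ := by
    intro a b hab
    have h := congrArg Subtype.val hab
    simp only [φ, Subgroup.coe_mul, Subgroup.coe_inv] at h
    have hc : Commute ((b⁻¹ * a : N) : GL (Fin n) k) x := by
      rw [Subgroup.coe_mul, Subgroup.coe_inv]
      have h' : (a : GL (Fin n) k) * x * (a : GL (Fin n) k)⁻¹ = b * x * (b : GL (Fin n) k)⁻¹ := by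
        have := congrArg (x * ·) h
        simpa [mul_assoc] using this
      rw [mul_inv_eq_iff_eq_mul] at h'
      show _ * x = x * _
      rw [mul_assoc, h']
      simp [mul_assoc]
    have := eq_one_of_mem_unipotentRadical_of_commute h2 hε (b⁻¹ * a).2 (hcomm _ hc)
    have h1 : b⁻¹ * a = 1 := Subtype.ext this
    exact (inv_mul_eq_one.1 h1).symm
  have hsum : ∑ c : N, s c = 0 := by
    ext v
    refine hs _ (fixedSpace_ne_bot (by rw [← Units.val_mul, hε, Units.val_one]) hε2)
      (fixedSpace_ne_top hε1) _ fun g hg => ?_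
    simp only [LinearMap.sum_apply, map_sum]
    conv_rhs => rw [← Equiv.sum_comp (Equiv.mulLeft (⟨g, hg⟩ : N))]
    simp
  have key : (Fintype.card N : K) * LinearMap.trace K M (s x) = 0 := by
    calc (Fintype.card N : K) * LinearMap.trace K M (s x)
        = ∑ c : N, LinearMap.trace K M (s x) := by simp
      _ = ∑ c : N, LinearMap.trace K M (s x * s (φ c)) := by
          refine Finset.sum_congr rfl fun c _ => ?_
          have h : x * (φ c : GL (Fin n) k) = c * x * (c : GL (Fin n) k)⁻¹ := by
            simp [φ, mul_assoc]
          rw [← map_mul, h]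
          exact (Representation.char_conj s x c).symm
      _ = LinearMap.trace K M (s x * ∑ c : N, s c) := by
          rw [Finset.mul_sum, map_sum]
          exact Equiv.sum_comp (Equiv.ofBijective φ (Finite.injective_iff_bijective.1 hφ))
            (fun c : N => LinearMap.trace K M (s x * s c))
      _ = 0 := by rw [hsum, mul_zero, map_zero]
  exact (mul_eq_zero.1 key).resolve_left (by exact_mod_cast Fintype.card_ne_zero)

end TraceVanishing

section FixedVectors

variable {k : Type} [Field k] {n : ℕ}

open Classical in
theorem sum_addChar_trace_mul [Fintype k] {K : Type} [Field K] [CharZero K]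
    {ψ : AddChar k K} (hψ : ψ ≠ 0) (X : Matrix (Fin n) (Fin n) k) :
    ∑ Y : Matrix (Fin n) (Fin n) k, ψ (Matrix.trace (Y * X)) =
      if X = 0 then (Fintype.card (Matrix (Fin n) (Fin n) k) : K) else 0 := by
  split_ifs with hX
  · simp [hX]
  let χ := ψ.compAddMonoidHom
    ((Matrix.traceAddMonoidHom (Fin n) k).comp (AddMonoidHom.mulRight X))
  refine AddChar.sum_eq_zero_iff_ne_zero.2 (show χ ≠ 0 from ?_)
  obtain ⟨i, j, hij⟩ : ∃ i j, X i j ≠ 0 := by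
    by_contra! h
    exact hX (Matrix.ext h)
  obtain ⟨a, ha⟩ := AddChar.ne_zero_iff.1 hψ
  refine AddChar.ne_zero_iff.2 ⟨Matrix.single j i (a / X i j), ?_⟩
  have : Matrix.trace (Matrix.single j i (a / X i j) * X) = a := by
    rw [Matrix.trace_single_mul, smul_eq_mul]; field_simp
  simpa [χ, this] using ha

/-- A cuspidal representation has no nonzero vectors fixed by the centralizer of a decomposition
of `k ^ n` into two nonzero subspaces of distinct dimensions. -/
theorem eq_zero_of_fixed_of_commute_idempotent [Fintype k] {K M : Type} [Field K] [CharZero K]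
    [AddCommGroup M] [Module K M] {s : Representation K (GL (Fin n) k) M} (hs : IsCuspidalGL s)
    {ψ : AddChar k K} (hψ : ψ ≠ 0) {P Q : Matrix (Fin n) (Fin n) k} (hadd : P + Q = 1)
    (hPP : P * P = P) (hQ : Q ≠ 0)
    (hlt : Module.finrank k (LinearMap.range Q.mulVecLin) <
      Module.finrank k (LinearMap.ker Q.mulVecLin))
    {v : M} (hv : ∀ g : GL (Fin n) k, Commute g.1 P → s g v = v) : v = 0 := by
  classical
  obtain rfl : Q = 1 - P := by rw [← hadd]; abel
  set Q := 1 - P with hQdef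
  have hQP : Q * P = 0 := by rw [hQdef, sub_mul, hPP, one_mul, sub_self]
  have hsq : ∀ Z : Matrix (Fin n) (Fin n) k, (P * Z * Q) * (P * Z * Q) = 0 := fun Z => by
    rw [show P * Z * Q * (P * Z * Q) = P * Z * (Q * P) * (Z * Q) by noncomm_ring, hQP]; simp
  let E : Matrix (Fin n) (Fin n) k → GL (Fin n) k := fun Z => oneAddSqZero (P * Z * Q) (hsq Z)
  let f : Matrix (Fin n) (Fin n) k → M := fun Y =>
    ∑ Z, ψ (Matrix.trace (Y * (P * Z * Q))) • s (E Z) v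
  have hf : ∀ Y, f Y = 0 := by
    intro Y
    let W := LinearMap.ker Q.mulVecLin ⊓ LinearMap.ker (Q * Y).mulVecLin
    have hWmem : ∀ w, w ∈ W ↔ Q *ᵥ w = 0 ∧ (Q * Y) *ᵥ w = 0 := fun w => by simp [W]
    have hbot : W ≠ ⊥ := by
      let F : LinearMap.ker Q.mulVecLin →ₗ[k] LinearMap.range Q.mulVecLin :=
        (Q.mulVecLin.rangeRestrict ∘ₗ Y.mulVecLin) ∘ₗ (LinearMap.ker Q.mulVecLin).subtype
      obtain ⟨w, hw, hw0⟩ := Submodule.exists_mem_ne_zero_of_ne_bot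
        (LinearMap.ker_ne_bot_of_finrank_lt (f := F) hlt)
      refine (Submodule.ne_bot_iff _).2 ⟨w, (hWmem _).2 ⟨LinearMap.mem_ker.1 w.2, ?_⟩,
        by simpa using hw0⟩
      have := congrArg Subtype.val (LinearMap.mem_ker.1 hw)
      simpa [F] using this
    have htop : W ≠ ⊤ := by
      intro ht
      refine hQ (matrix_eq_of_mulVec fun w => ?_)
      rw [Matrix.zero_mulVec]
      exact ((hWmem w).1 (ht ▸ Submodule.mem_top)).1
    refine hs W hbot htop _ fun g hg => ?_
    obtain ⟨Z', hZ'⟩ : ∃ Z', g.1 = 1 + Z' := ⟨g.1 - 1, by abel⟩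
    have hmem : ∀ w, Z' *ᵥ w ∈ W := fun w => by
      have := hg.2 w
      rwa [hZ', Matrix.add_mulVec, Matrix.one_mulVec, add_sub_cancel_left] at this
    have hQZ : Q * Z' = 0 := matrix_eq_of_mulVec fun w => by
      rw [← Matrix.mulVec_mulVec, ((hWmem _).1 (hmem w)).1, Matrix.zero_mulVec]
    have hQYZ : Q * Y * Z' = 0 := matrix_eq_of_mulVec fun w => by
      rw [← Matrix.mulVec_mulVec, ((hWmem _).1 (hmem w)).2, Matrix.zero_mulVec]
    have hZZ : Z' * Z' = 0 := by
      have := sq_sub_one_eq_zero hg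
      rwa [hZ', add_sub_cancel_left] at this
    have hPZ : P * Z' = Z' := by
      have : (1 - P) * Z' = 0 := hQZ
      rw [sub_mul, one_mul, sub_eq_zero] at this
      exact this.symm
    have hZP : Z' * P * (Z' * P) = 0 := by
      rw [show Z' * P * (Z' * P) = Z' * (P * Z') * P by noncomm_ring, hPZ, hZZ, zero_mul]
    let g₁ := oneAddSqZero (Z' * P) hZP
    have hg₁ : g₁.1 = 1 + Z' * P := rfl
    have hg₁v : s g₁ v = v := hv _ (by
      show g₁.1 * P = P * g₁.1
      rw [hg₁, add_mul, mul_add, mul_assoc, hPP, ← mul_assoc, hPZ, one_mul, mul_one])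
    let e : Matrix (Fin n) (Fin n) k ≃ Matrix (Fin n) (Fin n) k :=
      (Units.mulLeft g₁).trans (Equiv.addLeft Z')
    have he : ∀ Z, e Z = Z' + (1 + Z' * P) * Z := fun Z => rfl
    have hPe : ∀ Z, P * e Z * Q = Z' * Q + P * Z * Q + Z' * P * Z * Q := fun Z => by
      rw [he, show P * (Z' + (1 + Z' * P) * Z) * Q =
        (P * Z') * Q + P * Z * Q + (P * Z') * P * Z * Q by noncomm_ring, hPZ]
    have hgE : ∀ Z, g * E Z = E (e Z) * g₁ := fun Z => Units.ext <| by
      show g.1 * (1 + P * Z * Q) = (1 + P * e Z * Q) * g₁.1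
      rw [hPe, hZ', hg₁]
      have h1 : (1 + (Z' * Q + P * Z * Q + Z' * P * Z * Q)) * (1 + Z' * P) =
        1 + Z' * (P + Q) + P * Z * Q + Z' * P * Z * Q + Z' * (Q * Z') * P + P * Z * (Q * Z') * P
          + Z' * P * Z * (Q * Z') * P := by noncomm_ring
      rw [h1, hQZ, hadd]
      noncomm_ring
    have htr : ∀ Z, Matrix.trace (Y * (P * Z * Q)) = Matrix.trace (Y * (P * e Z * Q)) := fun Z => by
      rw [hPe, mul_add, mul_add, Matrix.trace_add, Matrix.trace_add]
      rw [show Y * (Z' * Q) = (Y * Z') * Q by noncomm_ring, Matrix.trace_mul_comm (Y * Z') Q,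
        show Y * (Z' * P * Z * Q) = (Y * (Z' * P * Z)) * Q by noncomm_ring,
        Matrix.trace_mul_comm (Y * (Z' * P * Z)) Q,
        show Q * (Y * Z') = Q * Y * Z' by noncomm_ring,
        show Q * (Y * (Z' * P * Z)) = Q * Y * Z' * P * Z by noncomm_ring, hQYZ]
      simp
    calc s g (f Y) = ∑ Z, ψ (Matrix.trace (Y * (P * e Z * Q))) • s (E (e Z)) v := by
          simp only [f, map_sum, map_smul]
          refine Finset.sum_congr rfl fun Z _ => ?_
          rw [← Module.End.mul_apply, ← map_mul, hgE, map_mul, Module.End.mul_apply, hg₁v, htr]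
      _ = f Y := Equiv.sum_comp e fun Z => ψ (Matrix.trace (Y * (P * Z * Q))) • s (E Z) v
  have hsum : ∑ Y, f Y = ∑ Z : Matrix (Fin n) (Fin n) k, if P * Z * Q = 0 then
      (Fintype.card (Matrix (Fin n) (Fin n) k) : K) • v else 0 := by
    rw [Finset.sum_comm]
    refine Finset.sum_congr rfl fun Z _ => ?_
    rw [← Finset.sum_smul, sum_addChar_trace_mul hψ]
    split_ifs with h
    · have : E Z = 1 := Units.ext (by show 1 + P * Z * Q = 1; rw [h, add_zero])
      rw [this, map_one, Module.End.one_apply]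
    · rw [zero_smul]
  simp only [hf, Finset.sum_const_zero, ← Finset.sum_filter, Finset.sum_const] at hsum
  rw [← Nat.cast_smul_eq_nsmul K, smul_smul] at hsum
  refine (smul_eq_zero.1 hsum.symm).resolve_left ?_
  refine mul_ne_zero (Nat.cast_ne_zero.2 (Finset.card_ne_zero_of_mem (a := 0) (by simp))) ?_
  exact Nat.cast_ne_zero.2 Fintype.card_ne_zero

/-- An algebraically closed field of characteristic zero admits nontrivial additive characters of
a finite field. -/
theorem exists_addChar_ne_zero [Finite k] (K : Type) [Field K] [CharZero K] [IsAlgClosed K] :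
    ∃ ψ : AddChar k K, ψ ≠ 0 := by
  obtain ⟨p, hp⟩ := CharP.exists k
  have h : ringChar ℚ ≠ ringChar k := by
    rw [ringChar.eq ℚ 0, ringChar.eq k p]
    exact (CharP.char_ne_zero_of_finite k p).symm
  let Ψ := AddChar.FiniteField.primitiveChar k ℚ h
  let j : CyclotomicField Ψ.n ℚ →+* K :=
    (IsAlgClosed.lift : CyclotomicField Ψ.n ℚ →ₐ[ℚ] K).toRingHom
  refine ⟨(j : CyclotomicField Ψ.n ℚ →* K).compAddChar Ψ.char, ?_⟩
  have h1 := Ψ.prim one_ne_zero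
  rw [AddChar.mulShift_one] at h1
  obtain ⟨a, ha⟩ := AddChar.ne_zero_iff.1 (h1 : Ψ.char ≠ 0)
  exact AddChar.ne_zero_iff.2 ⟨a, fun h => ha (j.injective (by simpa using h))⟩

/-- For odd `n ≥ 2` a cuspidal representation has no nonzero vectors fixed by the centralizer of
an involution. -/
theorem eq_zero_of_fixed_of_commute_involution [Finite k] (h2 : (2 : k) ≠ 0) (hn : Odd n)
    (hn1 : n ≠ 1) {K M : Type} [Field K] [CharZero K] [IsAlgClosed K]
    [AddCommGroup M] [Module K M] {s : Representation K (GL (Fin n) k) M} (hs : IsCuspidalGL s)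
    {ε : Matrix (Fin n) (Fin n) k} (hε : ε * ε = 1)
    {v : M} (hv : ∀ g : GL (Fin n) k, Commute g.1 ε → s g v = v) : v = 0 := by
  have := Fintype.ofFinite k
  obtain ⟨ψ, hψ⟩ := exists_addChar_ne_zero (k := k) K
  by_cases htriv : ∀ g : GL (Fin n) k, s g v = v
  · have hn2 : 1 < n := by obtain ⟨j, hj⟩ := hn; omega
    let w : Fin n → k := Pi.single ⟨0, by omega⟩ 1
    have hw : w ≠ 0 := by simp [w]
    refine hs (Submodule.span k {w}) (by simpa using hw) (fun ht => ?_) v fun g _ => htriv g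
    have h1 := finrank_span_singleton (K := k) hw
    rw [ht, finrank_top, Module.finrank_fin_fun] at h1
    omega
  push Not at htriv
  obtain ⟨g₀, hg₀⟩ := htriv
  set P : Matrix (Fin n) (Fin n) k := (2 : k)⁻¹ • (1 + ε) with hP
  set Q : Matrix (Fin n) (Fin n) k := (2 : k)⁻¹ • (1 - ε) with hQ
  have h22 : (2 : k)⁻¹ * 2 = 1 := inv_mul_cancel₀ h2
  have hadd : P + Q = 1 := by
    rw [hP, hQ, ← smul_add, show (1 + ε) + (1 - ε) = (2 : k) • 1 by rw [two_smul]; abel,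
      smul_smul, h22, one_smul]
  have hPP : P * P = P := by
    rw [hP, smul_mul_smul_comm, show (1 + ε) * (1 + ε) = (2 : k) • (1 + ε) by
      rw [two_smul, mul_add, add_mul, add_mul, hε]; simp; abel, smul_smul, mul_assoc, h22, mul_one]
  have hQQ : Q * Q = Q := by
    rw [← sub_eq_of_eq_add' hadd.symm, mul_sub, sub_mul, sub_mul, hPP]; simp
  have hPQ : P * Q = 0 := by
    rw [← sub_eq_of_eq_add' hadd.symm, mul_sub, hPP]; simp
  have hQP : Q * P = 0 := by
    rw [← sub_eq_of_eq_add' hadd.symm, sub_mul, hPP]; simp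
  have hεP : ε = (2 : k) • P - 1 := by
    rw [hP, smul_smul, mul_comm, h22, one_smul]; abel
  have hεQ : ε = 1 - (2 : k) • Q := by
    rw [hQ, smul_smul, mul_comm, h22, one_smul]; abel
  have hcP : ∀ g : GL (Fin n) k, Commute g.1 P → Commute g.1 ε := fun g hg => by
    rw [hεP]; exact (hg.smul_right _).sub_right (Commute.one_right _)
  have hcQ : ∀ g : GL (Fin n) k, Commute g.1 Q → Commute g.1 ε := fun g hg => by
    rw [hεQ]; exact (Commute.one_right _).sub_right (hg.smul_right _)
  have hQ0 : Q ≠ 0 := fun h => hg₀ (hv g₀ (by rw [hεQ, h]; simp))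
  have hP0 : P ≠ 0 := fun h => hg₀ (hv g₀ (by rw [hεP, h]; simp))
  have hle : ∀ A B : Matrix (Fin n) (Fin n) k, A * B = 0 →
      Module.finrank k (LinearMap.range B.mulVecLin) ≤
        Module.finrank k (LinearMap.ker A.mulVecLin) := fun A B h => by
    refine Submodule.finrank_mono ?_
    rintro _ ⟨w, rfl⟩
    simp [Matrix.mulVec_mulVec, h]
  have hdim := LinearMap.finrank_range_add_finrank_ker Q.mulVecLin
  rw [Module.finrank_fin_fun] at hdim
  have h1 := hle Q P hQP
  have h3 := hle P Q hPQ
  rcases lt_trichotomy (Module.finrank k (LinearMap.range Q.mulVecLin))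
    (Module.finrank k (LinearMap.ker Q.mulVecLin)) with h | h | h
  · exact eq_zero_of_fixed_of_commute_idempotent hs hψ hadd hPP hQ0 h fun g hg => hv g (hcP g hg)
  · obtain ⟨j, hj⟩ := hn
    omega
  · exact eq_zero_of_fixed_of_commute_idempotent hs hψ ((add_comm _ _).trans hadd) hQQ hP0
      (by omega) fun g hg => hv g (hcQ g hg)

end FixedVectors

section ProjectiveGroup

variable (k : Type) [Field k] (n : ℕ)

/-- The projective linear group, as a quotient of the general linear group. -/
abbrev ProjGL : Type := GL (Fin n) k ⧸ Subgroup.center (GL (Fin n) k)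

/-- The images in the projective linear group of the unipotent radicals of proper parabolics. -/
def projUnipotentRadicals : Set (Subgroup (ProjGL k n)) :=
  {N | ∃ W : Submodule k (Fin n → k), W ≠ ⊥ ∧ W ≠ ⊤ ∧
    N = (unipotentRadical W).map (QuotientGroup.mk' _)}

variable {k n}

theorem IsCuspidalFor.comp_mk' {K M : Type} [Field K] [AddCommGroup M] [Module K M]
    {r : Representation K (ProjGL k n) M} (hr : IsCuspidalFor (projUnipotentRadicals k n) r) :
    IsCuspidalGL (r.comp (QuotientGroup.mk' _) : Representation K (GL (Fin n) k) M) := by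
  refine fun W h0 h1 v hv => hr _ ⟨W, h0, h1, rfl⟩ v ?_
  rintro _ ⟨g, hg, rfl⟩
  exact hv g hg

theorem mk_scalar (η : kˣ) :
    (Matrix.GeneralLinearGroup.scalar (Fin n) η : ProjGL k n) = 1 :=
  (QuotientGroup.eq_one_iff _).2
    (by rw [Matrix.GeneralLinearGroup.center_eq_range_scalar]; exact ⟨η, rfl⟩)

theorem mem_center_of_val_eq_or {ε : GL (Fin n) k} (h : ε.1 = 1 ∨ ε.1 = -1) :
    ε ∈ Subgroup.center (GL (Fin n) k) := by
  refine Subgroup.mem_center_iff.2 fun g => Units.ext ?_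
  rw [Units.val_mul, Units.val_mul]
  rcases h with h | h <;> rw [h] <;> simp

theorem cuspidalVanishing_projUnipotentRadicals [Finite k] (h2 : (2 : k) ≠ 0) (hn : Odd n)
    (hn1 : n ≠ 1) (K : Type) [Field K] [CharZero K] [IsAlgClosed K] :
    CuspidalVanishing K (projUnipotentRadicals k n) where
  trace_eq_zero M _ _ _ r hr x hx := by
    obtain ⟨x, rfl⟩ := QuotientGroup.mk_surjective x
    obtain ⟨m, hm⟩ := hx
    have hpos : 0 < orderOf (x : ProjGL k n) := orderOf_pos _
    have hu : (x ^ m) ^ 2 ∈ Subgroup.center (GL (Fin n) k) := by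
      rw [← QuotientGroup.eq_one_iff, ← pow_mul, mul_two, ← hm, QuotientGroup.mk_pow,
        pow_orderOf_eq_one]
    have hu' : x ^ m ∉ Subgroup.center (GL (Fin n) k) := by
      rw [← QuotientGroup.eq_one_iff, QuotientGroup.mk_pow]
      exact pow_ne_one_of_lt_orderOf (by omega) (by omega)
    obtain ⟨η, ε, hε, hηε⟩ := exists_involution_of_sq_mem_center hn _ hu
    have hε' : ¬ (ε.1 = 1 ∨ ε.1 = -1) := fun h => hu' <| by
      rw [hηε]
      refine mul_mem ?_ (mem_center_of_val_eq_or h)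
      rw [← QuotientGroup.eq_one_iff, mk_scalar]
    push Not at hε'
    exact trace_eq_zero_of_involution h2 hr.comp_mk' hε hε'.1 hε'.2 hηε
  eq_zero_of_fixed M _ _ _ r hr x hx v hv := by
    obtain ⟨u, rfl⟩ := QuotientGroup.mk_surjective x
    have hu : u ^ 2 ∈ Subgroup.center (GL (Fin n) k) := by
      rwa [← QuotientGroup.eq_one_iff, QuotientGroup.mk_pow]
    obtain ⟨η, ε, hε, hηε⟩ := exists_involution_of_sq_mem_center hn _ hu
    refine eq_zero_of_fixed_of_commute_involution h2 hn hn1 hr.comp_mk' (ε := ε.1)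
      (by rw [← Units.val_mul, hε, Units.val_one]) fun g hg => hv g ?_
    have hg' : Commute g ε := Units.ext hg
    rw [hηε, QuotientGroup.mk_mul, mk_scalar, one_mul]
    exact congrArg (QuotientGroup.mk' _) hg'.eq

end ProjectiveGroup

section PrimitiveIdempotent

/-- Fitting's lemma for an element of a finite-dimensional algebra. -/
theorem exists_fitting_idempotent (R : Type) {A : Type} [Field R] [Ring A] [Algebra R A]
    [FiniteDimensional R A] (z : A) :
    ∃ u : A, Commute z u ∧ (z * u) * (z * u) = z * u ∧ ∃ m, z * u * z ^ m = z ^ m := by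
  let z₀ : Algebra.adjoin R {z} := ⟨z, Algebra.self_mem_adjoin_singleton R z⟩
  have : IsArtinianRing (Algebra.adjoin R {z}) := IsArtinianRing.of_finite R _
  obtain ⟨m, y, hy⟩ := IsArtinian.exists_pow_succ_smul_dvd z₀ (1 : Algebra.adjoin R {z})
  simp only [smul_eq_mul, mul_one] at hy
  have h1 : ∀ j, z₀ ^ (m + j) * y ^ j = z₀ ^ m := fun j => by
    induction j with
    | zero => simp
    | succ j ih =>
      rw [← ih]
      calc z₀ ^ (m + (j + 1)) * y ^ (j + 1) = (z₀ ^ m.succ * y) * z₀ ^ j * y ^ j := by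
            rw [Nat.succ_eq_add_one]; ring
        _ = _ := by rw [hy]; ring
  have h2 := h1 (m + 1)
  have hu : z₀ * (z₀ ^ m * y ^ (m + 1)) * z₀ ^ m = z₀ ^ m := by
    conv_rhs => rw [← h2]
    ring
  refine ⟨(z₀ ^ m * y ^ (m + 1) : Algebra.adjoin R {z}), ?_, ?_, m, ?_⟩
  · exact congrArg Subtype.val (mul_comm z₀ (z₀ ^ m * y ^ (m + 1)))
  · have : (z₀ * (z₀ ^ m * y ^ (m + 1))) * (z₀ * (z₀ ^ m * y ^ (m + 1))) =
        z₀ * (z₀ ^ m * y ^ (m + 1)) := by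
      linear_combination (exp := 1) (z₀ * y ^ (m + 1)) * hu
    exact congrArg Subtype.val this
  · exact congrArg Subtype.val hu

variable {R A V : Type} [Field R] [Ring A] [Algebra R A] [FiniteDimensional R A]
  [AddCommGroup V] [Module R V] (σ : A →ₐ[R] Module.End R V)

/-- An idempotent acting nontrivially, such that every element of the corner algebra acts
nilpotently or is invertible in the corner algebra. -/
structure IsPrimitiveFor (e : A) : Prop where
  mul_self : e * e = e
  map_ne_zero : σ e ≠ 0
  exists_inverse : ∀ z, e * z = z → z * e = z → ¬ IsNilpotent (σ z) →
    ∃ z', e * z' = z' ∧ z' * e = z' ∧ z * z' = e ∧ z' * z = e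

theorem exists_isPrimitiveFor [Nontrivial V] : ∃ e, IsPrimitiveFor σ e := by
  obtain ⟨e, he, hmin⟩ := exists_minimalFor_of_wellFoundedLT
    (fun e : A => e * e = e ∧ σ e ≠ 0)
    (fun e => Module.finrank R (LinearMap.range (LinearMap.mulRight R e)))
    ⟨1, by simp, by simp⟩
  refine ⟨e, he.1, he.2, fun z hez hze hz => ?_⟩
  obtain ⟨u, hcomm, hidem, m, hm⟩ := exists_fitting_idempotent R z
  set f := z * u with hf
  have hef : e * f = f := by rw [hf, ← mul_assoc, hez]
  have hfe : f * e = f := by rw [hf, hcomm.eq, mul_assoc, hze]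
  have hσ : σ f ≠ 0 := fun h => hz ⟨m, by rw [← map_pow, ← hm, map_mul, h, zero_mul]⟩
  have hle : LinearMap.range (LinearMap.mulRight R f) ≤
      LinearMap.range (LinearMap.mulRight R e) := by
    rintro _ ⟨a, rfl⟩
    exact ⟨a * f, by simp [mul_assoc, hfe]⟩
  have heq := Submodule.eq_of_le_of_finrank_le hle
    (hmin ⟨hidem, hσ⟩ (Submodule.finrank_mono hle))
  have hmem : e ∈ LinearMap.range (LinearMap.mulRight R f) := heq ▸ ⟨e, by simp [he.1]⟩
  obtain ⟨a, ha⟩ := hmem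
  have hfe' : f = e := by
    rw [← hef, ← ha]
    simp [mul_assoc, hidem]
  refine ⟨e * u * e, by simp only [← mul_assoc, he.1], by simp only [mul_assoc, he.1], ?_, ?_⟩
  · rw [← mul_assoc, ← mul_assoc, hze, ← hf, hfe', he.1]
  · rw [mul_assoc, hez, mul_assoc, ← hcomm.eq, ← hf, hfe', he.1]

variable {σ}

omit [FiniteDimensional R A] in
theorem exists_rankOne [IsAlgClosed R] [FiniteDimensional R V] [Nontrivial V]
    (hσ : ∀ v : V, v ≠ 0 → ∀ u, ∃ a, σ a v = u) :
    ∃ (a : A) (w : V), σ a ≠ 0 ∧ ∀ v, ∃ c : R, σ a v = c • w := by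
  obtain ⟨a, ha, hmin⟩ := exists_minimalFor_of_wellFoundedLT
    (fun a : A => σ a ≠ 0) (fun a => Module.finrank R (LinearMap.range (σ a)))
    ⟨1, by simp⟩
  obtain ⟨v₁, hv₁⟩ : ∃ v, σ a v ≠ 0 := by
    by_contra! h
    exact ha (LinearMap.ext h)
  refine ⟨a, σ a v₁, ha, fun v₂ => ?_⟩
  by_contra! hv₂
  obtain ⟨b, hb⟩ := hσ _ hv₁ v₂
  have hinv : ∀ x ∈ LinearMap.range (σ a), σ (a * b) x ∈ LinearMap.range (σ a) := fun x _ =>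
    ⟨σ b x, by simp⟩
  have : Nontrivial (LinearMap.range (σ a)) :=
    ⟨⟨⟨σ a v₁, ⟨v₁, rfl⟩⟩, 0, fun h => hv₁ (congrArg Subtype.val h)⟩⟩
  obtain ⟨c, hc⟩ := Module.End.exists_eigenvalue ((σ (a * b)).restrict hinv)
  obtain ⟨⟨x, hx⟩, hxc, hx0⟩ := hc.exists_hasEigenvector
  have hxc' : σ (a * b) x = c • x :=
    congrArg Subtype.val (Module.End.mem_eigenspace_iff.1 hxc)
  have hx0' : x ≠ 0 := fun h => hx0 (Subtype.ext h)
  set d := a * b - algebraMap R A c with hd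
  have hda : σ (d * a) v₁ ≠ 0 := by
    rw [hd, sub_mul, map_sub, LinearMap.sub_apply, mul_assoc]
    simp only [map_mul, Module.End.mul_apply, hb, AlgHom.commutes]
    intro h
    exact hv₂ c (by simpa [sub_eq_zero] using h)
  have hle : LinearMap.range (σ (d * a)) ≤ LinearMap.range (σ a) := by
    rintro _ ⟨y, rfl⟩
    refine ⟨σ b (σ a y) - c • y, ?_⟩
    simp [hd, sub_mul]
  have hne : σ (d * a) ≠ 0 := fun h => hda (by rw [h]; rfl)
  have heq := Submodule.eq_of_le_of_finrank_le hle (hmin hne (Submodule.finrank_mono hle))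
  have hinv' : ∀ y ∈ LinearMap.range (σ a), σ d y ∈ LinearMap.range (σ a) := by
    rintro _ ⟨y, rfl⟩
    exact hle ⟨y, by simp⟩
  have hsurj : Function.Surjective ((σ d).restrict hinv') := by
    rintro ⟨y, hy⟩
    rw [← heq] at hy
    obtain ⟨t, rfl⟩ := hy
    exact ⟨⟨σ a t, ⟨t, rfl⟩⟩, Subtype.ext (by simp)⟩
  have hinj := LinearMap.injective_iff_surjective.2 hsurj
  refine hx0 (hinj (Subtype.ext ?_))
  rw [map_zero]
  simp [hd] at hxc' ⊢
  rw [hxc', sub_self]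

omit [FiniteDimensional R A] in
theorem IsPrimitiveFor.exists_eq_smul [IsAlgClosed R] [FiniteDimensional R V] [Nontrivial V]
    (hσ : ∀ v : V, v ≠ 0 → ∀ u, ∃ a, σ a v = u) {e : A} (he : IsPrimitiveFor σ e) :
    ∃ (φ : V →ₗ[R] R) (w : V), φ w = 1 ∧ ∀ v, σ e v = φ v • w := by
  obtain ⟨a, w₁, ha, hrank⟩ := exists_rankOne hσ
  obtain ⟨v₀, hv₀⟩ : ∃ v, σ e v ≠ 0 := by
    by_contra! h
    exact he.map_ne_zero (LinearMap.ext h)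
  obtain ⟨v₁, hv₁⟩ : ∃ v, σ a v ≠ 0 := by
    by_contra! h
    exact ha (LinearMap.ext h)
  set w := σ e v₀ with hw
  have hew : σ e w = w := by rw [hw, ← Module.End.mul_apply, ← map_mul, he.mul_self]
  obtain ⟨c, hc⟩ := hσ w hv₀ v₁
  obtain ⟨b, hb⟩ := hσ (σ a v₁) hv₁ w
  have hrank' : ∀ v, ∃ t : R, σ (e * (b * a * c) * e) v = t • w := fun v => by
    obtain ⟨t₁, ht₁⟩ := hrank (σ c (σ e v))
    obtain ⟨t₂, ht₂⟩ := hrank v₁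
    have ht20 : t₂ ≠ 0 := by rintro rfl; exact hv₁ (by rw [ht₂, zero_smul])
    refine ⟨t₁ * t₂⁻¹, ?_⟩
    have h3 : w₁ = t₂⁻¹ • σ a v₁ := by rw [ht₂, smul_smul, inv_mul_cancel₀ ht20, one_smul]
    simp only [map_mul, Module.End.mul_apply]
    rw [ht₁, h3, map_smul, map_smul, map_smul, map_smul, hb, hew, smul_smul]
  have hzw : σ (e * (b * a * c) * e) w = w := by
    simp only [map_mul, Module.End.mul_apply, hew, hc, hb]
  obtain ⟨z', -, -, hz', -⟩ := he.exists_inverse (e * (b * a * c) * e)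
    (by simp only [← mul_assoc, he.mul_self]) (by simp only [mul_assoc, he.mul_self]) (by
      rintro ⟨m, hm⟩
      have h : ∀ j, (σ (e * (b * a * c) * e) ^ j) w = w := fun j => by
        induction j with
        | zero => simp
        | succ j ih => rw [pow_succ, Module.End.mul_apply, hzw, ih]
      exact hv₀ (by rw [← h m, hm]; rfl))
  have hspan : ∀ v, ∃ t : R, σ e v = t • w := fun v => by
    obtain ⟨t, ht⟩ := hrank' (σ z' v)
    exact ⟨t, by rw [← ht, ← Module.End.mul_apply, ← map_mul, hz']⟩
  obtain ⟨ψ, hψ⟩ := Module.Projective.exists_dual_eq_one R hv₀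
  have key : ∀ v, σ e v = (ψ ∘ₗ σ e) v • w := fun v => by
    obtain ⟨t, ht⟩ := hspan v
    rw [LinearMap.comp_apply, ht, map_smul, hψ, smul_eq_mul, mul_one]
  exact ⟨ψ ∘ₗ σ e, w, by rw [LinearMap.comp_apply, hew, hψ], key⟩

end PrimitiveIdempotent

section Factorization

variable {R A V : Type} [Field R] [Ring A] [Algebra R A]
  [AddCommGroup V] [Module R V] {σ : A →ₐ[R] Module.End R V}

theorem not_isNilpotent_of_apply_eq {f : Module.End R V} {w : V} (hw : w ≠ 0) (h : f w = w) :
    ¬ IsNilpotent f := by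
  rintro ⟨m, hm⟩
  have hp : ∀ j, (f ^ j) w = w := fun j => by
    induction j with
    | zero => simp
    | succ j ih => rw [pow_succ, Module.End.mul_apply, h, ih]
  exact hw (by rw [← hp m, hm]; rfl)

theorem IsPrimitiveFor.eq_of_mul_self {e f : A} (he : IsPrimitiveFor σ e) (hef : e * f = f)
    (hfe : f * e = f) (hf : f * f = f) (h0 : σ f ≠ 0) : f = e := by
  obtain ⟨v, hv⟩ : ∃ v, σ f v ≠ 0 := by
    by_contra! h
    exact h0 (LinearMap.ext h)
  obtain ⟨f', -, -, h1, -⟩ := he.exists_inverse f hef hfe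
    (not_isNilpotent_of_apply_eq hv (by rw [← Module.End.mul_apply, ← map_mul, hf]))
  rw [← hfe, ← h1, ← mul_assoc, hf]

/-- The image of a primitive idempotent under an anti-involution is equivalent to it when both
act nontrivially on the same simple module. -/
theorem IsPrimitiveFor.exists_factorization {e : A} (he : IsPrimitiveFor σ e)
    (hσ : ∀ v : V, v ≠ 0 → ∀ u, ∃ a, σ a v = u) (ι : A → A) (hmul : ∀ a b, ι (a * b) = ι b * ι a)
    (hι : ∀ a, ι (ι a) = a) (h0 : ∀ a, σ a = 0 → σ (ι a) = 0) :
    ∃ x y, x * y = e ∧ y * x = ι e := by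
  have h0' : ∀ a, σ a ≠ 0 → σ (ι a) ≠ 0 := fun a ha h => ha (hι a ▸ h0 _ h)
  have hιe : ι e * ι e = ι e := by rw [← hmul, he.mul_self]
  have hvec : ∀ a, a * a = a → σ a ≠ 0 → ∃ w, w ≠ 0 ∧ σ a w = w := fun a ha h => by
    obtain ⟨v, hv⟩ : ∃ v, σ a v ≠ 0 := by
      by_contra! h'
      exact h (LinearMap.ext h')
    exact ⟨σ a v, hv, by rw [← Module.End.mul_apply, ← map_mul, ha]⟩
  obtain ⟨w, hw, hew⟩ := hvec e he.mul_self he.map_ne_zero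
  obtain ⟨w', hw', hew'⟩ := hvec (ι e) hιe (h0' _ he.map_ne_zero)
  obtain ⟨a, ha⟩ := hσ w' hw' w
  obtain ⟨b, hb⟩ := hσ w hw w'
  set x := e * a * ι e with hx
  set y := ι e * b * e with hy
  have hex : e * x = x := by simp only [hx, ← mul_assoc, he.mul_self]
  have hye : y * e = y := by simp only [hy, mul_assoc, he.mul_self]
  have hxι : x * ι e = x := by simp only [hx, mul_assoc, hιe]
  have hιy : ι e * y = y := by simp only [hy, ← mul_assoc, hιe]
  have hyw : σ y w = w' := by
    simp only [hy, map_mul, Module.End.mul_apply, hew, hb, hew']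
  have hxw : σ x w' = w := by
    simp only [hx, map_mul, Module.End.mul_apply, hew, ha, hew']
  obtain ⟨z, hez, hze, h1, h2⟩ := he.exists_inverse (x * y) (by rw [← mul_assoc, hex])
    (by rw [mul_assoc, hye]) (not_isNilpotent_of_apply_eq hw (by
      rw [map_mul, Module.End.mul_apply, hyw, hxw]))
  refine ⟨x, y * z, by rw [← mul_assoc, h1], ?_⟩
  set f := y * z * x with hf
  have hff : f * f = f := by
    rw [hf, show y * z * x * (y * z * x) = y * z * (x * y * z) * x by simp only [mul_assoc], h1,
      mul_assoc y z e, hze]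
  have hfw : σ f w' = w' := by
    simp only [hf, map_mul, Module.End.mul_apply, hxw]
    have : σ (y * (z * (x * y))) w = w' := by rw [h2, hye, hyw]
    simpa only [map_mul, Module.End.mul_apply, hyw, hxw] using this
  have hf0 : σ f ≠ 0 := fun h => hw' (by rw [← hfw, h]; rfl)
  have hιf : f * ι e = f := by rw [hf, mul_assoc, hxι]
  have hfι : ι e * f = f := by
    rw [hf, mul_assoc y, ← mul_assoc (ι e), hιy]
  have := he.eq_of_mul_self (f := ι f) (by
      have := hmul f (ι e); rw [hι, hιf] at this; exact this.symm)
    (by have := hmul (ι e) f; rw [hι, hfι] at this; exact this.symm) (by rw [← hmul, hff])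
    (h0' _ hf0)
  rw [← hι f, this]

end Factorization

section InvariantMatrices

variable (R Γ : Type) [Field R] [Group Γ] [Fintype Γ] [DecidableEq Γ]

/-- The algebra of matrices indexed by a group and invariant under simultaneous left translation
of both indices; it is isomorphic to the group algebra. -/
def invMatrices : Subalgebra R (Matrix Γ Γ R) where
  carrier := {X | ∀ g a b, X (g * a) (g * b) = X a b}
  mul_mem' := by
    intro X Y hX hY g a b
    rw [Matrix.mul_apply, Matrix.mul_apply, ← Equiv.sum_comp (Equiv.mulLeft g)]
    simp [hX g, hY g]
  add_mem' := by
    intro X Y hX hY g a b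
    simp [hX g, hY g]
  algebraMap_mem' := by
    intro c g a b
    simp [Matrix.algebraMap_matrix_apply]

variable {R Γ}

theorem invMatrices_apply {X : Matrix Γ Γ R} (hX : X ∈ invMatrices R Γ) (a b : Γ) :
    X a b = X 1 (a⁻¹ * b) := by
  rw [← hX a⁻¹, inv_mul_cancel]

/-- Transposition of invariant matrices. -/
def invTranspose (X : invMatrices R Γ) : invMatrices R Γ := ⟨X.1ᵀ, fun g a b => X.2 g b a⟩

/-- Right translation of the row index. -/
def rowShift (h : Γ) (X : invMatrices R Γ) : invMatrices R Γ :=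
  ⟨fun a b => X.1 (a * h) b, fun g a b => by
    have := X.2 g (a * h) b
    rwa [← mul_assoc] at this⟩

variable {V : Type} [AddCommGroup V] [Module R V] (ρ : Representation R Γ V)

/-- The action of the algebra of invariant matrices on a representation. -/
noncomputable def invMatricesAction : invMatrices R Γ →ₐ[R] Module.End R V :=
  AlgHom.ofLinearMap
    { toFun := fun X => ∑ a, X.1 1 a • ρ a
      map_add' := fun X Y => by simp [add_smul, Finset.sum_add_distrib]
      map_smul' := fun c X => by simp [smul_smul, Finset.smul_sum] }
    (by simp [Matrix.one_apply])
    (by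
      intro X Y
      simp only [LinearMap.coe_mk, AddHom.coe_mk, MulMemClass.coe_mul, Matrix.mul_apply,
        Finset.sum_smul, Finset.sum_mul, Finset.mul_sum]
      rw [Finset.sum_comm]
      conv_rhs => rw [Finset.sum_comm]
      refine Finset.sum_congr rfl fun a _ => ?_
      rw [← Equiv.sum_comp (Equiv.mulLeft a)]
      refine Finset.sum_congr rfl fun b _ => ?_
      rw [Equiv.coe_mulLeft, invMatrices_apply Y.2, inv_mul_cancel_left, map_mul,
        smul_mul_smul_comm])

theorem invMatricesAction_apply (X : invMatrices R Γ) (v : V) :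
    invMatricesAction ρ X v = ∑ a, X.1 1 a • ρ a v := by
  simp [invMatricesAction]

theorem invMatricesAction_rowShift (h : Γ) (X : invMatrices R Γ) (v : V) :
    invMatricesAction ρ (rowShift h X) v = ρ h (invMatricesAction ρ X v) := by
  rw [invMatricesAction_apply, invMatricesAction_apply, map_sum,
    ← Equiv.sum_comp (Equiv.mulLeft h)]
  refine Finset.sum_congr rfl fun a _ => ?_
  rw [Equiv.coe_mulLeft, map_smul, ← Module.End.mul_apply, ← map_mul]
  congr 1
  show X.1 (1 * h) (h * a) = X.1 1 a
  rw [invMatrices_apply X.2]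
  simp

theorem exists_invMatricesAction_eq (hρ : IsIrreducibleRep ρ) {v : V} (hv : v ≠ 0) (u : V) :
    ∃ X, invMatricesAction ρ X v = u := by
  let T : invMatrices R Γ →ₗ[R] V :=
    (LinearMap.applyₗ v).comp (invMatricesAction ρ).toLinearMap
  have hT : ∀ X, T X = invMatricesAction ρ X v := fun X => rfl
  rcases hρ.2 (LinearMap.range T) (by
    rintro g _ ⟨X, rfl⟩
    exact ⟨rowShift g X, by rw [hT, hT, invMatricesAction_rowShift]⟩) with h | h
  · have : v ∈ LinearMap.range T := ⟨1, by simp [hT]⟩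
    rw [h, Submodule.mem_bot] at this
    exact absurd this hv
  · exact (h ▸ Submodule.mem_top : u ∈ LinearMap.range T)

theorem invMatricesAction_invTranspose {B : V →ₗ[R] V →ₗ[R] R}
    (hB : ∀ g x y, B (ρ g x) (ρ g y) = B x y) (X : invMatrices R Γ) (x y : V) :
    B x (invMatricesAction ρ (invTranspose X) y) = B (invMatricesAction ρ X x) y := by
  rw [invMatricesAction_apply, invMatricesAction_apply, map_sum, map_sum, LinearMap.sum_apply,
    ← Equiv.sum_comp (Equiv.inv Γ)]
  refine Finset.sum_congr rfl fun a _ => ?_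
  rw [map_smul, map_smul, LinearMap.smul_apply]
  have h1 : (invTranspose X).1 1 (a⁻¹) = X.1 1 a := by
    show X.1 a⁻¹ 1 = _
    rw [invMatrices_apply X.2]; simp
  have h2 : B x (ρ a⁻¹ y) = B (ρ a x) y := by
    rw [← hB a, ← Module.End.mul_apply, ← map_mul]; simp
  rw [Equiv.inv_apply, h1, h2]

end InvariantMatrices

theorem exists_linearMap_range {R A M V : Type} [Ring R] [AddCommGroup A] [Module R A]
    [AddCommGroup M] [Module R M] [AddCommGroup V] [Module R V] (L : A →ₗ[R] M) (T : A →ₗ[R] V)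
    (h : ∀ x, L x = 0 → T x = 0) :
    ∃ f : LinearMap.range L →ₗ[R] V, ∀ x (hx : L x ∈ LinearMap.range L), f ⟨L x, hx⟩ = T x := by
  refine ⟨((LinearMap.ker L).liftQ T fun x hx => h x hx) ∘ₗ
    L.quotKerEquivRange.symm.toLinearMap, fun x hx => ?_⟩
  simp only [LinearMap.coe_comp, LinearEquiv.coe_coe, Function.comp_apply,
    LinearMap.quotKerEquivRange_symm_apply_image]
  exact Submodule.liftQ_apply _ _ _

section StandardParabolic

variable {k : Type} [Field k] {n : ℕ} (B : Fin n → Fin 2)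

/-- The subspace stabilised by the standard two-block parabolic subgroup. -/
def blockSubspace : Submodule k (Fin n → k) where
  carrier := {v | ∀ i, B i = 1 → v i = 0}
  add_mem' := fun ha hb i hi => by simp [ha i hi, hb i hi]
  zero_mem' := fun i _ => rfl
  smul_mem' := fun c v hv i hi => by simp [hv i hi]

variable {B}

theorem mulVec_mem_blockSubspace {p : GL (Fin n) k} (hp : p ∈ parabolic k n 2 B)
    {v : Fin n → k} (hv : v ∈ blockSubspace B) : p.1 *ᵥ v ∈ blockSubspace B := by
  intro i hi
  rw [Matrix.mulVec, dotProduct]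
  refine Finset.sum_eq_zero fun j _ => ?_
  by_cases hj : B j = 1
  · rw [hv j hj, mul_zero]
  · rw [hp (show B j < B i by omega), zero_mul]

theorem conj_mem_unipotentRadical_blockSubspace {p g : GL (Fin n) k}
    (hp : p ∈ parabolic k n 2 B) (hg : g ∈ unipotentRadical (blockSubspace B)) :
    p⁻¹ * g * p ∈ unipotentRadical (blockSubspace B : Submodule k _) :=
  conj_mem_unipotentRadical hg (fun _ hw => mulVec_mem_blockSubspace hp hw)
    fun _ hw => mulVec_mem_blockSubspace (inv_mem hp) hw

theorem apply_eq_one_of_parabolic {u : GL (Fin n) k} (hu : u ∈ parabolic k n 2 B)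
    (h : ∀ i j, B i = B j → u.1 i j = (1 : Matrix (Fin n) (Fin n) k) i j) {i j : Fin n}
    (hij : B i = 1 ∨ B j = 0) : u.1 i j = (1 : Matrix (Fin n) (Fin n) k) i j := by
  by_cases hB : B i = B j
  · exact h i j hB
  · rw [hu (show B j < B i by omega), Matrix.one_apply_ne (fun hh : i = j => hB (congrArg B hh))]

theorem mem_unipotentRadical_blockSubspace {u : GL (Fin n) k} (hu : u ∈ parabolic k n 2 B)
    (h : ∀ i j, B i = B j → u.1 i j = (1 : Matrix (Fin n) (Fin n) k) i j) :
    u ∈ unipotentRadical (blockSubspace B : Submodule k _) := by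
  rw [mem_unipotentRadical]
  constructor
  · intro w hw
    conv_rhs => rw [← Matrix.one_mulVec w]
    ext i
    rw [Matrix.mulVec, Matrix.mulVec, dotProduct, dotProduct]
    refine Finset.sum_congr rfl fun j _ => ?_
    by_cases hj : B j = 1
    · rw [hw j hj, mul_zero, mul_zero]
    · rw [apply_eq_one_of_parabolic hu h (Or.inr (by omega))]
  · intro v i hi
    rw [Pi.sub_apply, sub_eq_zero]
    conv_rhs => rw [← Matrix.one_mulVec v]
    rw [Matrix.mulVec, Matrix.mulVec, dotProduct, dotProduct]
    refine Finset.sum_congr rfl fun j _ => ?_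
    rw [apply_eq_one_of_parabolic hu h (Or.inl hi)]

theorem det_eq_one_of_parabolic (hB : Monotone B) {u : GL (Fin n) k}
    (hu : u ∈ parabolic k n 2 B)
    (h : ∀ i j, B i = B j → u.1 i j = (1 : Matrix (Fin n) (Fin n) k) i j) :
    Matrix.GeneralLinearGroup.det u = 1 := by
  ext
  have ht : u.1.BlockTriangular id := fun i j hij => by
    rcases (hB (le_of_lt hij : j ≤ i)).lt_or_eq with hlt | heq
    · exact hu hlt
    · exact (h i j heq.symm).trans (Matrix.one_apply_ne (ne_of_gt hij))
  rw [Matrix.GeneralLinearGroup.val_det_apply, Matrix.det_of_isUpperTriangular ht]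
  simp [h]

end StandardParabolic

section Vanishing

variable {k : Type} [Field k] {n : ℕ} {B : Fin n → Fin 2} {R : Type} [Field R]
  {Γ : Type} [Group Γ] (pr : GL (Fin n) k →* Γ)

/-- Functions invariant under left translation by a unipotent radical. -/
def radicalInvariants (U : Subgroup (GL (Fin n) k)) : Submodule R (Γ → R) where
  carrier := {F | ∀ u ∈ U, ∀ b, F (pr u * b) = F b}
  add_mem' := fun ha hb u hu b => by simp [ha u hu b, hb u hu b]
  zero_mem' := fun u _ b => rfl
  smul_mem' := fun c F hF u hu b => by simp [hF u hu b]

variable (χ : GL (Fin n) k →* R)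

/-- Twisted left translation by the parabolic subgroup on functions invariant under its unipotent
radical. -/
def radicalRep : Representation R (parabolic k n 2 B)
    (radicalInvariants (R := R) pr (unipotentRadical (blockSubspace B : Submodule k _))) where
  toFun p :=
    { toFun := fun F => ⟨fun b => χ p.1 * F.1 ((pr p.1)⁻¹ * b), fun u hu b => by
        have h := F.2 _ (conj_mem_unipotentRadical_blockSubspace p.2 hu) ((pr p.1)⁻¹ * b)
        show χ p.1 * _ = χ p.1 * _
        rw [← h]
        simp [mul_assoc]⟩
      map_add' := fun F F' => by ext b; exact mul_add _ _ _
      map_smul' := fun c F => by ext b; exact mul_left_comm _ _ _ }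
  map_one' := by ext F b; simp
  map_mul' p p' := by ext F b; simp [mul_assoc]

theorem radicalRep_apply (p : parabolic k n 2 B)
    (F : radicalInvariants (R := R) pr (unipotentRadical (blockSubspace B : Submodule k _)))
    (b : Γ) : (radicalRep pr χ p F).1 b = χ p.1 * F.1 ((pr p.1)⁻¹ * b) := rfl

variable [Fintype Γ] [DecidableEq Γ]
  [Fintype (unipotentRadical (blockSubspace B : Submodule k (Fin n → k)))]

/-- Averaging the columns of an invariant matrix over the unipotent radical lands in the
representation induced from the parabolic subgroup. -/
def toInduced : invMatrices R Γ →ₗ[R] indCarrier (parabolic k n 2 B) (radicalRep (R := R) pr χ)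
    where
  toFun X := ⟨fun g => ⟨fun b => χ g * ∑ u : unipotentRadical (blockSubspace B : Submodule k _),
      X.1 (pr g) (pr u * b), fun u hu b => by
        show χ g * _ = χ g * _
        rw [← Equiv.sum_comp (Equiv.mulRight (⟨u, hu⟩ : unipotentRadical (blockSubspace B)))
          (fun v => X.1 (pr g) (pr v * b))]
        simp [mul_assoc]⟩, fun p g => by
      ext b
      rw [radicalRep_apply]
      show χ (p * g) * _ = χ p * (χ g * _)
      rw [map_mul, mul_assoc]
      congr 2
      let c : unipotentRadical (blockSubspace B : Submodule k _) ≃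
          unipotentRadical (blockSubspace B : Submodule k _) :=
        { toFun := fun u => ⟨p.1⁻¹ * u.1 * p.1, conj_mem_unipotentRadical_blockSubspace p.2 u.2⟩
          invFun := fun u => ⟨p.1 * u.1 * p.1⁻¹, by
            simpa using conj_mem_unipotentRadical_blockSubspace (inv_mem p.2) u.2⟩
          left_inv := fun u => by ext1; simp [mul_assoc]
          right_inv := fun u => by ext1; simp [mul_assoc] }
      conv_rhs => rw [← Equiv.sum_comp c]
      refine Finset.sum_congr rfl fun u _ => ?_
      rw [map_mul, ← X.2 (pr p.1) (pr g) (pr (c u) * ((pr p.1)⁻¹ * b))]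
      simp [c, mul_assoc]⟩
  map_add' X Y := by
    ext g b
    simp [Finset.sum_add_distrib, mul_add]
  map_smul' c X := by
    ext g b
    simp [← Finset.mul_sum, mul_left_comm]

theorem toInduced_apply (X : invMatrices R Γ) (g : GL (Fin n) k) (b : Γ) :
    ((toInduced (B := B) pr χ X).1 g).1 b =
      χ g * ∑ u : unipotentRadical (blockSubspace B : Submodule k _), X.1 (pr g) (pr u * b) := rfl

variable {pr χ} {V : Type} [AddCommGroup V] [Module R V] {ρ : Representation R (GL (Fin n) k) V}
  {ρ' : Representation R Γ V}

theorem IsPrimitiveFor.sum_blockSubspace_eq_zero (hρ : IsSupercuspidal k ρ)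
    (hρ' : IsIrreducibleRep ρ') (hpr : Function.Surjective pr)
    (hχ : ∀ g v, ρ g v = χ g • ρ' (pr g) v)
    (hdet : ∀ g, Matrix.GeneralLinearGroup.det g = 1 → χ g = 1)
    {e : invMatrices R Γ} (he : IsPrimitiveFor (invMatricesAction ρ') e)
    (hB : Monotone B) (hB' : Function.Surjective B) (a b : Γ) :
    ∑ u : unipotentRadical (blockSubspace B : Submodule k _), e.1 a (pr u * b) = 0 := by
  by_contra hne
  set σ := invMatricesAction ρ' with hσ
  obtain ⟨w₀, hw₀⟩ : ∃ v, σ e v ≠ 0 := by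
    by_contra! h
    exact he.map_ne_zero (LinearMap.ext h)
  set w := σ e w₀ with hw
  have hew : σ e w = w := by
    rw [hw, ← Module.End.mul_apply, ← map_mul, he.mul_self]
  have hχ0 : ∀ g, χ g ≠ 0 := fun g h => by
    have := map_mul χ g g⁻¹
    rw [mul_inv_cancel, map_one, h, zero_mul] at this
    exact one_ne_zero this
  let L := (toInduced (B := B) pr χ).comp (LinearMap.mulRight R e)
  have hL : ∀ X, L X = toInduced pr χ (X * e) := fun X => rfl
  let T : invMatrices R Γ →ₗ[R] V := (LinearMap.applyₗ w).comp σ.toLinearMap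
  have hT : ∀ X, T X = σ X w := fun X => rfl
  have hker : ∀ X, L X = 0 → T X = 0 := by
    intro X hX
    by_contra hTX
    rw [hT] at hTX
    obtain ⟨c, hc⟩ := exists_invMatricesAction_eq ρ' hρ' hTX w
    obtain ⟨z, hez, -, -, hz⟩ := he.exists_inverse (e * c * X * e)
      (by simp only [← mul_assoc, he.mul_self]) (by simp only [mul_assoc, he.mul_self])
      (not_isNilpotent_of_apply_eq hw₀ (by
        simp only [map_mul, Module.End.mul_apply, hew]
        rw [hc, hew]))
    have hY : ∀ s b, ∑ u : unipotentRadical (blockSubspace B : Submodule k _),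
        (X * e).1 s (pr u * b) = 0 := by
      intro s b
      obtain ⟨g, rfl⟩ := hpr s
      refine (mul_eq_zero.1 ?_).resolve_left (hχ0 g)
      rw [← toInduced_apply pr χ, ← hL, hX]
      rfl
    apply hne
    have hsplit : e = z * e * c * (X * e) := by
      conv_lhs => rw [← hz]
      simp only [mul_assoc]
    rw [hsplit]
    have hmul : ∀ (Y Z : invMatrices R Γ) s t, (Y * Z).1 s t = ∑ j, Y.1 s j * Z.1 j t :=
      fun Y Z s t => rfl
    simp only [hmul (z * e * c)]
    rw [Finset.sum_comm]
    refine Finset.sum_eq_zero fun s _ => ?_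
    rw [← Finset.mul_sum, hY, mul_zero]
  obtain ⟨f, hf⟩ := exists_linearMap_range (R := R) (A := invMatrices R Γ)
    (M := indCarrier (parabolic k n 2 B) (radicalRep (R := R) pr χ)) (V := V) L T hker
  have hshift : ∀ (h : GL (Fin n) k) (X : invMatrices R Γ),
      inducedRep (parabolic k n 2 B) (radicalRep pr χ) h (L X) = L (χ h • rowShift (pr h) X) := by
    intro h X
    apply Subtype.ext
    funext g
    apply Subtype.ext
    funext b
    rw [hL, hL, toInduced_apply]
    show χ (g * h) * _ = _
    rw [smul_mul_assoc, map_mul, mul_assoc]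
    congr 1
    rw [Finset.mul_sum]
    refine Finset.sum_congr rfl fun u _ => ?_
    rw [map_mul]
    rfl
  refine hρ 2 le_rfl B hB hB' _ (radicalRep pr χ) ?_ ⟨LinearMap.range L, ?_, f, ?_, ?_⟩
  · intro u hu
    ext F b
    have := F.2 _ (inv_mem (mem_unipotentRadical_blockSubspace u.2 hu)) b
    rw [radicalRep_apply, hdet _ (det_eq_one_of_parabolic hB u.2 hu), ← map_inv, this, one_mul]
    rfl
  · rintro h _ ⟨X, rfl⟩
    exact ⟨_, (hshift h X).symm⟩
  · intro v
    obtain ⟨X, hX⟩ := exists_invMatricesAction_eq ρ' hρ' hw₀ v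
    exact ⟨⟨L X, X, rfl⟩, (hf X _).trans hX⟩
  · rintro h ⟨_, X, rfl⟩
    have h1 : f ⟨inducedRep (parabolic k n 2 B) (radicalRep pr χ) h (L X),
        ⟨_, (hshift h X).symm⟩⟩ = f ⟨L (χ h • rowShift (pr h) X), ⟨_, rfl⟩⟩ :=
      congrArg f (Subtype.ext (hshift h X))
    refine h1.trans ((hf _ _).trans ?_)
    rw [hχ, hT, map_smul, LinearMap.smul_apply, hσ, invMatricesAction_rowShift]
    exact congrArg (fun v => χ h • ρ' (pr h) v) (hf X _).symm

end Vanishing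

/-- The block function with blocks of sizes `d` and `n - d`. -/
def twoBlocks (n d : ℕ) (i : Fin n) : Fin 2 := if i.1 < d then 0 else 1

theorem twoBlocks_monotone (n d : ℕ) : Monotone (twoBlocks n d) := by
  intro i j hij
  simp only [twoBlocks]
  split_ifs <;> first | exact le_rfl | exact Fin.zero_le _ | (have : i.1 ≤ j.1 := hij; omega)

theorem twoBlocks_surjective {n d : ℕ} (h0 : 0 < d) (hd : d < n) :
    Function.Surjective (twoBlocks n d) := by
  intro x
  fin_cases x
  · exact ⟨⟨0, by omega⟩, by simp [twoBlocks, h0]⟩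
  · exact ⟨⟨d, hd⟩, by simp [twoBlocks]⟩

section

variable {k : Type} [Field k] {n : ℕ}

theorem finrank_blockSubspace_twoBlocks {d : ℕ} (hd : d ≤ n) :
    Module.finrank k (blockSubspace (twoBlocks n d) : Submodule k (Fin n → k)) = d := by
  let E : (blockSubspace (twoBlocks n d) : Submodule k (Fin n → k)) ≃ₗ[k] (Fin d → k) :=
    { toFun := fun v i => v.1 (Fin.castLE hd i)
      map_add' := fun _ _ => rfl
      map_smul' := fun _ _ => rfl
      invFun := fun f => ⟨fun i => if h : i.1 < d then f ⟨i.1, h⟩ else 0, fun i hi => by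
        have : ¬ i.1 < d := fun h => by simp [twoBlocks, h] at hi
        simp [this]⟩
      left_inv := fun v => by
        ext i
        by_cases h : i.1 < d
        · simp [h]
        · simpa [h] using (v.2 i (by simp [twoBlocks, h])).symm
      right_inv := fun f => by ext i; simp }
  rw [E.finrank_eq, Module.finrank_fin_fun]

/-- Every subspace is the image of a standard one under an invertible matrix. -/
theorem exists_mulVec_mem_iff (W : Submodule k (Fin n → k)) :
    ∃ h : GL (Fin n) k, ∀ v,
      v ∈ (blockSubspace (twoBlocks n (Module.finrank k W)) : Submodule k _) ↔ h.1 *ᵥ v ∈ W := by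
  have hd : Module.finrank k W ≤ n := by simpa using W.finrank_le
  let f : (blockSubspace (twoBlocks n (Module.finrank k W)) : Submodule k (Fin n → k)) ≃ₗ[k] W :=
    LinearEquiv.ofFinrankEq _ _ (finrank_blockSubspace_twoBlocks hd)
  obtain ⟨g, hg⟩ := Submodule.exists_linearEquiv_restrict_eq f
  refine ⟨⟨LinearMap.toMatrix' g.toLinearMap, LinearMap.toMatrix' g.symm.toLinearMap, ?_, ?_⟩,
    fun v => ?_⟩
  · rw [← LinearMap.toMatrix'_comp]; simp
  · rw [← LinearMap.toMatrix'_comp]; simp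
  · rw [LinearMap.toMatrix'_mulVec]
    constructor
    · intro hv
      have := hg ⟨v, hv⟩
      exact (show g v = (f ⟨v, hv⟩ : Fin n → k) from this.symm) ▸ (f ⟨v, hv⟩).2
    · intro hv
      have h1 := hg (f.symm ⟨g v, hv⟩)
      rw [LinearEquiv.apply_symm_apply] at h1
      have h2 : v = (f.symm ⟨g v, hv⟩ : Fin n → k) := g.injective h1
      rw [h2]
      exact (f.symm ⟨g v, hv⟩).2

theorem conj_mem_unipotentRadical_iff {W W' : Submodule k (Fin n → k)} {h : GL (Fin n) k}
    (hW : ∀ v, v ∈ W' ↔ h.1 *ᵥ v ∈ W) {u : GL (Fin n) k} :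
    h⁻¹ * u * h ∈ unipotentRadical W' ↔ u ∈ unipotentRadical W := by
  have e : ∀ v : Fin n → k, h.1 *ᵥ ((h⁻¹ * u * h).1 *ᵥ v) = u.1 *ᵥ (h.1 *ᵥ v) := fun v => by
    rw [Matrix.mulVec_mulVec, Matrix.mulVec_mulVec, ← Units.val_mul, ← Units.val_mul]
    congr 2
    group
  have hinv : ∀ v : Fin n → k, h.1 *ᵥ ((h⁻¹).1 *ᵥ v) = v := fun v => by
    rw [Matrix.mulVec_mulVec, ← Units.val_mul, mul_inv_cancel, Units.val_one, Matrix.one_mulVec]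
  have hinj : Function.Injective fun v : Fin n → k => h.1 *ᵥ v :=
    Matrix.mulVec_injective_iff_isUnit.2 h.isUnit
  rw [mem_unipotentRadical, mem_unipotentRadical]
  constructor
  · rintro ⟨h1, h2⟩
    refine ⟨fun w hw => ?_, fun v => ?_⟩
    · have := h1 ((h⁻¹).1 *ᵥ w) ((hW _).2 (by rwa [hinv]))
      rw [← hinv w, ← e, this]
    · have := (hW _).1 (h2 ((h⁻¹).1 *ᵥ v))
      rwa [Matrix.mulVec_sub, e, hinv] at this
  · rintro ⟨h1, h2⟩
    refine ⟨fun w hw => hinj ?_, fun v => (hW _).2 ?_⟩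
    · show h.1 *ᵥ _ = h.1 *ᵥ w
      rw [e, h1 _ ((hW _).1 hw)]
    · rw [Matrix.mulVec_sub, e]
      exact h2 _

variable {R Γ V : Type} [Field R] [Group Γ] [Fintype Γ] [DecidableEq Γ] [AddCommGroup V]
  [Module R V] {ρ : Representation R (GL (Fin n) k) V} {ρ' : Representation R Γ V}
  {pr : GL (Fin n) k →* Γ} {χ : GL (Fin n) k →* R}

open Classical in
/-- A primitive idempotent not killing a supercuspidal representation is annihilated by averaging
over every unipotent radical. -/
theorem IsPrimitiveFor.sum_unipotentRadical_eq_zero [Fintype k] (hρ : IsSupercuspidal k ρ)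
    (hρ' : IsIrreducibleRep ρ') (hpr : Function.Surjective pr)
    (hχ : ∀ g v, ρ g v = χ g • ρ' (pr g) v)
    (hdet : ∀ g, Matrix.GeneralLinearGroup.det g = 1 → χ g = 1)
    {e : invMatrices R Γ} (he : IsPrimitiveFor (invMatricesAction ρ') e)
    {W : Submodule k (Fin n → k)} (hbot : W ≠ ⊥) (htop : W ≠ ⊤) (a b : Γ) :
    ∑ u : unipotentRadical W, e.1 a (pr u * b) = 0 := by
  obtain ⟨h, hW⟩ := exists_mulVec_mem_iff W
  have h0 : 0 < Module.finrank k W := Module.finrank_pos_iff.2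
    (Submodule.nontrivial_iff_ne_bot.2 hbot)
  have hd : Module.finrank k W < n := by
    simpa using Submodule.finrank_lt htop
  let c : unipotentRadical W ≃ unipotentRadical
      (blockSubspace (twoBlocks n (Module.finrank k W)) : Submodule k (Fin n → k)) :=
    { toFun := fun u => ⟨h⁻¹ * u.1 * h, (conj_mem_unipotentRadical_iff hW).2 u.2⟩
      invFun := fun u => ⟨h * u.1 * h⁻¹, (conj_mem_unipotentRadical_iff hW).1 (by
        simp [mul_assoc])⟩
      left_inv := fun u => by ext1; simp [mul_assoc]
      right_inv := fun u => by ext1; simp [mul_assoc] }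
  rw [← he.sum_blockSubspace_eq_zero hρ hρ' hpr hχ hdet (twoBlocks_monotone n _)
    (twoBlocks_surjective h0 hd) ((pr h)⁻¹ * a) ((pr h)⁻¹ * b), ← Equiv.sum_comp c]
  refine Finset.sum_congr rfl fun u _ => ?_
  rw [← e.2 (pr h)⁻¹]
  simp [c, mul_assoc]

end

/-- If every period of a permutation is divisible by `d`, so is the sum of an invariant
function. -/
theorem dvd_sum_of_forall_dvd_period {A O : Type} [Fintype A] [CommRing O] (r : Equiv.Perm A)
    (w : A → O) (hw : ∀ a, w (r a) = w a) (d : ℕ)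
    (hd : ∀ a, d ∣ Function.minimalPeriod r a) : (d : O) ∣ ∑ a, w a := by
  classical
  have hconst : ∀ a, ∀ g : Subgroup.zpowers r, w (g • a) = w a := by
    have hz : ∀ (j : ℤ) a, w ((r ^ j) a) = w a := fun j => by
      induction j using Int.induction_on with
      | zero => simp
      | succ j ih => intro a; rw [add_comm, _root_.zpow_add, zpow_one, Equiv.Perm.mul_apply, hw, ih]
      | pred j ih =>
        intro a
        rw [← ih a, ← hw ((r ^ (-(j : ℤ) - 1)) a), ← Equiv.Perm.mul_apply, ← _root_.zpow_one_add]
        congr 3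
        ring
    rintro a ⟨_, j, rfl⟩
    exact hz j a
  rw [← Equiv.sum_comp (MulAction.selfEquivSigmaOrbits (Subgroup.zpowers r) A).symm,
    Fintype.sum_sigma]
  refine Finset.dvd_sum fun ω _ => ?_
  have h1 : ∀ a : MulAction.orbit (Subgroup.zpowers r) ω.out,
      w ((MulAction.selfEquivSigmaOrbits (Subgroup.zpowers r) A).symm ⟨ω, a⟩) = w ω.out := by
    rintro ⟨_, g, rfl⟩
    exact hconst _ g
  rw [Finset.sum_congr rfl fun a _ => h1 a, Finset.sum_const, nsmul_eq_mul, Finset.card_univ]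
  refine Dvd.dvd.mul_right (Nat.cast_dvd_cast ?_) _
  have := MulAction.minimalPeriod_eq_card (a := r) (b := ω.out)
  convert hd ω.out using 1
  rw [← Nat.card_eq_fintype_card] at this ⊢
  exact this.symm

section ClosedWalks

variable {I : Type}

variable (γ : Equiv.Perm I) (n : ℕ)

/-- Rotation of a sequence, twisted by a permutation. -/
def twistedRotate : Equiv.Perm (Fin (n + 1) → I) where
  toFun b := Fin.snoc (Fin.tail b) (γ (b 0))
  invFun b := Fin.cons (γ.symm (b (Fin.last n))) (Fin.init b)
  left_inv b := by simp
  right_inv b := by simp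

variable {γ n}

theorem twistedRotate_castSucc (b : Fin (n + 1) → I) (i : Fin n) :
    twistedRotate γ n b i.castSucc = b i.succ := by
  simp [twistedRotate, Fin.tail]

theorem twistedRotate_last (b : Fin (n + 1) → I) :
    twistedRotate γ n b (Fin.last n) = γ (b 0) := by
  simp [twistedRotate]

theorem iterate_twistedRotate (b : Fin (n + 1) → I) (j : ℕ) (hj : j ≤ n + 1) (i : Fin (n + 1)) :
    ((twistedRotate γ n)^[j] b) i =
      if h : i.1 + j < n + 1 then b ⟨i.1 + j, h⟩ else γ (b ⟨i.1 + j - (n + 1), by omega⟩) := by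
  induction j generalizing i with
  | zero => rw [dif_pos (by omega)]; rfl
  | succ j ih =>
    rw [Function.iterate_succ_apply']
    induction i using Fin.lastCases with
    | last =>
      rw [twistedRotate_last, ih (by omega)]
      have h1 : ¬ (Fin.last n).1 + (j + 1) < n + 1 := by simp
      rw [dif_neg h1, dif_pos (by simpa using hj)]
      congr 3
      simp; omega
    | cast i =>
      rw [twistedRotate_castSucc, ih (by omega)]
      have h2 : i.succ.1 + j = i.castSucc.1 + (j + 1) := by simp; omega
      simp only [h2]

theorem iterate_twistedRotate_length (b : Fin (n + 1) → I) :
    (twistedRotate γ n)^[n + 1] b = fun i => γ (b i) := by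
  ext i
  rw [iterate_twistedRotate b _ le_rfl, dif_neg (by omega)]
  simp

theorem iterate_twistedRotate_length_mul (b : Fin (n + 1) → I) (s : ℕ) :
    (twistedRotate γ n)^[(n + 1) * s] b = fun i => (γ ^ s) (b i) := by
  rw [Function.iterate_mul]
  induction s with
  | zero => simp
  | succ s ih =>
    rw [Function.iterate_succ_apply', ih, iterate_twistedRotate_length, pow_succ']
    rfl

variable {O : Type} [CommRing O]

theorem prod_twistedRotate {E : Matrix I I O} (hE : ∀ x y, E (γ x) (γ y) = E x y)
    (b : Fin (n + 1) → I) :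
    ∏ i, E (twistedRotate γ n b i) (twistedRotate γ n (twistedRotate γ n b) i) =
      ∏ i, E (b i) (twistedRotate γ n b i) := by
  rw [Fin.prod_univ_castSucc, Fin.prod_univ_succ, mul_comm]
  congr 1
  · rw [twistedRotate_last, twistedRotate_last, hE]
  · refine Finset.prod_congr rfl fun i _ => ?_
    rw [twistedRotate_castSucc, twistedRotate_castSucc]

variable [Fintype I] [DecidableEq I]

theorem pow_succ_apply_eq_sum (E : Matrix I I O) (n : ℕ) (x y : I) :
    (E ^ (n + 1)) x y = ∑ a : Fin n → I, ∏ i : Fin (n + 1),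
      E ((Fin.cons x a : Fin (n + 1) → I) i) ((Fin.snoc a y : Fin (n + 1) → I) i) := by
  induction n generalizing x with
  | zero => simp [Fin.snoc]
  | succ n ih =>
    rw [pow_succ', Matrix.mul_apply, ← Equiv.sum_comp (Fin.consEquiv fun _ => I),
      Fintype.sum_prod_type]
    refine Finset.sum_congr rfl fun z _ => ?_
    rw [ih, Finset.mul_sum]
    refine Finset.sum_congr rfl fun a _ => ?_
    rw [Fin.prod_univ_succ (n := n + 1)]
    simp [Fin.consEquiv, ← Fin.cons_snoc_eq_snoc_cons]

theorem dvd_sum_pow_apply {ℓ : ℕ} (hℓ : ℓ.Prime) {E : Matrix I I O}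
    (hE : ∀ x y, E (γ x) (γ y) = E x y) (hγ : ∀ s x, (γ ^ s) x = x → ℓ ∣ s) (N : ℕ) :
    ((ℓ ^ (N + 1) : ℕ) : O) ∣ ∑ x, (E ^ ℓ ^ N) x (γ x) := by
  obtain ⟨n, hn⟩ : ∃ n, ℓ ^ N = n + 1 := ⟨ℓ ^ N - 1, by have := pow_pos hℓ.pos N; omega⟩
  have key : ∑ x, (E ^ ℓ ^ N) x (γ x) =
      ∑ b : Fin (n + 1) → I, ∏ i, E (b i) (twistedRotate γ n b i) := by
    rw [hn, ← Equiv.sum_comp (Fin.consEquiv fun _ => I), Fintype.sum_prod_type]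
    refine Finset.sum_congr rfl fun x _ => ?_
    rw [pow_succ_apply_eq_sum]
    rfl
  rw [key]
  refine dvd_sum_of_forall_dvd_period (twistedRotate γ n) _ (prod_twistedRotate hE) _ fun b => ?_
  set s := Function.minimalPeriod (twistedRotate γ n) b
  have hs : 0 < s := Function.minimalPeriod_pos_of_mem_periodicPts
    (Function.Injective.mem_periodicPts (twistedRotate γ n).injective b)
  obtain ⟨j, s', hs', he⟩ := Nat.exists_eq_pow_mul_and_not_dvd hs.ne' ℓ hℓ.ne_one
  by_contra hnd
  have hj : j ≤ N := by
    by_contra! h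
    exact hnd (he ▸ (pow_dvd_pow ℓ h).mul_right _)
  apply hs'
  have hper : Function.IsPeriodicPt (twistedRotate γ n) ((n + 1) * s') b := by
    have : (n + 1) * s' = s * ℓ ^ (N - j) := by
      rw [← hn, he, mul_right_comm, ← pow_add]
      congr 2; omega
    rw [this]
    exact (Function.isPeriodicPt_minimalPeriod _ b).mul_const _
  refine hγ s' (b 0) ?_
  have h2 := congrFun (iterate_twistedRotate_length_mul (γ := γ) b s') 0
  rw [← h2]
  exact congrFun hper 0

end ClosedWalks

section NatDvd

variable {A : Type} [Ring A] {m : ℕ}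

theorem natCast_dvd_mul_left {x : A} (h : (m : A) ∣ x) (y : A) : (m : A) ∣ y * x := by
  obtain ⟨c, rfl⟩ := h
  exact ⟨y * c, by rw [← mul_assoc, ← mul_assoc, (Nat.cast_commute m y).eq]⟩

theorem natCast_dvd_pow_sub_pow {x y : A} (h : (m : A) ∣ x - y) (j : ℕ) :
    (m : A) ∣ x ^ j - y ^ j := by
  induction j with
  | zero => simp
  | succ j ih =>
    have : x ^ (j + 1) - y ^ (j + 1) = (x ^ j - y ^ j) * x + y ^ j * (x - y) := by
      rw [pow_succ, pow_succ]; noncomm_ring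
    rw [this]
    exact dvd_add (ih.mul_right _) (natCast_dvd_mul_left h _)

theorem natCast_dvd_pow_mul_sub_pow {ℓ : ℕ} (hℓ : ℓ.Prime) {a : A} {q : ℕ}
    (h : (ℓ : A) ∣ a ^ q - a) (j : ℕ) :
    ((ℓ ^ (j + 1) : ℕ) : A) ∣ a ^ (q * ℓ ^ j) - a ^ ℓ ^ j := by
  induction j with
  | zero => simpa using h
  | succ j ih =>
    set x := a ^ ℓ ^ j
    set y := a ^ (q * ℓ ^ j) - x with hy
    have hxy : Commute x y :=
      ((Commute.refl a).pow_pow _ _).sub_right (Commute.refl _)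
    obtain ⟨r, hr⟩ := hxy.exists_add_pow_prime_eq hℓ
    have h1 : a ^ (q * ℓ ^ (j + 1)) - a ^ ℓ ^ (j + 1) = y ^ ℓ + (ℓ : A) * x * y * r := by
      rw [pow_succ ℓ j, ← mul_assoc, pow_mul a (q * ℓ ^ j), pow_mul a (ℓ ^ j),
        show a ^ (q * ℓ ^ j) = x + y by rw [hy]; abel, hr]
      abel
    have hle : ∀ (s t : ℕ) (z : A), s ∣ t → (t : A) ∣ z → (s : A) ∣ z := fun s t z hst h =>
      (Nat.cast_dvd_cast hst).trans h
    rw [h1]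
    refine dvd_add ?_ (Dvd.dvd.mul_right ?_ r)
    · obtain ⟨d, hd⟩ := ih
      refine hle _ ((ℓ ^ (j + 1)) ^ ℓ) _ ?_ ⟨d ^ ℓ, ?_⟩
      · rw [← pow_mul]
        exact pow_dvd_pow _ (by have := hℓ.two_le; nlinarith)
      · rw [hd, (Nat.cast_commute _ d).mul_pow, Nat.cast_pow (ℓ ^ (j + 1))]
    · obtain ⟨d, hd⟩ := ih
      refine ⟨x * d, ?_⟩
      rw [hd, mul_assoc (ℓ : A) x, ← mul_assoc x, ← (Nat.cast_commute (ℓ ^ (j + 1)) x).eq,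
        pow_succ' ℓ (j + 1), Nat.cast_mul]
      simp only [mul_assoc]

end NatDvd

section Limit

variable {I O : Type} [Fintype I] [DecidableEq I] [CommRing O] {ℓ : ℕ}

theorem matrix_natCast_dvd_iff {m : ℕ} {A : Matrix I I O} :
    (m : Matrix I I O) ∣ A ↔ ∀ i j, (m : O) ∣ A i j := by
  have hm : ∀ (B : Matrix I I O) i j, ((m : Matrix I I O) * B) i j = m * B i j := fun B i j => by
    rw [← nsmul_eq_mul, Matrix.smul_apply, nsmul_eq_mul]
  constructor
  · rintro ⟨B, rfl⟩ i j
    exact ⟨B i j, hm B i j⟩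
  · intro h
    choose B hB using h
    exact ⟨B, by ext i j; exact (hB i j).trans (hm B i j).symm⟩

theorem mem_span_natCast_pow_smul_top {N : ℕ} {x : O} :
    x ∈ (Ideal.span {(ℓ : O)} ^ N • ⊤ : Submodule O O) ↔ ((ℓ ^ N : ℕ) : O) ∣ x := by
  rw [Ideal.span_singleton_pow, smul_eq_mul, Ideal.mul_top, Ideal.mem_span_singleton,
    Nat.cast_pow]

variable [IsAdicComplete (Ideal.span {(ℓ : O)}) O]

omit [Fintype I] [DecidableEq I] in
theorem eq_zero_of_forall_pow_dvd {x : O} (h : ∀ N, ((ℓ ^ N : ℕ) : O) ∣ x) : x = 0 := by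
  refine IsHausdorff.haus' (I := Ideal.span {(ℓ : O)}) x fun N => ?_
  rw [SModEq.sub_mem, sub_zero, mem_span_natCast_pow_smul_top]
  exact h N

theorem matrix_eq_zero_of_forall_pow_dvd {A : Matrix I I O}
    (h : ∀ N, ((ℓ ^ N : ℕ) : Matrix I I O) ∣ A) : A = 0 := by
  ext i j
  exact eq_zero_of_forall_pow_dvd (ℓ := ℓ) fun N => matrix_natCast_dvd_iff.1 (h N) i j

/-- A matrix satisfying `a ^ q = a` modulo `ℓ`, with `q` a power of `ℓ`, is congruent to a matrix
satisfying this equation exactly. -/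
theorem exists_pow_eq_self_of_dvd (hℓ : ℓ.Prime) {f : ℕ} (hf : f ≠ 0) {a : Matrix I I O}
    (ha : (ℓ : Matrix I I O) ∣ a ^ ℓ ^ f - a) :
    ∃ u : Matrix I I O, u ^ ℓ ^ f = u ∧ (ℓ : Matrix I I O) ∣ u - a ∧
      ∀ X, Commute a X → Commute u X := by
  have hle : ∀ (s t : ℕ) (z : Matrix I I O), s ∣ t → (t : Matrix I I O) ∣ z →
      (s : Matrix I I O) ∣ z := fun s t z hst h => (Nat.cast_dvd_cast hst).trans h
  let b : ℕ → Matrix I I O := fun N => a ^ ℓ ^ (f * N)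
  have hstep : ∀ N, ((ℓ ^ (N + 1) : ℕ) : Matrix I I O) ∣ b (N + 1) - b N := fun N => by
    have := natCast_dvd_pow_mul_sub_pow hℓ ha (f * N)
    rw [← pow_add, show f + f * N = f * (N + 1) by ring] at this
    exact hle _ _ _ (pow_dvd_pow _ (Nat.succ_le_succ (Nat.le_mul_of_pos_left N
      (Nat.pos_of_ne_zero hf)))) this
  have hb : ∀ N M, N ≤ M → ((ℓ ^ (N + 1) : ℕ) : Matrix I I O) ∣ b M - b N := fun N M h => by
    induction M, h using Nat.le_induction with
    | base => simp
    | succ M h ih =>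
      rw [← sub_add_sub_cancel _ (b M)]
      exact dvd_add (hle _ _ _ (pow_dvd_pow _ (Nat.succ_le_succ h)) (hstep M)) ih
  have hlim : ∀ i j, ∃ x : O, ∀ N, ((ℓ ^ N : ℕ) : O) ∣ b N i j - x := fun i j => by
    obtain ⟨x, hx⟩ := IsPrecomplete.prec' (I := Ideal.span {(ℓ : O)}) (M := O)
      (fun N => b N i j) (fun {m n} hmn => by
        rw [SModEq.sub_mem, mem_span_natCast_pow_smul_top, ← dvd_neg, neg_sub]
        exact (Nat.cast_dvd_cast (pow_dvd_pow ℓ m.le_succ)).trans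
          (matrix_natCast_dvd_iff.1 (hb m n hmn) i j))
    refine ⟨x, fun N => ?_⟩
    have := hx N
    rwa [SModEq.sub_mem, mem_span_natCast_pow_smul_top] at this
  choose u' hu using hlim
  let u : Matrix I I O := Matrix.of u'
  have hu' : ∀ N, ((ℓ ^ N : ℕ) : Matrix I I O) ∣ b N - u := fun N =>
    matrix_natCast_dvd_iff.2 fun i j => hu i j N
  refine ⟨u, ?_, ?_, fun X hX => ?_⟩
  · refine sub_eq_zero.1 (matrix_eq_zero_of_forall_pow_dvd (ℓ := ℓ) fun N => ?_)
    have h1 := natCast_dvd_pow_sub_pow (hu' N) (ℓ ^ f)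
    have h2 : b N ^ ℓ ^ f = b (N + 1) := by
      simp only [b]
      rw [← pow_mul, ← pow_add, mul_add_one]
    rw [h2] at h1
    have h3 := hle _ _ _ (pow_dvd_pow _ N.le_succ) (hu' (N + 1))
    have := dvd_sub h3 h1
    rwa [sub_sub_sub_cancel_left] at this
  · have h1 := hu' 1
    have h2 := hb 0 1 zero_le_one
    rw [zero_add, pow_one] at h2
    rw [pow_one] at h1
    have h3 : b 0 = a := by simp [b]
    have := dvd_sub h2 h1
    rwa [h3, sub_sub_sub_cancel_left] at this
  · refine sub_eq_zero.1 (matrix_eq_zero_of_forall_pow_dvd (ℓ := ℓ) fun N => ?_)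
    have h1 : b N * X = X * b N := (hX.pow_left _).eq
    have h2 : u * X - X * u = X * (b N - u) - (b N - u) * X := by
      rw [mul_sub, sub_mul, h1]; abel
    rw [h2]
    exact dvd_sub (natCast_dvd_mul_left (hu' N) X) ((hu' N).mul_right X)

end Limit

section BrauerTrace

open Polynomial

variable {ℓ : ℕ} [Fact ℓ.Prime] {R : Type} [Field R] [IsAlgClosed R]

theorem roots_X_pow_sub_X_card [CharP R ℓ] {f : ℕ} (hf : f ≠ 0) :
    (X ^ ℓ ^ f - X : R[X]).roots.card = ℓ ^ f ∧ (X ^ ℓ ^ f - X : R[X]).roots.Nodup := by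
  have hℓ : ℓ.Prime := Fact.out
  constructor
  · rw [← (IsAlgClosed.splits (X ^ ℓ ^ f - X : R[X])).natDegree_eq_card_roots,
      FiniteField.X_pow_card_pow_sub_X_natDegree_eq R hf hℓ.one_lt]
  · exact nodup_roots (galois_poly_separable ℓ _ (dvd_pow_self ℓ hf))

theorem X_pow_sub_X_monic_natDegree {O : Type} [CommRing O] [Nontrivial O] {q : ℕ} (hq : 1 < q) :
    (X ^ q - X : O[X]).Monic ∧ (X ^ q - X : O[X]).natDegree = q := by
  have hd : (X : O[X]).degree < ((q : ℕ) : WithBot ℕ) := by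
    rw [degree_X]; exact_mod_cast hq
  refine ⟨monic_X_pow_sub hd, ?_⟩
  rw [natDegree_sub_eq_left_of_natDegree_lt (by simpa using hq), natDegree_X_pow]

/-- Teichmüller lifts of the roots of unity in `R` are all the roots of `X ^ q - X`. -/
theorem exists_teichmuller_eq [CharP R ℓ] {L : Type} [Field L] {alg : WittVector ℓ R →+* L}
    (halg : Function.Injective alg) {f : ℕ} (hf : f ≠ 0) {μ : L} (hμ : μ ^ ℓ ^ f = μ) :
    ∃ x : R, μ = alg (WittVector.teichmuller ℓ x) := by
  have hℓ : ℓ.Prime := Fact.out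
  have hT : Function.Injective (WittVector.teichmuller ℓ : R → WittVector ℓ R) := fun x y h => by
    rw [← WittVector.teichmuller_coeff_zero ℓ x, h, WittVector.teichmuller_coeff_zero]
  obtain ⟨hm, hd⟩ := X_pow_sub_X_monic_natDegree (O := L) (Nat.one_lt_pow hf hℓ.one_lt)
  obtain ⟨hc, hn⟩ := roots_X_pow_sub_X_card (ℓ := ℓ) (R := R) hf
  set s := (X ^ ℓ ^ f - X : R[X]).roots.map fun x => alg (WittVector.teichmuller ℓ x)
  have hs : s ≤ (X ^ ℓ ^ f - X : L[X]).roots := by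
    refine (Multiset.le_iff_subset (hn.map (halg.comp hT))).2 fun y hy => ?_
    obtain ⟨x, hx, rfl⟩ := Multiset.mem_map.1 hy
    rw [mem_roots hm.ne_zero, IsRoot.def, eval_sub, eval_pow, eval_X]
    show alg (WittVector.teichmuller ℓ x) ^ ℓ ^ f - alg (WittVector.teichmuller ℓ x) = 0
    rw [← map_pow, ← map_pow]
    rw [mem_roots', IsRoot.def, eval_sub, eval_pow, eval_X] at hx
    rw [sub_eq_zero.1 hx.2, sub_self]
  have hμ' : μ ∈ (X ^ ℓ ^ f - X : L[X]).roots := by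
    rw [mem_roots hm.ne_zero, IsRoot.def, eval_sub, eval_pow, eval_X, hμ, sub_self]
  rw [← Multiset.eq_of_le_of_card_le hs (by
    rw [Multiset.card_map, hc]; exact (card_roots' _).trans hd.le)] at hμ'
  obtain ⟨x, -, hx⟩ := Multiset.mem_map.1 hμ'
  exact ⟨x, hx.symm⟩

variable {I : Type} [Fintype I] [DecidableEq I]

/-- The Brauer trace of a matrix: the sum of the Teichmüller lifts of its eigenvalues. -/
noncomputable def brauerTrace (ℓ : ℕ) [Fact ℓ.Prime] (A : Matrix I I R) : WittVector ℓ R :=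
  (A.charpoly.roots.map (WittVector.teichmuller ℓ)).sum

theorem pow_eq_self_of_isRoot_charpoly {L : Type} [Field L] {A : Matrix I I L} {q : ℕ}
    (hA : A ^ q = A) {μ : L} (hμ : A.charpoly.IsRoot μ) : μ ^ q = μ := by
  obtain ⟨v, hv, hv0⟩ : ∃ v, A *ᵥ v = μ • v ∧ v ≠ 0 := by
    rw [IsRoot.def, Matrix.eval_charpoly] at hμ
    obtain ⟨v, hv0, hv⟩ := Matrix.exists_mulVec_eq_zero_iff.2 hμ
    refine ⟨v, ?_, hv0⟩
    rw [Matrix.sub_mulVec, sub_eq_zero] at hv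
    rw [← hv]
    ext i
    simp [Matrix.scalar_apply, Matrix.mulVec_diagonal]
  have hpow : ∀ j, (A ^ j) *ᵥ v = μ ^ j • v := fun j => by
    induction j with
    | zero => simp
    | succ j ih => rw [pow_succ', ← Matrix.mulVec_mulVec, ih, Matrix.mulVec_smul, hv, smul_smul,
        pow_succ]
  have h := hpow q
  rw [hA, hv] at h
  exact (smul_left_injective L hv0 h).symm

/-- The trace of a Witt vector matrix satisfying `u ^ q = u` is the Brauer trace of its
reduction. -/
theorem trace_eq_brauerTrace [CharP R ℓ] {f : ℕ} (hf : f ≠ 0) {u : Matrix I I (WittVector ℓ R)}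
    (hu : u ^ ℓ ^ f = u) : u.trace = brauerTrace ℓ (u.map WittVector.constantCoeff) := by
  let L := AlgebraicClosure (FractionRing (WittVector ℓ R))
  let alg : WittVector ℓ R →+* L := (algebraMap (FractionRing (WittVector ℓ R)) L).comp
    (algebraMap (WittVector ℓ R) (FractionRing (WittVector ℓ R)))
  have halg : Function.Injective alg :=
    (algebraMap (FractionRing (WittVector ℓ R)) L).injective.comp (IsFractionRing.injective _ _)
  have hu' : alg.mapMatrix u ^ ℓ ^ f = alg.mapMatrix u := by rw [← map_pow, hu]
  have hroot : ∀ μ ∈ (alg.mapMatrix u).charpoly.roots,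
      ∃ x : R, μ = alg (WittVector.teichmuller ℓ x) := fun μ hμ =>
    exists_teichmuller_eq halg hf
      (pow_eq_self_of_isRoot_charpoly hu' (isRoot_of_mem_roots hμ))
  choose! c hc using hroot
  set s := (alg.mapMatrix u).charpoly.roots.map c
  have hs : s.map (fun x => alg (WittVector.teichmuller ℓ x)) =
      (alg.mapMatrix u).charpoly.roots := by
    rw [Multiset.map_map]
    conv_rhs => rw [← Multiset.map_id (alg.mapMatrix u).charpoly.roots]
    exact Multiset.map_congr rfl fun μ hμ => (hc μ hμ).symm
  have hchar : u.charpoly = ((s.map (WittVector.teichmuller ℓ)).map fun x => X - C x).prod := by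
    apply Polynomial.map_injective alg halg
    rw [Polynomial.map_multiset_prod, Multiset.map_map, Multiset.map_map, ← Matrix.charpoly_map]
    change (alg.mapMatrix u).charpoly = _
    rw [(IsAlgClosed.splits (alg.mapMatrix u).charpoly).eq_prod_roots_of_monic
        (Matrix.charpoly_monic _)]
    conv_lhs => rw [← hs]
    rw [Multiset.map_map]
    congr 1
    exact Multiset.map_congr rfl fun x _ => by simp
  have hred : (u.map WittVector.constantCoeff).charpoly = (s.map fun x => X - C x).prod := by
    have : (u.map WittVector.constantCoeff).charpoly = u.charpoly.map WittVector.constantCoeff :=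
      Matrix.charpoly_map _ _
    rw [this, hchar, Polynomial.map_multiset_prod, Multiset.map_map, Multiset.map_map]
    congr 1
    refine Multiset.map_congr rfl fun x _ => ?_
    have : WittVector.constantCoeff (WittVector.teichmuller ℓ x) = x :=
      WittVector.teichmuller_coeff_zero ℓ x
    simp [this]
  rw [brauerTrace, hred, roots_multiset_prod_X_sub_C,
    Matrix.trace_eq_sum_roots_charpoly_of_splits, hchar, roots_multiset_prod_X_sub_C]
  rw [hchar]
  exact Splits.multisetProd (by
    intro g hg
    obtain ⟨x, -, rfl⟩ := Multiset.mem_map.1 hg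
    exact Splits.X_sub_C x)

end BrauerTrace

section IdempotentLifting

variable {I : Type} [Fintype I] [DecidableEq I]

theorem mul_permMatrixHom_apply {O : Type} [CommRing O] (E : Matrix I I O) (γ : Equiv.Perm I)
    (x y : I) : (E * permMatrixHom γ : Matrix I I O) x y = E x (γ y) := by
  rw [permMatrixHom_apply, PEquiv.mul_toMatrix_toPEquiv]
  rfl

theorem permMatrixHom_commute {O : Type} [CommRing O] {E : Matrix I I O} {γ : Equiv.Perm I} :
    Commute E (permMatrixHom γ) ↔ ∀ x y, E (γ x) (γ y) = E x y := by
  have hl : ∀ x y, (permMatrixHom γ * E : Matrix I I O) x y = E (γ⁻¹ x) y := fun x y => by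
    rw [permMatrixHom_apply, PEquiv.toMatrix_toPEquiv_mul]
    rfl
  constructor
  · intro h x y
    have := congrFun (congrFun h.eq (γ x)) y
    rw [mul_permMatrixHom_apply, hl, Equiv.Perm.inv_def, Equiv.symm_apply_apply] at this
    exact this
  · intro h
    ext x y
    rw [mul_permMatrixHom_apply, hl, ← h (γ⁻¹ x), Equiv.Perm.inv_def, Equiv.apply_symm_apply]

theorem permMatrixHom_transpose {O : Type} [CommRing O] (γ : Equiv.Perm I) :
    (permMatrixHom γ : Matrix I I O)ᵀ = permMatrixHom γ⁻¹ := by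
  rw [permMatrixHom_apply, permMatrixHom_apply, transpose_permMatrix]

theorem permMatrixHom_map {O R : Type} [CommRing O] [CommRing R] (f : O →+* R)
    (γ : Equiv.Perm I) : (permMatrixHom γ : Matrix I I O).map f = permMatrixHom γ := by
  rw [permMatrixHom_apply, permMatrixHom_apply, Equiv.Perm.permMatrix, PEquiv.map_toMatrix]

variable {ℓ : ℕ} [Fact ℓ.Prime] {R : Type} [Field R] [CharP R ℓ] [IsAlgClosed R]

theorem natCast_dvd_iff_constantCoeff {x : WittVector ℓ R} :
    (ℓ : WittVector ℓ R) ∣ x ↔ WittVector.constantCoeff x = 0 := by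
  rw [← Ideal.mem_span_singleton, ← WittVector.ker_constantCoeff, RingHom.mem_ker]

theorem matrix_natCast_dvd_sub_iff {A B : Matrix I I (WittVector ℓ R)} :
    (ℓ : Matrix I I (WittVector ℓ R)) ∣ A - B ↔
      A.map WittVector.constantCoeff = B.map WittVector.constantCoeff := by
  rw [matrix_natCast_dvd_iff]
  simp only [natCast_dvd_iff_constantCoeff, Matrix.sub_apply, map_sub, sub_eq_zero]
  exact ⟨fun h => by ext i j; exact h i j, fun h i j => congrFun (congrFun h i) j⟩

instance charZero_wittVector : CharZero (WittVector ℓ R) := by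
  have hℓ : ℓ.Prime := Fact.out
  refine charZero_of_inj_zero fun n hn => ?_
  by_contra h0
  obtain ⟨j, s, hs, rfl⟩ := Nat.exists_eq_pow_mul_and_not_dvd h0 ℓ hℓ.ne_one
  rw [Nat.cast_mul, Nat.cast_pow] at hn
  have h1 := (mul_eq_zero.1 hn).resolve_left (pow_ne_zero _ (WittVector.p_nonzero ℓ R))
  apply hs
  rw [← CharP.cast_eq_zero_iff R ℓ, ← map_natCast (WittVector.constantCoeff (p := ℓ) (R := R)), h1,
    map_zero]

theorem exists_lift_pow_eq_self {f : ℕ} (hf : f ≠ 0) {A : Matrix I I R} (hA : A ^ ℓ ^ f = A) :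
    ∃ u : Matrix I I (WittVector ℓ R), u ^ ℓ ^ f = u ∧ u.map WittVector.constantCoeff = A ∧
      ∀ γ : Equiv.Perm I, (∀ x y, A (γ x) (γ y) = A x y) → ∀ x y, u (γ x) (γ y) = u x y := by
  let a : Matrix I I (WittVector ℓ R) := A.map (WittVector.teichmuller ℓ)
  have ha : a.map WittVector.constantCoeff = A := by
    ext x y
    exact WittVector.teichmuller_coeff_zero ℓ (A x y)
  obtain ⟨u, hu, hua, hc⟩ := exists_pow_eq_self_of_dvd (a := a) (Fact.out : ℓ.Prime) hf (by
    rw [matrix_natCast_dvd_sub_iff, ha]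
    refine (map_pow (WittVector.constantCoeff (p := ℓ) (R := R)).mapMatrix a _).trans ?_
    exact (congrArg (· ^ ℓ ^ f) ha).trans hA)
  refine ⟨u, hu, (matrix_natCast_dvd_sub_iff.1 hua).trans ha, fun γ hγ => ?_⟩
  exact permMatrixHom_commute.1 (hc _ (permMatrixHom_commute.2 fun x y => by
    simp only [a, Matrix.map_apply, hγ]))

/-- Lifting of idempotent matrices to Witt vectors, compatibly with permutations of the
indices. -/
theorem exists_lift_idempotent {A : Matrix I I R} (hA : A * A = A) :
    ∃ E : Matrix I I (WittVector ℓ R), E * E = E ∧ E.map WittVector.constantCoeff = A ∧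
      ∀ γ : Equiv.Perm I, (∀ x y, A (γ x) (γ y) = A x y) → ∀ x y, E (γ x) (γ y) = E x y := by
  have hA' : IsIdempotentElem A := hA
  have hℓ : ℓ.Prime := Fact.out
  obtain ⟨u, hu, hua, hγ⟩ := exists_lift_pow_eq_self (ℓ := ℓ) one_ne_zero
    (hA'.pow_eq (pow_ne_zero 1 hℓ.ne_zero))
  rw [pow_one] at hu
  obtain ⟨m, rfl⟩ : ∃ m, ℓ = m + 1 := ⟨ℓ - 1, by have := hℓ.pos; omega⟩
  have hm : m ≠ 0 := by rintro rfl; exact hℓ.ne_one rfl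
  refine ⟨u ^ m, ?_, ?_, fun γ h => ?_⟩
  · obtain ⟨s, rfl⟩ := Nat.exists_eq_succ_of_ne_zero hm
    calc u ^ (s + 1) * u ^ (s + 1) = u ^ s * u ^ (s + 1 + 1) := by
          rw [← pow_add, ← pow_add]; congr 1; omega
      _ = u ^ (s + 1) := by rw [hu, pow_succ]
  · refine (map_pow WittVector.constantCoeff.mapMatrix u _).trans ?_
    exact (congrArg (· ^ m) hua).trans (hA'.pow_eq hm)
  · exact permMatrixHom_commute.1 ((permMatrixHom_commute.2 (hγ γ h)).pow_left m)

theorem sum_apply_eq_zero {E : Matrix I I (WittVector ℓ R)} (hE : E * E = E)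
    {γ : Equiv.Perm I} (hγ : ∀ x y, E (γ x) (γ y) = E x y)
    (h : ∀ s x, (γ ^ s) x = x → ℓ ∣ s) : ∑ x, E x (γ x) = 0 := by
  have hℓ : ℓ.Prime := Fact.out
  refine eq_zero_of_forall_pow_dvd (ℓ := ℓ) fun N => ?_
  have := dvd_sum_pow_apply hℓ hγ h N
  rw [IsIdempotentElem.pow_eq (show IsIdempotentElem E from hE) (pow_ne_zero N hℓ.ne_zero)] at this
  exact (Nat.cast_dvd_cast (pow_dvd_pow ℓ N.le_succ)).trans this

theorem exists_pow_eq_self_of_pow_eq_one (ℓ : ℕ) {m : ℕ} (hm : 0 < m) (hℓm : ℓ.Coprime m) :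
    ∃ f, f ≠ 0 ∧ ∀ {G : Type} [Monoid G] {g : G}, g ^ m = 1 → g ^ ℓ ^ f = g := by
  refine ⟨m.totient, (Nat.totient_pos.2 hm).ne', fun {G} _ {g} hg => ?_⟩
  have h : ℓ ^ m.totient % m = 1 % m := Nat.ModEq.pow_totient hℓm
  rw [pow_eq_pow_mod _ hg, h, ← pow_eq_pow_mod _ hg, pow_one]

theorem sum_apply_eq_brauerTrace {E : Matrix I I (WittVector ℓ R)} (hE : E * E = E)
    {γ : Equiv.Perm I} (hγ : ∀ x y, E (γ x) (γ y) = E x y) {m : ℕ} (hm : 0 < m)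
    (hℓm : ℓ.Coprime m) (hγm : γ ^ m = 1) :
    ∑ x, E x (γ x) =
      brauerTrace ℓ (E.map WittVector.constantCoeff * permMatrixHom γ : Matrix I I R) := by
  have hℓ : ℓ.Prime := Fact.out
  obtain ⟨f, hf, hf'⟩ := exists_pow_eq_self_of_pow_eq_one ℓ hm hℓm
  have hu : (E * permMatrixHom γ) ^ ℓ ^ f = E * permMatrixHom γ := by
    rw [(permMatrixHom_commute.2 hγ).mul_pow, ← map_pow, hf' hγm,
      IsIdempotentElem.pow_eq (show IsIdempotentElem E from hE) (pow_ne_zero f hℓ.ne_zero)]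
  rw [← permMatrixHom_map (WittVector.constantCoeff (p := ℓ) (R := R)), ← Matrix.map_mul,
    ← trace_eq_brauerTrace hf hu]
  exact Finset.sum_congr rfl fun x _ => (mul_permMatrixHom_apply E γ x x).symm

end IdempotentLifting

section FreeAction

variable {Γ I : Type} [Group Γ] [Finite Γ] [Fintype I] [DecidableEq I] {τ : Γ →* Equiv.Perm I}
  {ℓ : ℕ} [Fact ℓ.Prime] {R : Type} [Field R] [CharP R ℓ] [IsAlgClosed R]
  {E : Matrix I I (WittVector ℓ R)}

omit [Finite Γ] in
theorem sum_apply_eq_zero_of_dvd_orderOf (hτ : ∀ g x, τ g x = x → g = 1) (hE : E * E = E)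
    (hinv : ∀ g x y, E (τ g x) (τ g y) = E x y) {g : Γ} (hg : ℓ ∣ orderOf g) :
    ∑ x, E x (τ g x) = 0 :=
  sum_apply_eq_zero hE (hinv g) fun s x hs => hg.trans <| orderOf_dvd_of_pow_eq_one <|
    hτ _ x (by rw [map_pow]; exact hs)

theorem sum_apply_eq_brauerTrace_of_not_dvd_orderOf (hE : E * E = E)
    (hinv : ∀ g x y, E (τ g x) (τ g y) = E x y) {g : Γ} (hg : ¬ ℓ ∣ orderOf g) :
    ∑ x, E x (τ g x) =
      brauerTrace ℓ (E.map WittVector.constantCoeff * permMatrixHom (τ g) : Matrix I I R) :=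
  sum_apply_eq_brauerTrace hE (hinv g) (orderOf_pos g)
    (((Fact.out : ℓ.Prime).coprime_iff_not_dvd).2 hg)
    (by rw [← map_pow, pow_orderOf_eq_one, map_one])

/-- If an invariant idempotent is conjugate to its transpose, then the character it defines is
real. -/
theorem sum_apply_inv (hτ : ∀ g x, τ g x = x → g = 1) (hE : E * E = E)
    (hinv : ∀ g x y, E (τ g x) (τ g y) = E x y) {X Y : Matrix I I R}
    (hX : ∀ g x y, X (τ g x) (τ g y) = X x y)
    (hXY : X * Y = E.map WittVector.constantCoeff)
    (hYX : Y * X = (E.map WittVector.constantCoeff)ᵀ) (g : Γ) :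
    ∑ x, E x (τ g⁻¹ x) = ∑ x, E x (τ g x) := by
  by_cases hg : ℓ ∣ orderOf g
  · rw [sum_apply_eq_zero_of_dvd_orderOf hτ hE hinv hg,
      sum_apply_eq_zero_of_dvd_orderOf hτ hE hinv (by rwa [orderOf_inv])]
  · rw [sum_apply_eq_brauerTrace_of_not_dvd_orderOf hE hinv hg,
      sum_apply_eq_brauerTrace_of_not_dvd_orderOf hE hinv (by rwa [orderOf_inv])]
    set A := E.map WittVector.constantCoeff
    have hA : ∀ g x y, A (τ g x) (τ g y) = A x y := fun g x y => by
      simp only [A, Matrix.map_apply, hinv]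
    have h : (A * permMatrixHom (τ g⁻¹)).charpoly = (A * permMatrixHom (τ g)).charpoly := by
      calc (A * permMatrixHom (τ g⁻¹)).charpoly
          = ((permMatrixHom (τ g) : Matrix I I R)ᵀ * A).charpoly := by
            rw [Matrix.charpoly_mul_comm, permMatrixHom_transpose, map_inv]
        _ = (Aᵀ * permMatrixHom (τ g)).charpoly := by
            rw [← Matrix.charpoly_transpose, Matrix.transpose_mul, Matrix.transpose_transpose]
        _ = (A * permMatrixHom (τ g)).charpoly := by
            rw [← hYX, ← hXY, Matrix.mul_assoc, (permMatrixHom_commute.2 (hX g)).eq,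
              ← Matrix.mul_assoc, Matrix.charpoly_mul_comm, ← Matrix.mul_assoc]
    rw [brauerTrace, brauerTrace, h]

omit [Finite Γ] in
/-- An invariant idempotent over Witt vectors, right multiplication by which kills the sums over a
subgroup of order prime to `ℓ` modulo `ℓ`, kills them. -/
theorem sum_permMatrixHom_mul_eq_zero (hE : E * E = E)
    (hinv : ∀ g x y, E (τ g x) (τ g y) = E x y) {U : Type} [Group U] [Fintype U] (j : U →* Γ)
    (hU : (Fintype.card U : R) ≠ 0)
    (hsum : ∀ a b, ∑ u, WittVector.constantCoeff (E a (τ (j u) b)) = 0) :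
    (∑ u, permMatrixHom (τ (j u))) * E = 0 := by
  have hℓ : ℓ.Prime := Fact.out
  set G₀ : Matrix I I (WittVector ℓ R) := ∑ u, permMatrixHom (τ (j u)) with hG₀
  have hcomm : Commute E G₀ :=
    Commute.sum_right _ _ _ fun u _ => permMatrixHom_commute.2 (hinv (j u))
  have hsq : G₀ * G₀ = Fintype.card U • G₀ := by
    have : ∀ u, permMatrixHom (τ (j u)) * G₀ = G₀ := fun u => by
      rw [hG₀, Finset.mul_sum]
      refine Fintype.sum_equiv (Equiv.mulLeft u) _ _ fun w => ?_
      rw [Equiv.coe_mulLeft, map_mul, map_mul, map_mul]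
    conv_lhs => enter [1]; rw [hG₀]
    rw [Finset.sum_mul, Finset.sum_congr rfl fun u _ => this u, Finset.sum_const, Finset.card_univ]
  have hG : (G₀ * E) * (G₀ * E) = Fintype.card U • (G₀ * E) := by
    rw [mul_assoc, ← mul_assoc E, hcomm.eq, mul_assoc, hE, ← mul_assoc, hsq, smul_mul_assoc]
  have hcop : ∀ N, IsCoprime ((ℓ ^ N : ℕ) : WittVector ℓ R) (Fintype.card U : WittVector ℓ R) := by
    intro N
    have : (ℓ ^ N).Coprime (Fintype.card U) := by
      refine Nat.Coprime.pow_left N ((hℓ.coprime_iff_not_dvd).2 ?_)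
      rwa [← CharP.cast_eq_zero_iff R ℓ]
    simpa using this.isCoprime.map (Int.castRingHom (WittVector ℓ R))
  have hdvd : ∀ N, ((ℓ ^ (N + 1) : ℕ) : Matrix I I (WittVector ℓ R)) ∣ G₀ * E := fun N => by
    induction N with
    | zero =>
      rw [zero_add, pow_one, ← sub_zero (G₀ * E), matrix_natCast_dvd_sub_iff, ← hcomm.eq]
      ext a b
      rw [Matrix.map_apply, hG₀, Finset.mul_sum, Matrix.sum_apply, map_sum]
      simp only [mul_permMatrixHom_apply, hsum, Matrix.map_apply, Matrix.zero_apply, map_zero]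
    | succ N ih =>
      have h2 : ((ℓ ^ (N + 2) : ℕ) : Matrix I I (WittVector ℓ R)) ∣
          Fintype.card U • (G₀ * E) := by
        obtain ⟨c, hc⟩ := ih
        rw [← hG]
        nth_rewrite 1 [hc]
        rw [hc]
        refine (Nat.cast_dvd_cast (?_ : ℓ ^ (N + 2) ∣ ℓ ^ (N + 1) * ℓ ^ (N + 1))).trans
          ⟨c * c, ?_⟩
        · rw [← pow_add]
          exact pow_dvd_pow _ (by omega)
        · rw [Nat.cast_mul, mul_assoc, mul_assoc, ← mul_assoc c, ← (Nat.cast_commute _ c).eq,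
            mul_assoc]
      rw [matrix_natCast_dvd_iff] at h2 ⊢
      intro a b
      refine (hcop (N + 2)).dvd_of_dvd_mul_left ?_
      rw [← nsmul_eq_mul]
      exact h2 a b
  exact matrix_eq_zero_of_forall_pow_dvd (ℓ := ℓ) fun N =>
    (Nat.cast_dvd_cast (pow_dvd_pow ℓ N.le_succ)).trans (hdvd N)

end FreeAction

section RangeRepresentation

variable {Γ I K : Type} [Group Γ] [Fintype I] [DecidableEq I] [Field K]

/-- The permutation representation attached to an action by permutations. -/
noncomputable def permRepresentation (K : Type) [Field K] (τ : Γ →* Equiv.Perm I) :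
    Representation K Γ (I → K) :=
  ((Matrix.toLinAlgEquiv' : Matrix I I K ≃ₐ[K] _) : Matrix I I K →* _).comp
    (permMatrixHom.comp τ)

theorem permRepresentation_apply (τ : Γ →* Equiv.Perm I) (g : Γ) (v : I → K) :
    permRepresentation K τ g v = (permMatrixHom (τ g) : Matrix I I K) *ᵥ v := rfl

theorem exists_range_representation {τ : Γ →* Equiv.Perm I} {E : Matrix I I K} (hE : E * E = E)
    (hinv : ∀ g x y, E (τ g x) (τ g y) = E x y) :
    ∃ r : Representation K Γ (LinearMap.range (Matrix.toLin' E)),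
      (∀ g v, (r g v : I → K) = (permMatrixHom (τ g) : Matrix I I K) *ᵥ (v : I → K)) ∧
      ∀ g, r.character g = ∑ x, E x (τ g x) := by
  have hcomm : ∀ g v, E *ᵥ ((permMatrixHom (τ g) : Matrix I I K) *ᵥ v) =
      (permMatrixHom (τ g) : Matrix I I K) *ᵥ (E *ᵥ v) := fun g v => by
    rw [Matrix.mulVec_mulVec, Matrix.mulVec_mulVec, (permMatrixHom_commute.2 (hinv g)).eq]
  have hmem : ∀ g, ∀ v ∈ LinearMap.range (Matrix.toLin' E),
      permRepresentation K τ g v ∈ LinearMap.range (Matrix.toLin' E) := by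
    rintro g _ ⟨w, rfl⟩
    exact ⟨(permMatrixHom (τ g) : Matrix I I K) *ᵥ w, hcomm g w⟩
  refine ⟨{ toFun := fun g => (permRepresentation K τ g).restrict (hmem g)
            map_one' := ?_
            map_mul' := fun g h => ?_ }, fun g v => rfl, fun g => ?_⟩
  · ext v
    simp
  · ext v
    simp
  · let π : (I → K) →ₗ[K] LinearMap.range (Matrix.toLin' E) := (Matrix.toLin' E).rangeRestrict
    let ι : LinearMap.range (Matrix.toLin' E) →ₗ[K] (I → K) := Submodule.subtype _
    have h1 : (permRepresentation K τ g).restrict (hmem g) =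
        (π ∘ₗ permRepresentation K τ g) ∘ₗ ι := by
      ext1 v
      obtain ⟨w, hw⟩ := v.2
      refine Subtype.ext ?_
      show permRepresentation K τ g v = E *ᵥ permRepresentation K τ g v
      rw [← hw, permRepresentation_apply, hcomm, Matrix.toLin'_apply,
        Matrix.mulVec_mulVec w E E, hE]
    show LinearMap.trace K _ ((permRepresentation K τ g).restrict (hmem g)) = _
    rw [h1, LinearMap.trace_comp_comm']
    have h2 : ι ∘ₗ π ∘ₗ permRepresentation K τ g = Matrix.toLin' (E * permMatrixHom (τ g)) := by
      rw [Matrix.toLin'_mul]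
      rfl
    rw [h2, Matrix.trace_toLin'_eq]
    exact Finset.sum_congr rfl fun x _ => mul_permMatrixHom_apply E _ x x

end RangeRepresentation

section Twist

open scoped Kronecker

variable {Γ J : Type} [Group Γ]

/-- Left translations on the second factor of `J × Γ`. -/
def leftPerm (J Γ : Type) [Group Γ] : Γ →* Equiv.Perm (J × Γ) where
  toFun g := Equiv.prodCongr (Equiv.refl J) (Equiv.mulLeft g)
  map_one' := by ext x <;> simp
  map_mul' g h := by ext x <;> simp [mul_assoc]

theorem leftPerm_apply (g : Γ) (x : J × Γ) : leftPerm J Γ g x = (x.1, g * x.2) := rfl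

theorem leftPerm_eq_one {g : Γ} {x : J × Γ} (h : leftPerm J Γ g x = x) : g = 1 :=
  mul_eq_right.1 (congrArg Prod.snd h)

variable {R : Type} [CommRing R] [Fintype Γ] [DecidableEq Γ] [Fintype J] [DecidableEq J]

/-- The matrix `E` twisted by the matrix representation `r`. -/
def twist (r : Γ →* Matrix J J R) (E : Matrix Γ Γ R) : Matrix (J × Γ) (J × Γ) R :=
  Matrix.of fun x y => E x.2 y.2 * r (x.2⁻¹ * y.2) x.1 y.1

omit [Fintype Γ] [DecidableEq Γ] in
theorem twist_leftPerm (r : Γ →* Matrix J J R) {E : Matrix Γ Γ R}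
    (hE : ∀ g x y, E (g * x) (g * y) = E x y) (g : Γ) (x y : J × Γ) :
    twist r E (leftPerm J Γ g x) (leftPerm J Γ g y) = twist r E x y := by
  have h : (g * x.2)⁻¹ * (g * y.2) = x.2⁻¹ * y.2 := by group
  simp only [twist, Matrix.of_apply, leftPerm_apply, hE, h]

theorem blockDiagonal_mul_twist (r : Γ →* Matrix J J R) (E : Matrix Γ Γ R) (g : Γ) :
    blockDiagonal (fun a => r a) * (twist r E * permMatrixHom (leftPerm J Γ g)) =
      (r g ⊗ₖ (E * permMatrixHom (MulAction.toPermHom Γ Γ g))) * blockDiagonal (fun a => r a) := by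
  ext ⟨i, a⟩ ⟨j, b⟩
  have h1 : ∀ (k : J) (c : Γ), (twist r E * permMatrixHom (leftPerm J Γ g) : Matrix _ _ R) (k, c)
      (j, b) = E c (g * b) * r (c⁻¹ * (g * b)) k j := fun k c =>
    mul_permMatrixHom_apply _ _ _ _
  have h2 : ∀ (c d : Γ), (E * permMatrixHom (MulAction.toPermHom Γ Γ g) : Matrix _ _ R) c d =
      E c (g * d) := fun c d => mul_permMatrixHom_apply _ _ _ _
  rw [Matrix.mul_apply, Matrix.mul_apply, Fintype.sum_prod_type, Fintype.sum_prod_type]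
  have h3 : ∀ k, ∑ c, blockDiagonal (fun a => r a) (i, a) (k, c) *
      (twist r E * permMatrixHom (leftPerm J Γ g) : Matrix _ _ R) (k, c) (j, b) =
      E a (g * b) * (r a i k * r (a⁻¹ * (g * b)) k j) := fun k => by
    rw [Finset.sum_eq_single a, h1, blockDiagonal_apply_eq]
    · ring
    · intro c _ hc
      rw [blockDiagonal_apply_ne _ _ _ hc.symm, zero_mul]
    · simp
  have h4 : ∀ k, ∑ c, (r g ⊗ₖ (E * permMatrixHom (MulAction.toPermHom Γ Γ g)) :
      Matrix _ _ R) (i, a) (k, c) * blockDiagonal (fun a => r a) (k, c) (j, b) =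
      E a (g * b) * (r g i k * r b k j) := fun k => by
    rw [Finset.sum_eq_single b, kronecker_apply, h2, blockDiagonal_apply_eq]
    · ring
    · intro c _ hc
      rw [blockDiagonal_apply_ne _ _ _ hc, mul_zero]
    · simp
  simp only [h3, h4]
  rw [← Finset.mul_sum, ← Finset.mul_sum, ← Matrix.mul_apply, ← Matrix.mul_apply, ← map_mul,
    ← map_mul, mul_inv_cancel_left]

theorem isUnit_blockDiagonal (r : Γ →* Matrix J J R) :
    IsUnit (blockDiagonal fun a => r a) := by
  refine IsUnit.of_mul_eq_one (blockDiagonal fun a => r a⁻¹) ?_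
  rw [← blockDiagonal_mul]
  simp only [← map_mul, mul_inv_cancel, map_one]
  exact blockDiagonal_one

theorem twist_mul_self (r : Γ →* Matrix J J R) {E : Matrix Γ Γ R} (hE : E * E = E) :
    twist r E * twist r E = twist r E := by
  have h := blockDiagonal_mul_twist r E 1
  simp only [map_one, mul_one] at h
  refine (isUnit_blockDiagonal r).mul_left_cancel ?_
  rw [← mul_assoc, h, mul_assoc, h, ← mul_assoc, ← Matrix.mul_kronecker_mul, hE, mul_one]

theorem charpoly_twist (r : Γ →* Matrix J J R) (E : Matrix Γ Γ R) (g : Γ) :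
    (twist r E * permMatrixHom (leftPerm J Γ g)).charpoly =
      (r g ⊗ₖ (E * permMatrixHom (MulAction.toPermHom Γ Γ g))).charpoly := by
  obtain ⟨D, hD⟩ := isUnit_blockDiagonal r
  rw [← Matrix.charpoly_units_conj D, hD, blockDiagonal_mul_twist, ← hD, mul_assoc,
    ← Matrix.coe_units_inv, Units.mul_inv, mul_one]

omit [DecidableEq Γ] [DecidableEq J] in
/-- The sum over the group of the traces of the translates of an invariant matrix. -/
theorem sum_sum_leftPerm {M : Matrix (J × Γ) (J × Γ) R}
    (hM : ∀ g x y, M (leftPerm J Γ g x) (leftPerm J Γ g y) = M x y) :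
    ∑ g, ∑ x, M x (leftPerm J Γ g x) =
      Fintype.card Γ * (Matrix.of fun i j => ∑ c, M (i, 1) (j, c)).trace := by
  have h : ∀ (i : J) (a : Γ), ∑ g, M (i, a) (leftPerm J Γ g (i, a)) = ∑ c, M (i, 1) (i, c) := by
    intro i a
    refine Fintype.sum_equiv ((Equiv.mulLeft a⁻¹).trans (Equiv.mulRight a)) _ _
      fun g => ?_
    simpa [leftPerm_apply, mul_assoc] using hM a (i, 1) (i, a⁻¹ * (g * a))
  rw [Finset.sum_comm, Fintype.sum_prod_type]
  simp only [h, Finset.sum_const, Finset.card_univ, nsmul_eq_mul]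
  rw [← Finset.mul_sum]
  rfl

omit [DecidableEq Γ] [DecidableEq J] in
theorem augmentation_mul_self {M : Matrix (J × Γ) (J × Γ) R}
    (hM : ∀ g x y, M (leftPerm J Γ g x) (leftPerm J Γ g y) = M x y) (h : M * M = M) :
    (Matrix.of fun i j => ∑ c, M (i, 1) (j, c) : Matrix J J R) *
      (Matrix.of fun i j => ∑ c, M (i, 1) (j, c)) = Matrix.of fun i j => ∑ c, M (i, 1) (j, c) := by
  have h1 : ∀ (k j : J) (c : Γ), ∑ c', M (k, 1) (j, c') = ∑ c', M (k, c) (j, c') := by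
    intro k j c
    refine Fintype.sum_equiv (Equiv.mulLeft c) _ _ fun c' => ?_
    simpa [leftPerm_apply] using (hM c (k, 1) (j, c')).symm
  ext i j
  rw [Matrix.mul_apply]
  simp only [Matrix.of_apply]
  conv_rhs => rw [← h]
  simp only [Matrix.mul_apply, Fintype.sum_prod_type, Finset.sum_mul]
  refine Eq.trans ?_ Finset.sum_comm
  refine Finset.sum_congr rfl fun k _ => ?_
  refine Eq.trans ?_ Finset.sum_comm
  refine Finset.sum_congr rfl fun c _ => ?_
  rw [h1 k j c, Finset.mul_sum]

end Twist

section BrauerCharacter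

variable {J : Type} [Fintype J] [DecidableEq J] {ℓ : ℕ} [Fact ℓ.Prime] {R : Type} [Field R]
theorem isIntegral_brauerTrace {A : Matrix J J R} {q : ℕ} (hq : 1 < q) (hA : A ^ q = A) :
    IsIntegral ℤ (brauerTrace ℓ A) := by
  refine IsIntegral.multiset_sum fun y hy => ?_
  obtain ⟨μ, hμ, rfl⟩ := Multiset.mem_map.1 hy
  have h := pow_eq_self_of_isRoot_charpoly hA (Polynomial.isRoot_of_mem_roots hμ)
  refine ⟨Polynomial.X ^ q - Polynomial.X, (X_pow_sub_X_monic_natDegree hq).1, ?_⟩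
  rw [Polynomial.eval₂_sub, Polynomial.eval₂_X_pow, Polynomial.eval₂_X, ← map_pow, h, sub_self]

theorem brauerTrace_vecMulVec {u v : J → R} (huv : v ⬝ᵥ u = 1) :
    brauerTrace ℓ (vecMulVec u v) = 1 := by
  rcases isEmpty_or_nonempty J with hJ | hJ
  · simp at huv
  obtain ⟨m, hm⟩ : ∃ m, Fintype.card J = m + 1 :=
    Nat.exists_eq_succ_of_ne_zero Fintype.card_ne_zero
  have h : (vecMulVec u v).charpoly =
      Polynomial.X ^ m * (Polynomial.X - Polynomial.C 1) := by
    rw [Matrix.charpoly_vecMulVec, dotProduct_comm, huv, hm, Nat.add_sub_cancel, one_smul,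
      Polynomial.C_1]
    ring
  rw [brauerTrace, h, Polynomial.roots_mul (h ▸ (Matrix.charpoly_monic _).ne_zero),
    Polynomial.roots_X_pow, Polynomial.roots_X_sub_C]
  simp [Multiset.map_nsmul, Multiset.sum_nsmul, WittVector.teichmuller_zero]

end BrauerCharacter

section Modular

open scoped Kronecker

variable {Γ J : Type} [Group Γ] [Fintype Γ] [DecidableEq Γ] [Fintype J] [DecidableEq J] {ℓ : ℕ}
  [Fact ℓ.Prime] {R : Type} [Field R] [CharP R ℓ] [IsAlgClosed R]
  {E : Matrix Γ Γ (WittVector ℓ R)}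

/-- The character of the twist of an invariant idempotent by `r` is the product of the character
of this idempotent by the Brauer character of `r`. -/
theorem sum_twist_apply (hE : E * E = E) (hEinv : ∀ g x y, E (g * x) (g * y) = E x y)
    {r : Γ →* Matrix J J R} {ε : Matrix (J × Γ) (J × Γ) (WittVector ℓ R)} (hε : ε * ε = ε)
    (hεinv : ∀ g x y, ε (leftPerm J Γ g x) (leftPerm J Γ g y) = ε x y)
    (hεr : ε.map WittVector.constantCoeff = twist r (E.map WittVector.constantCoeff)) (g : Γ) :
    ∑ x, ε x (leftPerm J Γ g x) = (∑ a, E a (g * a)) * brauerTrace ℓ (r g) := by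
  have hℓ : ℓ.Prime := Fact.out
  have hfree : ∀ (g x : Γ), MulAction.toPermHom Γ Γ g x = x → g = 1 := fun g x h =>
    mul_eq_right.1 h
  have hEinv' : ∀ g x y, E (MulAction.toPermHom Γ Γ g x) (MulAction.toPermHom Γ Γ g y) = E x y :=
    hEinv
  by_cases hg : ℓ ∣ orderOf g
  · have h := sum_apply_eq_zero_of_dvd_orderOf hfree hE hEinv' hg
    rw [sum_apply_eq_zero_of_dvd_orderOf (fun _ _ => leftPerm_eq_one) hε hεinv hg]
    exact ((congrArg (· * _) h).trans (zero_mul _)).symm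
  rw [sum_apply_eq_brauerTrace_of_not_dvd_orderOf hε hεinv hg, hεr, brauerTrace, charpoly_twist,
    ← brauerTrace]
  obtain ⟨f, hf, hf'⟩ := exists_pow_eq_self_of_pow_eq_one ℓ (orderOf_pos g)
    ((hℓ.coprime_iff_not_dvd).2 hg)
  obtain ⟨v, hv, hvr, -⟩ := exists_lift_pow_eq_self hf (A := r g)
    (by rw [← map_pow, hf' (pow_orderOf_eq_one g)])
  set P : Matrix Γ Γ (WittVector ℓ R) := permMatrixHom (MulAction.toPermHom Γ Γ g)
  have hu : (E * P) ^ ℓ ^ f = E * P := by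
    rw [(permMatrixHom_commute.2 (hEinv' g)).mul_pow, ← map_pow, ← map_pow,
      hf' (pow_orderOf_eq_one g),
      IsIdempotentElem.pow_eq (show IsIdempotentElem E from hE) (pow_ne_zero f hℓ.ne_zero)]
  have hpow : ∀ m, (v ⊗ₖ (E * P)) ^ m = (v ^ m) ⊗ₖ ((E * P) ^ m) := fun m => by
    induction m with
    | zero => simp
    | succ m ih => rw [pow_succ, ih, ← Matrix.mul_kronecker_mul, pow_succ, pow_succ]
  have hmap : (v ⊗ₖ (E * P)).map WittVector.constantCoeff =
      r g ⊗ₖ (E.map WittVector.constantCoeff * permMatrixHom (MulAction.toPermHom Γ Γ g)) := by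
    rw [← hvr, ← permMatrixHom_map (WittVector.constantCoeff (p := ℓ) (R := R)), ← Matrix.map_mul]
    ext ⟨i, a⟩ ⟨j, b⟩
    exact map_mul (WittVector.constantCoeff (p := ℓ) (R := R)) _ _
  rw [← hmap, ← trace_eq_brauerTrace hf (by rw [hpow, hv, hu]), Matrix.trace_kronecker, ← hvr,
    ← trace_eq_brauerTrace hf hv, mul_comm]
  congr 1
  exact Finset.sum_congr rfl fun a _ => mul_permMatrixHom_apply E _ a a

/-- A projective indecomposable module has multiplicity one of its head in its head, as a
statement about Brauer characters. -/
theorem sum_mul_brauerTrace_eq_card (hE : E * E = E)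
    (hEinv : ∀ g x y, E (g * x) (g * y) = E x y) (r : Γ →* Matrix J J R) {u v : J → R}
    (huv : v ⬝ᵥ u = 1)
    (hr : ∑ c, WittVector.constantCoeff (E 1 c) • r c = vecMulVec u v) :
    ∑ g, (∑ a, E a (g * a)) * brauerTrace ℓ (r g) = Fintype.card Γ := by
  have hℓ : ℓ.Prime := Fact.out
  have hE' : E.map WittVector.constantCoeff * E.map WittVector.constantCoeff =
      E.map WittVector.constantCoeff := by
    rw [← Matrix.map_mul, hE]
  obtain ⟨ε, hε, hεr, hεinv⟩ := exists_lift_idempotent (twist_mul_self r hE')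
  have hεinv' : ∀ g x y, ε (leftPerm J Γ g x) (leftPerm J Γ g y) = ε x y := fun g =>
    hεinv _ (twist_leftPerm r (fun g x y => by simp only [Matrix.map_apply, hEinv]) g)
  simp only [← sum_twist_apply hE hEinv hε hεinv' hεr]
  rw [sum_sum_leftPerm hεinv']
  have haug := augmentation_mul_self hεinv' hε
  rw [trace_eq_brauerTrace (ℓ := ℓ) one_ne_zero
    (IsIdempotentElem.pow_eq haug (pow_ne_zero 1 hℓ.ne_zero))]
  have : (Matrix.of fun i j => ∑ c, ε (i, 1) (j, c)).map WittVector.constantCoeff =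
      vecMulVec u v := by
    rw [← hr]
    ext i j
    rw [Matrix.map_apply, Matrix.of_apply, map_sum, Matrix.sum_apply]
    refine Finset.sum_congr rfl fun c _ => ?_
    refine (congrFun (congrFun hεr (i, 1)) (j, c)).trans ?_
    simp [twist]
  rw [this, brauerTrace_vecMulVec huv, mul_one]

end Modular

theorem not_isIntegral_of_two_mul_eq_odd {K : Type} [Field K] [CharZero K] {t : K}
    (ht : IsIntegral ℤ t) {m : ℕ} (hm : Odd m) : (m : K) ≠ 2 * t := by
  intro h
  have h2 : t = algebraMap ℚ K ((m : ℚ) / 2) := by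
    rw [map_div₀, map_natCast, map_ofNat, h, mul_div_cancel_left₀ _ two_ne_zero]
  rw [h2, isIntegral_algebraMap_iff (algebraMap ℚ K).injective] at ht
  obtain ⟨z, hz⟩ := IsIntegrallyClosed.isIntegral_iff.1 ht
  have h3 : ((2 * z : ℤ) : ℚ) = (m : ℤ) := by
    rw [eq_intCast] at hz
    push_cast
    rw [hz]
    ring
  have h4 : 2 * z = (m : ℤ) := by exact_mod_cast h3
  obtain ⟨s, rfl⟩ := hm
  push_cast at h4
  omega

/-- A selfdual simple module, whose projective cover lifts to a cuspidal module in characteristic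
zero, cannot exist if cuspidal irreducible representations in characteristic zero are never
selfdual. -/
theorem false_of_idempotent {Γ J : Type} [Group Γ] [Fintype Γ] [DecidableEq Γ] [Fintype J]
    [DecidableEq J] {R : Type} [Field R] [IsAlgClosed R] {ℓ : ℕ} [Fact ℓ.Prime] [CharP R ℓ]
    {S : Set (Subgroup Γ)}
    (hS : ∀ (K : Type) [Field K] [CharZero K] [IsAlgClosed K], CuspidalVanishing K S)
    (r : Γ →* Matrix J J R) (hr : ∀ g, (r g⁻¹).charpoly = (r g).charpoly)
    {A X Y : Matrix Γ Γ R} (hA : A * A = A) (hAinv : ∀ g x y, A (g * x) (g * y) = A x y)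
    (hXinv : ∀ g x y, X (g * x) (g * y) = X x y) (hXY : X * Y = A) (hYX : Y * X = Aᵀ)
    {u v : J → R} (huv : v ⬝ᵥ u = 1) (hruv : ∑ c, A 1 c • r c = vecMulVec u v)
    (hcusp : ∀ N ∈ S, ∃ (U : Type) (_ : Group U) (_ : Fintype U) (j : U →* Γ), (∀ u, j u ∈ N) ∧
      (Fintype.card U : R) ≠ 0 ∧ ∀ a b, ∑ u, A a (j u * b) = 0) : False := by
  have hℓ : ℓ.Prime := Fact.out
  obtain ⟨E, hE, hEA, hEinv₀⟩ := exists_lift_idempotent (ℓ := ℓ) hA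
  have hEinv : ∀ g x y, E (g * x) (g * y) = E x y := fun g =>
    hEinv₀ (MulAction.toPermHom Γ Γ g) (hAinv g)
  have hfree : ∀ (g x : Γ), MulAction.toPermHom Γ Γ g x = x → g = 1 := fun g x h =>
    mul_eq_right.1 h
  have hEinv' : ∀ g x y, E (MulAction.toPermHom Γ Γ g x) (MulAction.toPermHom Γ Γ g y) = E x y :=
    hEinv
  have hreal := sum_apply_inv hfree hE hEinv' hXinv (hXY.trans hEA.symm)
    (hYX.trans (congrArg transpose hEA.symm))
  let L := AlgebraicClosure (FractionRing (WittVector ℓ R))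
  let alg : WittVector ℓ R →+* L := (algebraMap (FractionRing (WittVector ℓ R)) L).comp
    (algebraMap (WittVector ℓ R) (FractionRing (WittVector ℓ R)))
  have halg : Function.Injective alg :=
    (algebraMap (FractionRing (WittVector ℓ R)) L).injective.comp (IsFractionRing.injective _ _)
  have : CharZero L := ⟨fun m n h => by
    have : alg m = alg n := by rw [map_natCast, map_natCast]; exact h
    exact Nat.cast_injective (halg this)⟩
  have hEL : alg.mapMatrix E * alg.mapMatrix E = alg.mapMatrix E := by rw [← map_mul, hE]
  obtain ⟨ρ, hρ, hχ⟩ := exists_range_representation (τ := MulAction.toPermHom Γ Γ) hEL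
    fun g x y => congrArg alg (hEinv g x y)
  have hχ' : ∀ g, ρ.character g = alg (∑ a, E a (g * a)) := fun g => by
    rw [hχ, map_sum]
    rfl
  obtain ⟨Q⟩ : Nonempty (Sylow 2 Γ) := inferInstance
  obtain ⟨t, ht, hsum⟩ := (hS L).sum_real_character_mul Q.isPGroup'
    (fun g => alg (brauerTrace ℓ (r g)))
    (fun g => map_isIntegral_int alg (isIntegral_brauerTrace (q := orderOf g + 1)
      (by have := orderOf_pos g; omega)
      (by rw [← map_pow, pow_succ, pow_orderOf_eq_one, one_mul])))
    (fun x g => by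
      have : (r (x * g * x⁻¹)).charpoly = (r g).charpoly := by
        rw [map_mul, Matrix.charpoly_mul_comm, ← map_mul, inv_mul_cancel_left]
      simp only [brauerTrace, this])
    (fun g => by simp only [brauerTrace, hr]) _ _ ρ rfl
    (fun N hN w hw => by
      obtain ⟨U, _, _, j, hj, hU, hz⟩ := hcusp N hN
      have h0 := sum_permMatrixHom_mul_eq_zero hE hEinv' j hU fun a b => by
        rw [← hz a b]
        exact Finset.sum_congr rfl fun u _ => congrFun (congrFun hEA a) _
      have h1 : (∑ u, permMatrixHom (MulAction.toPermHom Γ Γ (j u))) * alg.mapMatrix E = 0 := by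
        have := congrArg alg.mapMatrix h0
        rw [map_mul, map_sum, map_zero] at this
        rw [← this]
        congr 1
        exact Finset.sum_congr rfl fun u _ => (permMatrixHom_map alg _).symm
      obtain ⟨w', hw'⟩ := w.2
      have h2 : Fintype.card U • (w : Γ → L) = 0 := by
        calc Fintype.card U • (w : Γ → L) = ∑ u : U, (ρ (j u) w : Γ → L) := by
              simp only [hw _ (hj _), Finset.sum_const, Finset.card_univ]
          _ = ((∑ u, permMatrixHom (MulAction.toPermHom Γ Γ (j u))) * alg.mapMatrix E) *ᵥ w' := by
              rw [← Matrix.mulVec_mulVec, ← Matrix.toLin'_apply (alg.mapMatrix E), hw',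
                Matrix.sum_mulVec]
              simp only [hρ]
          _ = 0 := by rw [h1, Matrix.zero_mulVec]
      refine Subtype.ext ((smul_eq_zero.1 h2).resolve_left ?_)
      exact Fintype.card_ne_zero)
    (fun g => by
      rw [hχ', hχ']
      exact congrArg alg (hreal g))
  simp only [hχ', ← map_mul] at hsum
  rw [← map_sum, sum_mul_brauerTrace_eq_card hE hEinv r huv (by
    rw [← hruv]
    exact Finset.sum_congr rfl fun c _ => congrArg (· • r c) (congrFun (congrFun hEA 1) c)),
    map_natCast, ← Nat.card_eq_fintype_card, ← Subgroup.card_mul_index (Q : Subgroup Γ),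
    Nat.cast_mul, mul_comm (2 : L), mul_assoc] at hsum
  refine not_isIntegral_of_two_mul_eq_odd ht (m := (Q : Subgroup Γ).index) ?_
    (mul_left_cancel₀ (Nat.cast_ne_zero.2 Nat.card_pos.ne') hsum)
  rw [← Nat.not_even_iff_odd, even_iff_two_dvd]
  exact Q.not_dvd_index

section Reduction

variable {k : Type} [Field k] {n : ℕ}

theorem isPGroup_unipotentRadical (p : ℕ) [Fact p.Prime] [CharP k p]
    (W : Submodule k (Fin n → k)) : IsPGroup p (unipotentRadical W) := by
  rintro ⟨g, hg⟩
  refine ⟨1, Subtype.ext (Units.ext ?_)⟩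
  rcases Nat.eq_zero_or_pos n with rfl | hn
  · exact Subsingleton.elim _ _
  have : Nonempty (Fin n) := ⟨⟨0, hn⟩⟩
  have h2 : (2 : ℕ) ≤ p := (Fact.out : p.Prime).two_le
  have hX : (g.1 - 1) ^ p = 0 := by
    obtain ⟨m, rfl⟩ := Nat.exists_eq_add_of_le h2
    rw [pow_add, pow_two, sq_sub_one_eq_zero hg, zero_mul]
  show (g ^ p ^ 1).1 = 1
  rw [pow_one, Units.val_pow_eq_pow_val]
  rw [sub_pow_char_of_commute p (Commute.one_right _), one_pow, sub_eq_zero] at hX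
  exact hX

theorem card_unipotentRadical_ne_zero [Finite k] {p : ℕ} [Fact p.Prime] [CharP k p] {R : Type}
    [Field R] (hchar : ringChar R ≠ p) (W : Submodule k (Fin n → k)) :
    (Nat.card (unipotentRadical W) : R) ≠ 0 := by
  obtain ⟨m, hm⟩ := IsPGroup.iff_card.1 (isPGroup_unipotentRadical p W)
  rw [hm, Nat.cast_pow]
  refine pow_ne_zero _ fun h => ?_
  rcases (Nat.dvd_prime Fact.out).1 (ringChar.dvd h) with h1 | h1
  · exact CharP.ringChar_ne_one h1
  · exact hchar h1

theorem exists_invariant_form {R G V : Type} [Field R] [Group G] [AddCommGroup V] [Module R V]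
    {ρ : Representation R G V} (hsd : RepIso ρ ρ.dual) :
    ∃ B : V →ₗ[R] V →ₗ[R] R, (∀ g x y, B (ρ g x) (ρ g y) = B x y) ∧ Function.Injective B := by
  obtain ⟨e, he⟩ := hsd
  refine ⟨e.toLinearMap, fun g x y => ?_, e.injective⟩
  show e (ρ g x) (ρ g y) = e x y
  rw [he, Representation.dual_apply, Module.Dual.transpose_apply, LinearMap.comp_apply,
    ← Module.End.mul_apply, ← map_mul, inv_mul_cancel, map_one, Module.End.one_apply]

/-- The homomorphism `g ↦ det g • g`. -/
noncomputable def detSMul : GL (Fin n) k →* GL (Fin n) k where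
  toFun g := Matrix.GeneralLinearGroup.scalar (Fin n) (Matrix.GeneralLinearGroup.det g) * g
  map_one' := by simp
  map_mul' a b := by
    have := Matrix.GeneralLinearGroup.scalar_commute (n := Fin n)
      (Matrix.GeneralLinearGroup.det b) a
    rw [map_mul, map_mul, mul_assoc, mul_assoc, ← mul_assoc a, ← this, mul_assoc]

variable {R V : Type} [Field R] [IsAlgClosed R] [AddCommGroup V] [Module R V]
  {ρ : Representation R (GL (Fin n) k) V}

/-- A selfdual irreducible representation of `GL n k`, for `n` odd, descends to the projective
linear group up to a twist. -/
theorem exists_projRep [Finite k] (hn : Odd n) (hirr : IsIrreducibleRep ρ)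
    {B : V →ₗ[R] V →ₗ[R] R} (hB : ∀ g x y, B (ρ g x) (ρ g y) = B x y)
    (hinj : Function.Injective B) :
    ∃ (ρ' : Representation R (ProjGL k n) V) (χ : GL (Fin n) k →* R),
      IsIrreducibleRep ρ' ∧ (∀ g v, ρ g v = χ g • ρ' g v) ∧
      (∀ g, Matrix.GeneralLinearGroup.det g = 1 → χ g = 1) ∧
      ∀ g x y, B (ρ' g x) (ρ' g y) = B x y := by
  have := nontrivial_of_irreducible hirr
  have := finiteDimensional_of_irreducible hirr
  have hc : ∀ η : kˣ, ∃ c : R, ∀ v, ρ (Matrix.GeneralLinearGroup.scalar (Fin n) η) v = c • v :=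
    fun η => exists_smul_of_commute hirr _ fun g v => by
      rw [← Module.End.mul_apply, ← Module.End.mul_apply, ← map_mul, ← map_mul,
        Matrix.GeneralLinearGroup.scalar_commute η g]
  choose c hc using hc
  obtain ⟨v₀, hv₀⟩ := exists_ne (0 : V)
  have hc1 : c 1 = 1 := smul_left_injective R hv₀ (by
    show c 1 • v₀ = (1 : R) • v₀
    rw [← hc]; simp)
  have hcmul : ∀ a b, c (a * b) = c a * c b := fun a b => smul_left_injective R hv₀ (by
    show c (a * b) • v₀ = (c a * c b) • v₀
    rw [← hc, map_mul, map_mul, Module.End.mul_apply, hc, hc, smul_smul])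
  let C : kˣ →* R := { toFun := c, map_one' := hc1, map_mul' := hcmul }
  obtain ⟨w₀, hw₀⟩ : ∃ w, B v₀ w ≠ 0 := by
    by_contra! h
    exact hv₀ (hinj (by rw [map_zero]; exact LinearMap.ext h))
  have hsq : ∀ η, c η * c η = 1 := fun η => by
    have := hB (Matrix.GeneralLinearGroup.scalar (Fin n) η) v₀ w₀
    rw [hc, hc, map_smul, map_smul, LinearMap.smul_apply, smul_eq_mul, smul_eq_mul,
      ← mul_assoc] at this
    exact mul_right_cancel₀ hw₀ (by rw [this, one_mul])
  have hf : ∀ g v, ρ (detSMul g) v = c (Matrix.GeneralLinearGroup.det g) • ρ g v := fun g v => by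
    show ρ (Matrix.GeneralLinearGroup.scalar (Fin n) _ * g) v = _
    rw [map_mul, Module.End.mul_apply, hc]
  let ρ' : Representation R (ProjGL k n) V := QuotientGroup.lift _ (ρ.comp detSMul) (by
    intro z hz
    rw [Matrix.GeneralLinearGroup.center_eq_range_scalar] at hz
    obtain ⟨η, rfl⟩ := hz
    refine LinearMap.ext fun v => ?_
    show ρ (detSMul _) v = v
    obtain ⟨m, hm⟩ := hn
    rw [hf, hc, smul_smul, Matrix.GeneralLinearGroup.det_scalar, Fintype.card_fin]
    have : c (η ^ n) = c η ^ n := map_pow C η n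
    rw [this, hm, ← pow_succ, show 2 * m + 1 + 1 = 2 * (m + 1) by ring, pow_mul, pow_two, hsq,
      one_pow, one_smul])
  have hρ' : ∀ (g : GL (Fin n) k) v,
      ρ' g v = c (Matrix.GeneralLinearGroup.det g) • ρ g v := hf
  refine ⟨ρ', C.comp Matrix.GeneralLinearGroup.det, ⟨hirr.1, fun W hW => hirr.2 W fun g v hv => ?_⟩,
    fun g v => ?_, fun g hg => ?_, fun g x y => ?_⟩
  · have := W.smul_mem (c (Matrix.GeneralLinearGroup.det g)) (hW g v hv)
    rwa [hρ', smul_smul, hsq, one_smul] at this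
  · show _ = c _ • _
    rw [hρ', smul_smul, hsq, one_smul]
  · show c _ = 1
    rw [hg, hc1]
  · obtain ⟨g, rfl⟩ := QuotientGroup.mk_surjective g
    rw [hρ', hρ', map_smul, map_smul, LinearMap.smul_apply, smul_smul, hsq, one_smul, hB]

end Reduction

section Contradiction

variable {R Γ V : Type} [Field R] [Group Γ] [Fintype Γ] [DecidableEq Γ] [AddCommGroup V]
  [Module R V] {ρ : Representation R Γ V}

theorem isCuspidalFor_of_sum_eq_zero (hρ : IsIrreducibleRep ρ) {e : invMatrices R Γ}
    (he : invMatricesAction ρ e ≠ 0) {S : Set (Subgroup Γ)}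
    (hcusp : ∀ N ∈ S, ∃ (U : Type) (_ : Group U) (_ : Fintype U) (j : U →* Γ), (∀ u, j u ∈ N) ∧
      (Fintype.card U : R) ≠ 0 ∧ ∀ a b, ∑ u, e.1 a (j u * b) = 0) :
    IsCuspidalFor S ρ := by
  intro N hN v hv
  obtain ⟨U, _, _, j, hj, hU, hz⟩ := hcusp N hN
  obtain ⟨w, hw⟩ : ∃ w, invMatricesAction ρ e w ≠ 0 := by
    by_contra! h
    exact he (LinearMap.ext h)
  obtain ⟨X, hX⟩ := exists_invMatricesAction_eq ρ hρ hw v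
  have hmul : ∀ (Y Z : invMatrices R Γ) s t, (Y * Z).1 s t = ∑ d, Y.1 s d * Z.1 d t :=
    fun _ _ _ _ => rfl
  have hzero : ∑ u : U, rowShift (j u) (X * e) = 0 := by
    refine Subtype.ext (Matrix.ext fun a b => ?_)
    have h1 : (∑ u : U, rowShift (j u) (X * e)).1 a b = ∑ u : U, (X * e).1 (a * j u) b := by
      rw [AddSubmonoidClass.coe_finsetSum, Matrix.sum_apply]
      rfl
    have h2 : ∀ u : U, (X * e).1 (a * j u⁻¹) b = ∑ d, X.1 1 d * e.1 d (j u * (a⁻¹ * b)) :=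
      fun u => by
        have : (a * j u⁻¹)⁻¹ * b = j u * (a⁻¹ * b) := by simp [mul_assoc]
        rw [invMatrices_apply (X * e).2, hmul, this]
    rw [h1, ← Equiv.sum_comp (Equiv.inv U)]
    refine (Finset.sum_congr rfl fun u _ => h2 u).trans ?_
    rw [Finset.sum_comm]
    simp only [← Finset.mul_sum, hz, mul_zero, Finset.sum_const_zero]
    rfl
  have h2 : (Fintype.card U : R) • v = 0 := by
    calc (Fintype.card U : R) • v = ∑ u : U, ρ (j u) v := by
          simp only [hv _ (hj _), Finset.sum_const, Finset.card_univ, Nat.cast_smul_eq_nsmul]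
      _ = invMatricesAction ρ (∑ u : U, rowShift (j u) (X * e)) w := by
          rw [map_sum, LinearMap.sum_apply]
          refine Finset.sum_congr rfl fun u _ => ?_
          rw [invMatricesAction_rowShift, map_mul, Module.End.mul_apply, hX]
      _ = 0 := by rw [hzero, map_zero, LinearMap.zero_apply]
  exact (smul_eq_zero.1 h2).resolve_left hU

omit [Fintype Γ] [DecidableEq Γ] in
theorem charpoly_inv_of_invariant_form [FiniteDimensional R V] {B : V →ₗ[R] V →ₗ[R] R}
    (hB : ∀ g x y, B (ρ g x) (ρ g y) = B x y) (hinj : Function.Injective B) (g : Γ) :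
    (ρ g⁻¹).charpoly = (ρ g).charpoly := by
  let E : V ≃ₗ[R] Module.Dual R V := LinearEquiv.ofBijective B ⟨hinj,
    (LinearMap.injective_iff_surjective_of_finrank_eq_finrank
      Subspace.dual_finrank_eq.symm).1 hinj⟩
  have h : E.conj (ρ g⁻¹) = (ρ g).dualMap := by
    refine LinearMap.ext fun φ => LinearMap.ext fun y => ?_
    obtain ⟨x, rfl⟩ := E.surjective φ
    rw [LinearEquiv.conj_apply_apply, LinearEquiv.symm_apply_apply, LinearMap.dualMap_apply]
    show B (ρ g⁻¹ x) y = B x (ρ g y)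
    rw [← hB g, ← Module.End.mul_apply, ← map_mul, mul_inv_cancel, map_one, Module.End.one_apply]
  let b := Module.finBasis R V
  rw [← E.charpoly_conj, h, ← LinearMap.charpoly_toMatrix _ b.dualBasis, LinearMap.dualMap_def,
    LinearMap.toMatrix_transpose, Matrix.charpoly_transpose, LinearMap.charpoly_toMatrix]

variable [IsAlgClosed R]

/-- An irreducible representation with a nondegenerate invariant form cannot afford a primitive
idempotent annihilated by averaging over the subgroups of a vanishing family. -/
theorem IsPrimitiveFor.false_of_invariant_form (hρ : IsIrreducibleRep ρ) {S : Set (Subgroup Γ)}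
    (hS : ∀ (K : Type) [Field K] [CharZero K] [IsAlgClosed K], CuspidalVanishing K S)
    {B : V →ₗ[R] V →ₗ[R] R} (hB : ∀ g x y, B (ρ g x) (ρ g y) = B x y)
    (hinj : Function.Injective B) {e : invMatrices R Γ}
    (he : IsPrimitiveFor (invMatricesAction ρ) e)
    (hcusp : ∀ N ∈ S, ∃ (U : Type) (_ : Group U) (_ : Fintype U) (j : U →* Γ), (∀ u, j u ∈ N) ∧
      (Fintype.card U : R) ≠ 0 ∧ ∀ a b, ∑ u, e.1 a (j u * b) = 0) : False := by
  have := nontrivial_of_irreducible hρ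
  have := finiteDimensional_of_irreducible hρ
  obtain ⟨ℓ, hℓ⟩ := CharP.exists R
  rcases CharP.char_is_prime_or_zero R ℓ with hp | rfl
  · have : Fact ℓ.Prime := ⟨hp⟩
    have hσ : ∀ v : V, v ≠ 0 → ∀ u, ∃ X, invMatricesAction ρ X v = u := fun v hv u =>
      exists_invMatricesAction_eq ρ hρ hv u
    obtain ⟨X, Y, hXY, hYX⟩ := he.exists_factorization hσ invTranspose
      (fun a b => Subtype.ext (Matrix.transpose_mul _ _))
      (fun a => rfl) (fun a ha => by
        have hsep : ∀ y, (∀ x, B x y = 0) → y = 0 := by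
          intro y hy
          refine (Module.forall_dual_apply_eq_zero_iff R y).1 fun φ => ?_
          obtain ⟨x, rfl⟩ := (LinearMap.injective_iff_surjective_of_finrank_eq_finrank
            Subspace.dual_finrank_eq.symm).1 hinj φ
          exact hy x
        refine LinearMap.ext fun y => hsep _ fun x => ?_
        rw [invMatricesAction_invTranspose ρ hB, ha]
        simp)
    obtain ⟨φ, w, hφ, hew⟩ := he.exists_eq_smul hσ
    let b := Module.finBasis R V
    let r : Γ →* Matrix (Fin (Module.finrank R V)) (Fin (Module.finrank R V)) R :=
      (LinearMap.toMatrixAlgEquiv b : Module.End R V →* _).comp ρ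
    refine false_of_idempotent hS r (fun g => ?_) (A := e.1) (X := X.1) (Y := Y.1)
      (u := b.repr w) (v := fun i => φ (b i)) (congrArg Subtype.val he.mul_self) e.2 X.2
      (congrArg Subtype.val hXY) (congrArg Subtype.val hYX) ?_ ?_ hcusp
    · exact (LinearMap.charpoly_toMatrix _ b).trans
        ((charpoly_inv_of_invariant_form hB hinj g).trans (LinearMap.charpoly_toMatrix _ b).symm)
    · rw [← hφ]
      conv_rhs => rw [← b.sum_repr w, map_sum]
      exact Finset.sum_congr rfl fun i _ => by rw [map_smul, smul_eq_mul, mul_comm]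
    · have h : ∑ c, e.1 1 c • r c = LinearMap.toMatrixAlgEquiv b (invMatricesAction ρ e) := by
        have h1 : invMatricesAction ρ e = ∑ c, e.1 1 c • ρ c := rfl
        have h2 : ∀ c, LinearMap.toMatrixAlgEquiv b (e.1 1 c • ρ c) = e.1 1 c • r c := fun c =>
          (LinearMap.toMatrixAlgEquiv b).toLinearMap.map_smul (e.1 1 c) (ρ c)
        rw [h1, map_sum]
        exact Finset.sum_congr rfl fun c _ => (h2 c).symm
      rw [h]
      refine Matrix.ext fun i j => ?_
      rw [LinearMap.toMatrixAlgEquiv_apply, hew, map_smul, Finsupp.smul_apply, smul_eq_mul,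
        Matrix.vecMulVec_apply, mul_comm]
  · have : CharZero R := CharP.charP_to_charZero R
    obtain ⟨v, hv⟩ := exists_ne (0 : V)
    refine hv (hinj ?_)
    rw [(hS R).bilin_eq_zero hρ (isCuspidalFor_of_sum_eq_zero hρ he.map_ne_zero hcusp) B hB]
    rfl

end Contradiction

end SupercuspidalGL

/-- If `GL n k` (`p ≠ 2`) has a selfdual supercuspidal irreducible
representation, then `n = 1` or `n` is even. -/
theorem selfdual_supercuspidal_even
    (p : ℕ) [Fact p.Prime] (hp : p ≠ 2)
    (k : Type) [Field k] [Fintype k] [CharP k p]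
    (R : Type) [Field R] [IsAlgClosed R] (hchar : ringChar R ≠ p)
    (n : ℕ) (V : Type) [AddCommGroup V] [Module R V]
    (ρ : Representation R (GL (Fin n) k) V)
    (hirr : IsIrreducibleRep ρ) (hsc : IsSupercuspidal k ρ)
    (hsd : RepIso ρ ρ.dual) :
    n = 1 ∨ Even n := by
  classical
  open SupercuspidalGL in
  by_contra! h
  obtain ⟨hn1, hn⟩ := h
  rw [Nat.not_even_iff_odd] at hn
  have h2 : (2 : k) ≠ 0 := fun h => by
    have : p ∣ 2 := (CharP.cast_eq_zero_iff k p 2).1 (by exact_mod_cast h)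
    exact hp ((Nat.prime_dvd_prime_iff_eq Fact.out Nat.prime_two).1 this)
  obtain ⟨B, hB, hinj⟩ := exists_invariant_form hsd
  obtain ⟨ρ', χ, hirr', hχ, hdet, hB'⟩ := exists_projRep hn hirr hB hinj
  have := nontrivial_of_irreducible hirr
  let _ : Fintype (ProjGL k n) := Fintype.ofFinite _
  obtain ⟨e, he⟩ := exists_isPrimitiveFor (invMatricesAction ρ')
  refine he.false_of_invariant_form hirr' (fun K _ _ _ =>
    cuspidalVanishing_projUnipotentRadicals h2 hn hn1 K) hB' hinj ?_
  rintro _ ⟨W, hbot, htop, rfl⟩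
  refine ⟨unipotentRadical W, inferInstance, inferInstance,
    (QuotientGroup.mk' _).comp (unipotentRadical W).subtype,
    fun u => Subgroup.mem_map_of_mem _ u.2, ?_, fun a b => ?_⟩
  · rw [← Nat.card_eq_fintype_card]
    exact card_unipotentRadical_ne_zero hchar W
  · convert he.sum_unipotentRadical_eq_zero hsc hirr' (QuotientGroup.mk'_surjective _) hχ hdet
      hbot htop a b
    rfl
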